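/- There exists C > 0 such that |v_ε − B_ε| ≤ C γ_ε⁻¹ and |∇(v_ε − B_ε)| ≤ C γ_ε⁻¹ ρ_ε⁻¹ everywhere in the disk D₀(ρ_ε), for all ε small. -/

import Mathlib

open Metric Set Filter Topology Real MeasureTheory
open scoped RealInnerProductSpace

noncomputable section

/-- Points of the plane. -/
abbrev Pt := EuclideanSpace ℝ (Fin 2)

/-- The geometer's Laplacian `Δu = -(∂²u/∂x² + ∂²u/∂y²)`. -/
def lap (u : Pt → ℝ) (x : Pt) : ℝ :=
  - ∑ i : Fin 2, fderiv ℝ (fun y => fderiv ℝ u y (EuclideanSpace.single i 1)) x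
      (EuclideanSpace.single i 1)

/-- Convergence in `C^k(s)`: uniform convergence on `s` of all derivatives of order `≤ k`. -/
def TendstoCkOn (F : ℕ → Pt → ℝ) (g : Pt → ℝ) (s : Set Pt) (k : ℕ) : Prop :=
  ∀ j : ℕ, j ≤ k → TendstoUniformlyOn (fun n x => iteratedFDeriv ℝ j (F n) x)
    (fun x => iteratedFDeriv ℝ j g x) atTop s

/-- Convergence in `C^k_loc(s)`: locally uniform convergence on `s` of all derivatives of
order `≤ k`. -/
def TendstoCkLocOn (F : ℕ → Pt → ℝ) (g : Pt → ℝ) (s : Set Pt) (k : ℕ) : Prop :=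
  ∀ j : ℕ, j ≤ k → TendstoLocallyUniformlyOn (fun n x => iteratedFDeriv ℝ j (F n) x)
    (fun x => iteratedFDeriv ℝ j g x) atTop s

/-- The standard bubble profile `U(x) = -ln(1 + |x|²/4)`. -/
def Ustd (x : Pt) : ℝ := - Real.log (1 + ‖x‖ ^ 2 / 4)

/-- The point of the plane with coordinates `(a, b)`. -/
def mkPt (a b : ℝ) : Pt := (WithLp.equiv 2 (Fin 2 → ℝ)).symm ![a, b]

/-- Spherical mean `(1/(2πr)) ∫_{∂D(c,r)} v dσ`, written via the parametrization of the
circle of radius `r` around `c`. -/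
def sphAvg (v : Pt → ℝ) (c : Pt) (r : ℝ) : ℝ :=
  (2 * π)⁻¹ * ∫ θ in (0 : ℝ)..(2 * π), v (c + r • mkPt (Real.cos θ) (Real.sin θ))

/-! ### One-variable tools -/

/-- Second derivative test at an interior minimum. -/
theorem secondDeriv_nonneg_of_isLocalMin {f f' : ℝ → ℝ} {x f'' : ℝ}
    (h1 : ∀ᶠ s in 𝓝 x, HasDerivAt f (f' s) s) (h2 : HasDerivAt f' f'' x)
    (hm : IsLocalMin f x) : 0 ≤ f'' := by
  by_contra hneg
  push Not at hneg
  have hd : deriv f =ᶠ[𝓝 x] f' := h1.mono fun s hs => hs.deriv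
  have hdd : deriv (deriv f) x = f'' := by rw [hd.deriv_eq, h2.deriv]
  have hmax : IsLocalMax f x :=
    isLocalMax_of_deriv_deriv_neg (by rw [hdd]; exact hneg) hm.deriv_eq_zero
      h1.self_of_nhds.continuousAt
  have hconst : f =ᶠ[𝓝 x] fun _ => f x := by
    filter_upwards [hm, hmax] with s hs1 hs2 using le_antisymm hs2 hs1
  have hd0 : deriv f =ᶠ[𝓝 x] fun _ => (0 : ℝ) := by
    have := hconst.deriv
    simpa using this
  have : deriv (deriv f) x = 0 := by rw [hd0.deriv_eq]; simp
  linarith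

/-- Comparison of two functions from `-∞` through their derivatives. -/
theorem norm_le_of_norm_deriv_le_of_tendsto_atBot {E : Type*} [NormedAddCommGroup E]
    [NormedSpace ℝ E] {f f' : ℝ → E} {B B' : ℝ → ℝ} {y₁ : ℝ}
    (hf : ∀ y ≤ y₁, HasDerivAt f (f' y) y) (hB : ∀ y ≤ y₁, HasDerivAt B (B' y) y)
    (hle : ∀ y ≤ y₁, ‖f' y‖ ≤ B' y) (h0 : Tendsto f atBot (𝓝 0)) (hpos : ∀ y ≤ y₁, 0 ≤ B y) :
    ∀ y ≤ y₁, ‖f y‖ ≤ B y := by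
  intro y hy
  have key : ∀ s ≤ y, ‖f y - f s‖ ≤ B y := by
    intro s hs
    have h := image_norm_le_of_norm_deriv_right_le_deriv_boundary' (a := s) (b := y)
      (f := fun t => f t - f s) (f' := f') (B := fun t => B t - B s) (B' := B')
      (fun t ht => ((hf t (ht.2.trans hy)).continuousAt.sub
        continuousAt_const).continuousWithinAt)
      (fun t ht => ((hf t (ht.2.le.trans hy)).sub_const _).hasDerivWithinAt)
      (by simp)
      (fun t ht => ((hB t (ht.2.trans hy)).continuousAt.sub
        continuousAt_const).continuousWithinAt)
      (fun t ht => ((hB t (ht.2.le.trans hy)).sub_const _).hasDerivWithinAt)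
      (fun t ht => hle t (ht.2.le.trans hy)) (right_mem_Icc.2 hs)
    linarith [hpos s (hs.trans hy)]
  have hlim : Tendsto (fun s => ‖f y - f s‖) atBot (𝓝 ‖f y‖) := by
    simpa using (tendsto_const_nhds.sub h0).norm
  exact le_of_tendsto hlim ((eventually_le_atBot y).mono key)

/-- A nonnegative continuous function on a half-line vanishing at `-∞` attains its maximum. -/
theorem exists_isMax_Iic {h : ℝ → ℝ} {y₁ : ℝ} (hc : ContinuousOn h (Iic y₁))
    (hn : ∀ y ≤ y₁, 0 ≤ h y) (h0 : Tendsto h atBot (𝓝 0)) :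
    ∃ y ≤ y₁, ∀ s ≤ y₁, h s ≤ h y := by
  by_cases hz : ∀ s ≤ y₁, h s = 0
  · exact ⟨y₁, le_rfl, fun s hs => by rw [hz s hs, hz y₁ le_rfl]⟩
  push Not at hz
  obtain ⟨s₀, hs₀, hne⟩ := hz
  have hpos : 0 < h s₀ := lt_of_le_of_ne (hn s₀ hs₀) (Ne.symm hne)
  obtain ⟨m, hm⟩ := (eventually_atBot.1 (h0.eventually (gt_mem_nhds hpos)))
  have hms : m ≤ s₀ := by
    by_contra hcon
    exact lt_irrefl _ (hm s₀ (not_le.1 hcon).le)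
  obtain ⟨y, hy, hmax⟩ := (isCompact_Icc (a := m) (b := y₁)).exists_isMaxOn
    ⟨s₀, hms, hs₀⟩ (hc.mono fun t ht => ht.2)
  refine ⟨y, hy.2, fun s hs => ?_⟩
  rcases le_total s m with h1 | h1
  · exact (hm s h1).le.trans (hmax ⟨hms, hs₀⟩)
  · exact hmax ⟨h1, hs⟩

/-- The two-ended exponential weight. -/
def wt (κ Y y : ℝ) : ℝ := exp (-κ * |y|) + exp (-κ * (Y - y))

theorem wt_pos (κ Y y : ℝ) : 0 < wt κ Y y := by unfold wt; positivity

/-- A bounded increasing function whose derivative dominates the weight `wt`. -/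
def wtPrim (κ Y y : ℝ) : ℝ := (1 + exp (-κ * y))⁻¹ + exp (-κ * (Y - y))

theorem hasDerivAt_wtPrim (κ Y y : ℝ) :
    HasDerivAt (wtPrim κ Y)
      (κ * (exp (-κ * y) / (1 + exp (-κ * y)) ^ 2 + exp (-κ * (Y - y)))) y := by
  have h1 : HasDerivAt (fun y : ℝ => exp (-κ * y)) (exp (-κ * y) * (-κ * 1)) y :=
    ((hasDerivAt_id y).const_mul (-κ)).exp
  have h2 : HasDerivAt (fun y : ℝ => exp (-κ * (Y - y))) (exp (-κ * (Y - y)) * (-κ * (0 - 1))) y :=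
    (((hasDerivAt_const y Y).sub (hasDerivAt_id y)).const_mul (-κ)).exp
  have h3 := (h1.const_add 1).inv (by positivity)
  refine (h3.add h2).congr_deriv ?_
  have : (1 + exp (-κ * y)) ≠ 0 := by positivity
  field_simp
  ring

theorem wtPrim_nonneg (κ Y y : ℝ) : 0 ≤ wtPrim κ Y y := by unfold wtPrim; positivity

theorem wtPrim_le {κ Y y : ℝ} (hκ : 0 < κ) (hy : y ≤ Y) : wtPrim κ Y y ≤ 2 := by
  unfold wtPrim
  have h1 : (1 + exp (-κ * y))⁻¹ ≤ 1 :=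
    inv_le_one_of_one_le₀ (by linarith [exp_pos (-κ * y)])
  have h2 : exp (-κ * (Y - y)) ≤ 1 := by
    rw [exp_le_one_iff]
    nlinarith
  linarith

theorem wt_le_deriv_wtPrim {κ : ℝ} (hκ : 0 < κ) (Y y : ℝ) :
    wt κ Y y ≤ (4 / κ) *
      (κ * (exp (-κ * y) / (1 + exp (-κ * y)) ^ 2 + exp (-κ * (Y - y)))) := by
  have e1 : (4 / κ) * (κ * (exp (-κ * y) / (1 + exp (-κ * y)) ^ 2 + exp (-κ * (Y - y))))
      = 4 * (exp (-κ * y) / (1 + exp (-κ * y)) ^ 2) + 4 * exp (-κ * (Y - y)) := by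
    field_simp
  rw [e1]
  unfold wt
  have h2 : exp (-κ * |y|) ≤ 4 * (exp (-κ * y) / (1 + exp (-κ * y)) ^ 2) := by
    rw [← mul_div_assoc, le_div_iff₀ (by positivity)]
    rcases le_total 0 y with hy | hy
    · rw [abs_of_nonneg hy]
      have : exp (-κ * y) ≤ 1 := by rw [exp_le_one_iff]; nlinarith
      have h0 := exp_pos (-κ * y)
      have : (1 + exp (-κ * y)) ^ 2 ≤ 4 := by nlinarith
      nlinarith
    · rw [abs_of_nonpos hy]
      have e2 : exp (-κ * y) * exp (-κ * -y) = 1 := by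
        rw [← exp_add]; simp
      have : exp (-κ * -y) ≤ 1 := by rw [exp_le_one_iff]; nlinarith
      have h0 := exp_pos (-κ * y)
      have h0' := exp_pos (-κ * -y)
      have : exp (-κ * -y) * (1 + exp (-κ * y)) ^ 2
        = exp (-κ * -y) + 2 * (exp (-κ * y) * exp (-κ * -y)) +
          (exp (-κ * y) * exp (-κ * -y)) * exp (-κ * y) := by ring
      rw [this, e2]
      have : 1 ≤ exp (-κ * y) := by rw [one_le_exp_iff]; nlinarith
      nlinarith
  linarith [exp_pos (-κ * (Y - y))]

/-- The constant in the Gronwall type estimates below. -/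
def gronConst (κ L : ℝ) : ℝ := 16 / κ * exp (16 * L / κ)

theorem gronConst_pos {κ : ℝ} (hκ : 0 < κ) (L : ℝ) : 0 < gronConst κ L := by
  unfold gronConst; positivity

/-- A function controlled by its own maximal ratio against `exp (y + Λ q)` is controlled by the
source. The operator enters only through `hstep`. -/
theorem gronwall_core {E : Type*} [NormedAddCommGroup E] [NormedSpace ℝ E]
    {a g : ℝ → E} {κ L S Y y₁ : ℝ} (hκ : 0 < κ) (hL : 0 ≤ L) (hS : 0 ≤ S) (hY : y₁ ≤ Y)
    (hc : ContinuousOn a (Iic y₁))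
    (hg : ∀ y ≤ y₁, ‖g y‖ ≤ wt κ Y y * (L * ‖a y‖ + S * exp y))
    (h0 : Tendsto (fun y => exp (-y) * ‖a y‖) atBot (𝓝 0))
    (hstep : ∀ Ψ Ψ' : ℝ → ℝ, (∀ y ≤ y₁, HasDerivAt Ψ (Ψ' y) y) →
      (∀ y ≤ y₁, 0 ≤ Ψ y) → (∀ y ≤ y₁, 0 ≤ Ψ' y) →
      (∀ y ≤ y₁, ‖g y‖ ≤ Ψ' y * exp y) → ∀ y ≤ y₁, ‖a y‖ ≤ Ψ y * exp y) :
    ∃ Ψ Ψ' : ℝ → ℝ, (∀ y ≤ y₁, HasDerivAt Ψ (Ψ' y) y) ∧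
      (∀ y ≤ y₁, 0 ≤ Ψ y) ∧ (∀ y ≤ y₁, 0 ≤ Ψ' y) ∧
      (∀ y ≤ y₁, ‖g y‖ ≤ Ψ' y * exp y) ∧ ∀ y ≤ y₁, Ψ y ≤ gronConst κ L * S := by
  set q := wtPrim κ Y with hq
  set q' : ℝ → ℝ := fun y => κ * (exp (-κ * y) / (1 + exp (-κ * y)) ^ 2 + exp (-κ * (Y - y)))
    with hq'
  have hq0 : ∀ y, 0 ≤ q y := wtPrim_nonneg κ Y
  have hq2 : ∀ y ≤ y₁, q y ≤ 2 := fun y hy => wtPrim_le hκ (hy.trans hY)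
  have hdq : ∀ y, HasDerivAt q (q' y) y := hasDerivAt_wtPrim κ Y
  have hq'0 : ∀ y, 0 ≤ q' y := fun y => by simp only [hq']; positivity
  have hqc : Continuous q := continuous_iff_continuousAt.2 fun y => (hdq y).continuousAt
  set L' := 4 * L / κ with hL'
  set S' := 4 * S / κ with hS'
  have hL'0 : 0 ≤ L' := by positivity
  have hS'0 : 0 ≤ S' := by positivity
  set Λ := 2 * L' with hΛ
  have hΛ0 : 0 ≤ Λ := by positivity
  set h : ℝ → ℝ := fun y => exp (-y) * ‖a y‖ * exp (-Λ * q y) with hh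
  have hh0 : ∀ y, 0 ≤ h y := fun y => by positivity
  obtain ⟨ym, hym, hmax⟩ := exists_isMax_Iic (h := h) (y₁ := y₁)
    (by
      apply ContinuousOn.mul
      · exact (continuous_exp.comp continuous_neg).continuousOn.mul hc.norm
      · exact (by fun_prop : Continuous fun y => exp (-Λ * q y)).continuousOn)
    (fun y _ => hh0 y)
    (by
      refine squeeze_zero hh0 (fun y => ?_) h0
      have : exp (-Λ * q y) ≤ 1 := by
        rw [exp_le_one_iff]
        nlinarith [mul_nonneg hΛ0 (hq0 y)]
      have h3 : 0 ≤ exp (-y) * ‖a y‖ := by positivity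
      nlinarith)
  set X := h ym with hX
  have hX0 : 0 ≤ X := hh0 ym
  have haX : ∀ y ≤ y₁, ‖a y‖ ≤ X * exp (Λ * q y) * exp y := by
    intro y hy
    have h1 := hmax y hy
    have h2 : ‖a y‖ = h y * exp (Λ * q y) * exp y := by
      simp only [hh]
      have e1 : exp (-y) * exp y = 1 := by rw [← exp_add]; simp
      have e2 : exp (-Λ * q y) * exp (Λ * q y) = 1 := by rw [← exp_add]; simp
      calc ‖a y‖ = ‖a y‖ * (exp (-y) * exp y) * (exp (-Λ * q y) * exp (Λ * q y)) := by
            rw [e1, e2]; ring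
        _ = _ := by ring
    rw [h2]
    gcongr
  set Ψ : ℝ → ℝ := fun y => X / 2 * exp (Λ * q y) + S' * q y with hΨ
  set Ψ' : ℝ → ℝ := fun y => q' y * (L' * X * exp (Λ * q y) + S') with hΨ'
  have hdΨ : ∀ y ≤ y₁, HasDerivAt Ψ (Ψ' y) y := by
    intro y _
    have h1 := (((hdq y).const_mul Λ).exp.const_mul (X / 2)).add ((hdq y).const_mul S')
    refine h1.congr_deriv ?_
    simp only [hΨ', hΛ]
    ring
  have hΨ0 : ∀ y ≤ y₁, 0 ≤ Ψ y := fun y _ =>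
    add_nonneg (by positivity) (mul_nonneg hS'0 (hq0 y))
  have hΨ'0 : ∀ y ≤ y₁, 0 ≤ Ψ' y := fun y _ => mul_nonneg (hq'0 y) (by positivity)
  have hgΨ : ∀ y ≤ y₁, ‖g y‖ ≤ Ψ' y * exp y := by
    intro y hy
    have h1 : wt κ Y y ≤ 4 / κ * q' y := wt_le_deriv_wtPrim hκ Y y
    calc ‖g y‖ ≤ wt κ Y y * (L * ‖a y‖ + S * exp y) := hg y hy
      _ ≤ (4 / κ * q' y) * (L * (X * exp (Λ * q y) * exp y) + S * exp y) := by
          apply mul_le_mul h1 _ (by positivity) (mul_nonneg (by positivity) (hq'0 y))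
          gcongr
          exact haX y hy
      _ = Ψ' y * exp y := by
          simp only [hΨ', hL', hS']
          ring
  have hfin := hstep Ψ Ψ' hdΨ hΨ0 hΨ'0 hgΨ ym hym
  have hXb : X ≤ 4 * S' := by
    have e0 : 1 ≤ exp (Λ * q ym) := one_le_exp (mul_nonneg hΛ0 (hq0 ym))
    have e1 : X ≤ X / 2 + 2 * S' := by
      have e3 : exp (-ym) * exp ym = 1 := by rw [← exp_add]; simp
      have e2 : exp (-Λ * q ym) * exp (Λ * q ym) = 1 := by rw [← exp_add]; simp
      have e4 : exp (-Λ * q ym) ≤ 1 := by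
        rw [exp_le_one_iff]
        nlinarith [mul_nonneg hΛ0 (hq0 ym)]
      calc X = exp (-ym) * ‖a ym‖ * exp (-Λ * q ym) := rfl
        _ ≤ exp (-ym) * (Ψ ym * exp ym) * exp (-Λ * q ym) := by gcongr
        _ = (exp (-ym) * exp ym) *
            (X / 2 * (exp (-Λ * q ym) * exp (Λ * q ym)) + S' * q ym * exp (-Λ * q ym)) := by
            simp only [hΨ]; ring
        _ = X / 2 + S' * q ym * exp (-Λ * q ym) := by rw [e3, e2]; ring
        _ ≤ X / 2 + S' * 2 * 1 := by
            gcongr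
            · exact hq2 ym hym
        _ = _ := by ring
    linarith
  refine ⟨Ψ, Ψ', hdΨ, hΨ0, hΨ'0, hgΨ, fun y hy => ?_⟩
  have e1 : exp (Λ * q y) ≤ exp (16 * L / κ) := by
    apply exp_le_exp.2
    have : Λ * q y ≤ Λ * 2 := mul_le_mul_of_nonneg_left (hq2 y hy) hΛ0
    refine this.trans (le_of_eq ?_)
    simp only [hΛ, hL']
    ring
  have e2 : 1 ≤ exp (16 * L / κ) := one_le_exp (by positivity)
  calc Ψ y ≤ (4 * S') / 2 * exp (16 * L / κ) + S' * 2 := by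
        simp only [hΨ]
        gcongr
        exact hq2 y hy
    _ ≤ 4 * S' * exp (16 * L / κ) := by nlinarith
    _ = gronConst κ L * S := by
        simp only [gronConst, hS']
        ring

/-- Gronwall type estimate for `z'' = O(weight) z + source` with zero data at `-∞`. -/
theorem gronwall_modeZero {z z' z'' : ℝ → ℝ} {κ L S Y y₁ : ℝ} (hκ : 0 < κ) (hL : 0 ≤ L)
    (hS : 0 ≤ S) (hY : y₁ ≤ Y)
    (h1 : ∀ y ≤ y₁, HasDerivAt z (z' y) y) (h2 : ∀ y ≤ y₁, HasDerivAt z' (z'' y) y)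
    (hg : ∀ y ≤ y₁, |z'' y| ≤ wt κ Y y * (L * |z y| + S * exp y))
    (h0 : Tendsto (fun y => exp (-y) * |z y|) atBot (𝓝 0))
    (hz0 : Tendsto z atBot (𝓝 0)) (hz0' : Tendsto z' atBot (𝓝 0)) :
    ∀ y ≤ y₁, |z y| ≤ gronConst κ L * S * exp y ∧ |z' y| ≤ gronConst κ L * S * exp y := by
  have step : ∀ Ψ Ψ' : ℝ → ℝ, (∀ y ≤ y₁, HasDerivAt Ψ (Ψ' y) y) →
      (∀ y ≤ y₁, 0 ≤ Ψ y) → (∀ y ≤ y₁, 0 ≤ Ψ' y) →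
      (∀ y ≤ y₁, ‖z'' y‖ ≤ Ψ' y * exp y) →
      (∀ y ≤ y₁, ‖z' y‖ ≤ Ψ y * exp y) ∧ ∀ y ≤ y₁, ‖z y‖ ≤ Ψ y * exp y := by
    intro Ψ Ψ' hd hp hp' hb
    have hdE : ∀ y ≤ y₁, HasDerivAt (fun y => Ψ y * exp y) (Ψ' y * exp y + Ψ y * exp y) y :=
      fun y hy => (hd y hy).mul (hasDerivAt_exp y)
    have A : ∀ y ≤ y₁, ‖z' y‖ ≤ Ψ y * exp y :=
      norm_le_of_norm_deriv_le_of_tendsto_atBot h2 hdE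
        (fun y hy => (hb y hy).trans (by
          have := mul_nonneg (hp y hy) (exp_pos y).le
          linarith)) hz0'
        (fun y hy => mul_nonneg (hp y hy) (exp_pos y).le)
    refine ⟨A, norm_le_of_norm_deriv_le_of_tendsto_atBot h1 hdE
        (fun y hy => (A y hy).trans (by
          have := mul_nonneg (hp' y hy) (exp_pos y).le
          linarith)) hz0
        (fun y hy => mul_nonneg (hp y hy) (exp_pos y).le)⟩
  obtain ⟨Ψ, Ψ', hd, hp, hp', hb, hfin⟩ := gronwall_core (a := z) (g := z'') hκ hL hS hY
    (fun y hy => (h1 y hy).continuousAt.continuousWithinAt) hg h0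
    (fun Ψ Ψ' a b c d => (step Ψ Ψ' a b c d).2)
  obtain ⟨hA, hB⟩ := step Ψ Ψ' hd hp hp' hb
  intro y hy
  exact ⟨(hB y hy).trans (mul_le_mul_of_nonneg_right (hfin y hy) (exp_pos y).le),
    (hA y hy).trans (mul_le_mul_of_nonneg_right (hfin y hy) (exp_pos y).le)⟩

/-- Gronwall type estimate for `a'' - a = O(weight) a + source` with `a = o(exp y)` at `-∞`. -/
theorem gronwall_modeOne {E : Type*} [NormedAddCommGroup E] [NormedSpace ℝ E]
    {a a' g : ℝ → E} {κ L S Y y₁ : ℝ} (hκ : 0 < κ) (hL : 0 ≤ L)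
    (hS : 0 ≤ S) (hY : y₁ ≤ Y)
    (h1 : ∀ y ≤ y₁, HasDerivAt a (a' y) y) (h2 : ∀ y ≤ y₁, HasDerivAt a' (a y + g y) y)
    (hg : ∀ y ≤ y₁, ‖g y‖ ≤ wt κ Y y * (L * ‖a y‖ + S * exp y))
    (h0 : Tendsto (fun y => exp (-y) * ‖a y‖) atBot (𝓝 0))
    (h0' : Tendsto (fun y => exp (-y) * ‖a' y‖) atBot (𝓝 0)) :
    ∀ y ≤ y₁, ‖a y‖ ≤ gronConst κ L * S * exp y := by
  have step : ∀ Ψ Ψ' : ℝ → ℝ, (∀ y ≤ y₁, HasDerivAt Ψ (Ψ' y) y) →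
      (∀ y ≤ y₁, 0 ≤ Ψ y) → (∀ y ≤ y₁, 0 ≤ Ψ' y) →
      (∀ y ≤ y₁, ‖g y‖ ≤ Ψ' y * exp y) → ∀ y ≤ y₁, ‖a y‖ ≤ Ψ y * exp y := by
    intro Ψ Ψ' hd hp hp' hb
    have t0 : Tendsto (fun y => exp (-y) * (‖a' y‖ + ‖a y‖)) atBot (𝓝 0) := by
      simpa [mul_add] using h0'.add h0
    have eP : ∀ y ≤ y₁, HasDerivAt (fun y => exp (-y) • (a' y + a y)) (exp (-y) • g y) y := by
      intro y hy
      have e : HasDerivAt (fun y : ℝ => exp (-y)) (-exp (-y)) y := by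
        simpa using (hasDerivAt_neg y).exp
      refine (e.smul ((h2 y hy).add (h1 y hy))).congr_deriv ?_
      simp only [smul_add, neg_smul, Pi.add_apply]
      abel
    have eD : ∀ y ≤ y₁, HasDerivAt (fun y => exp y • (a' y - a y)) (exp y • g y) y := by
      intro y hy
      refine ((hasDerivAt_exp y).smul ((h2 y hy).sub (h1 y hy))).congr_deriv ?_
      simp only [smul_add, smul_sub, Pi.sub_apply]
      abel
    have A := norm_le_of_norm_deriv_le_of_tendsto_atBot eP hd
      (fun y hy => by
        rw [norm_smul, norm_of_nonneg (exp_pos _).le]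
        calc exp (-y) * ‖g y‖ ≤ exp (-y) * (Ψ' y * exp y) := by gcongr; exact hb y hy
          _ = Ψ' y * (exp (-y) * exp y) := by ring
          _ = Ψ' y := by rw [← exp_add]; simp)
      (squeeze_zero_norm (fun y => by
        rw [norm_smul, norm_of_nonneg (exp_pos _).le]
        gcongr
        exact norm_add_le _ _) t0) hp
    have hdE : ∀ y ≤ y₁, HasDerivAt (fun y => Ψ y * (exp y * exp y))
        (Ψ' y * (exp y * exp y) + Ψ y * (exp y * exp y + exp y * exp y)) y :=
      fun y hy => (hd y hy).mul ((hasDerivAt_exp y).mul (hasDerivAt_exp y))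
    have D := norm_le_of_norm_deriv_le_of_tendsto_atBot eD hdE
      (fun y hy => by
        rw [norm_smul, norm_of_nonneg (exp_pos _).le]
        have e1 : exp y * ‖g y‖ ≤ exp y * (Ψ' y * exp y) := by gcongr; exact hb y hy
        have e2 : 0 ≤ Ψ y * (exp y * exp y + exp y * exp y) := mul_nonneg (hp y hy) (by positivity)
        linarith)
      (squeeze_zero_norm' ((eventually_le_atBot 0).mono fun y hy => by
        rw [norm_smul, norm_of_nonneg (exp_pos _).le]
        gcongr
        · linarith
        · exact norm_sub_le _ _) t0)
      (fun y hy => mul_nonneg (hp y hy) (by positivity))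
    intro y hy
    have a1 := A y hy
    have d1 := D y hy
    rw [norm_smul, norm_of_nonneg (exp_pos _).le] at a1 d1
    have a2 : ‖a' y + a y‖ ≤ Ψ y * exp y := by
      calc ‖a' y + a y‖ = (exp (-y) * ‖a' y + a y‖) * exp y := by
            rw [mul_right_comm, ← exp_add]; simp
        _ ≤ _ := by gcongr
    have d2 : ‖a' y - a y‖ ≤ Ψ y * exp y := by
      have := exp_pos y
      have : exp y * ‖a' y - a y‖ ≤ exp y * (Ψ y * exp y) := by linarith
      exact le_of_mul_le_mul_left this (exp_pos y)
    have e : (2 : ℝ) • a y = (a' y + a y) - (a' y - a y) := by rw [two_smul]; abel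
    have : 2 * ‖a y‖ ≤ ‖a' y + a y‖ + ‖a' y - a y‖ := by
      calc 2 * ‖a y‖ = ‖(2 : ℝ) • a y‖ := by rw [norm_smul]; simp
        _ ≤ _ := by rw [e]; exact norm_sub_le _ _
    linarith
  obtain ⟨Ψ, Ψ', hd, hp, hp', hb, hfin⟩ := gronwall_core (a := a) (g := g) hκ hL hS hY
    (fun y hy => (h1 y hy).continuousAt.continuousWithinAt) hg h0 step
  intro y hy
  exact (step Ψ Ψ' hd hp hp' hb y hy).trans
    (mul_le_mul_of_nonneg_right (hfin y hy) (exp_pos y).le)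

/-- Smoothness of a function of `(y, θ)` on the half-cylinder `y < Y`. -/
def Sm (Y : ℝ) (g : ℝ → ℝ → ℝ) : Prop :=
  ContDiffOn ℝ (⊤ : ℕ∞) (fun p : ℝ × ℝ => g p.1 p.2) {p | p.1 < Y}

/-- Partial derivative in the axial variable. -/
def pdy (g : ℝ → ℝ → ℝ) (y θ : ℝ) : ℝ := deriv (fun s => g s θ) y

/-- Partial derivative in the angular variable. -/
def pdt (g : ℝ → ℝ → ℝ) (y θ : ℝ) : ℝ := deriv (g y) θ

theorem isOpen_halfCyl (Y : ℝ) : IsOpen {p : ℝ × ℝ | p.1 < Y} :=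
  isOpen_lt continuous_fst continuous_const

namespace Sm

variable {Y y θ : ℝ} {g h : ℝ → ℝ → ℝ}

theorem contDiffAt (hg : Sm Y g) (hy : y < Y) :
    ContDiffAt ℝ (⊤ : ℕ∞) (fun p : ℝ × ℝ => g p.1 p.2) (y, θ) :=
  ContDiffOn.contDiffAt hg ((isOpen_halfCyl Y).mem_nhds hy)

theorem hasFDerivAt (hg : Sm Y g) (hy : y < Y) :
    HasFDerivAt (fun p : ℝ × ℝ => g p.1 p.2)
      (fderiv ℝ (fun p : ℝ × ℝ => g p.1 p.2) (y, θ)) (y, θ) :=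
  ((hg.contDiffAt hy).differentiableAt (by simp)).hasFDerivAt

theorem hasDerivAt_y_aux (hg : Sm Y g) (hy : y < Y) :
    HasDerivAt (fun s => g s θ) (fderiv ℝ (fun p : ℝ × ℝ => g p.1 p.2) (y, θ) (1, 0)) y := by
  have h1 : HasDerivAt (fun s : ℝ => (s, θ)) ((1 : ℝ), (0 : ℝ)) y :=
    (hasDerivAt_id y).prodMk (hasDerivAt_const y θ)
  exact HasFDerivAt.comp_hasDerivAt (f := fun s : ℝ => (s, θ)) y (hg.hasFDerivAt hy) h1

theorem hasDerivAt_t_aux (hg : Sm Y g) (hy : y < Y) :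
    HasDerivAt (g y) (fderiv ℝ (fun p : ℝ × ℝ => g p.1 p.2) (y, θ) (0, 1)) θ := by
  have h1 : HasDerivAt (fun s : ℝ => (y, s)) ((0 : ℝ), (1 : ℝ)) θ :=
    (hasDerivAt_const θ y).prodMk (hasDerivAt_id θ)
  exact HasFDerivAt.comp_hasDerivAt (f := fun s : ℝ => (y, s)) θ (hg.hasFDerivAt hy) h1

theorem pdy_eq (hg : Sm Y g) (hy : y < Y) :
    pdy g y θ = fderiv ℝ (fun p : ℝ × ℝ => g p.1 p.2) (y, θ) (1, 0) :=
  (hg.hasDerivAt_y_aux hy).deriv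

theorem pdt_eq (hg : Sm Y g) (hy : y < Y) :
    pdt g y θ = fderiv ℝ (fun p : ℝ × ℝ => g p.1 p.2) (y, θ) (0, 1) :=
  (hg.hasDerivAt_t_aux hy).deriv

theorem hasDerivAt_y (hg : Sm Y g) (hy : y < Y) :
    HasDerivAt (fun s => g s θ) (pdy g y θ) y := by
  rw [hg.pdy_eq hy]; exact hg.hasDerivAt_y_aux hy

theorem hasDerivAt_t (hg : Sm Y g) (hy : y < Y) : HasDerivAt (g y) (pdt g y θ) θ := by
  rw [hg.pdt_eq hy]; exact hg.hasDerivAt_t_aux hy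

theorem fderiv_contDiffOn (hg : Sm Y g) :
    ContDiffOn ℝ (⊤ : ℕ∞) (fderiv ℝ (fun p : ℝ × ℝ => g p.1 p.2)) {p | p.1 < Y} :=
  ContDiffOn.fderiv_of_isOpen hg (isOpen_halfCyl Y) (by norm_cast)

theorem pdy (hg : Sm Y g) : Sm Y (pdy g) := by
  refine (hg.fderiv_contDiffOn.clm_apply (contDiffOn_const (c := ((1 : ℝ), (0 : ℝ))))).congr ?_
  rintro ⟨y, θ⟩ hy
  exact hg.pdy_eq hy

theorem pdt (hg : Sm Y g) : Sm Y (pdt g) := by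
  refine (hg.fderiv_contDiffOn.clm_apply (contDiffOn_const (c := ((0 : ℝ), (1 : ℝ))))).congr ?_
  rintro ⟨y, θ⟩ hy
  exact hg.pdt_eq hy

theorem comm (hg : Sm Y g) (hy : y < Y) :
    _root_.pdy (_root_.pdt g) y θ = _root_.pdt (_root_.pdy g) y θ := by
  set G : ℝ × ℝ → ℝ := fun p => g p.1 p.2 with hG
  have hd : HasFDerivAt (fderiv ℝ G) (fderiv ℝ (fderiv ℝ G) (y, θ)) (y, θ) :=
    ((hg.fderiv_contDiffOn.contDiffAt ((isOpen_halfCyl Y).mem_nhds hy)).differentiableAt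
      (by simp)).hasFDerivAt
  have hs := (hg.contDiffAt (θ := θ) hy).isSymmSndFDerivAt (by simp; norm_cast)
  have e1 : _root_.pdy (_root_.pdt g) y θ = fderiv ℝ (fderiv ℝ G) (y, θ) (1, 0) (0, 1) := by
    have h1 : HasDerivAt (fun s : ℝ => (s, θ)) ((1 : ℝ), (0 : ℝ)) y :=
      (hasDerivAt_id y).prodMk (hasDerivAt_const y θ)
    have h2 : HasDerivAt (fun s : ℝ => fderiv ℝ G (s, θ)) (fderiv ℝ (fderiv ℝ G) (y, θ) (1, 0)) y :=
      HasFDerivAt.comp_hasDerivAt (f := fun s : ℝ => (s, θ)) y hd h1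
    have h3 := h2.clm_apply (hasDerivAt_const y ((0 : ℝ), (1 : ℝ)))
    rw [map_zero, add_zero] at h3
    refine (h3.congr_of_eventuallyEq ?_).deriv
    filter_upwards [eventually_lt_nhds hy] with s hs
    exact hg.pdt_eq hs
  have e2 : _root_.pdt (_root_.pdy g) y θ = fderiv ℝ (fderiv ℝ G) (y, θ) (0, 1) (1, 0) := by
    have h1 : HasDerivAt (fun s : ℝ => (y, s)) ((0 : ℝ), (1 : ℝ)) θ :=
      (hasDerivAt_const θ y).prodMk (hasDerivAt_id θ)
    have h2 : HasDerivAt (fun s : ℝ => fderiv ℝ G (y, s)) (fderiv ℝ (fderiv ℝ G) (y, θ) (0, 1)) θ :=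
      HasFDerivAt.comp_hasDerivAt (f := fun s : ℝ => (y, s)) θ hd h1
    have h3 := h2.clm_apply (hasDerivAt_const θ ((1 : ℝ), (0 : ℝ)))
    rw [map_zero, add_zero] at h3
    refine (h3.congr_of_eventuallyEq ?_).deriv
    exact Eventually.of_forall fun s => hg.pdy_eq hy
  rw [e1, e2]
  exact hs.eq _ _

theorem continuous_t (hg : Sm Y g) (hy : y < Y) : Continuous (g y) :=
  continuous_iff_continuousAt.2 fun _ => (hg.hasDerivAt_t hy).continuousAt

theorem continuousOn (hg : Sm Y g) : ContinuousOn (fun p : ℝ × ℝ => g p.1 p.2) {p | p.1 < Y} :=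
  ContDiffOn.continuousOn hg

theorem mul (hg : Sm Y g) (hh : Sm Y h) : Sm Y (fun y θ => g y θ * h y θ) :=
  ContDiffOn.mul hg hh

theorem sub (hg : Sm Y g) (hh : Sm Y h) : Sm Y (fun y θ => g y θ - h y θ) :=
  ContDiffOn.sub hg hh

theorem const_mul (c : ℝ) (hg : Sm Y g) : Sm Y (fun y θ => c * g y θ) :=
  ContDiffOn.mul contDiffOn_const hg

theorem comp (hg : Sm Y g) {f : ℝ → ℝ} (hf : ContDiff ℝ (⊤ : ℕ∞) f) :
    Sm Y (fun y θ => f (g y θ)) :=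
  hf.comp_contDiffOn hg

theorem of_fst {f : ℝ → ℝ} (hf : ContDiff ℝ (⊤ : ℕ∞) f) : Sm Y (fun y _ => f y) :=
  (hf.comp contDiff_fst).contDiffOn

theorem hasDerivAt_integral (hg : Sm Y g) {c : ℝ → ℝ} (hc : Continuous c) (hy : y < Y) :
    HasDerivAt (fun y => ∫ θ in (0 : ℝ)..(2 * π), g y θ * c θ)
      (∫ θ in (0 : ℝ)..(2 * π), _root_.pdy g y θ * c θ) y := by
  obtain ⟨δ, hδ, hδY⟩ : ∃ δ > 0, y + δ < Y := ⟨(Y - y) / 2, by linarith, by linarith⟩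
  have hsub : Icc (y - δ) (y + δ) ×ˢ Icc 0 (2 * π) ⊆ {p : ℝ × ℝ | p.1 < Y} := by
    rintro ⟨s, t⟩ hst
    exact hst.1.2.trans_lt hδY
  have hcont : ContinuousOn (fun p : ℝ × ℝ => _root_.pdy g p.1 p.2 * c p.2)
      (Icc (y - δ) (y + δ) ×ˢ Icc 0 (2 * π)) :=
    (hg.pdy.continuousOn.mono hsub).mul (hc.comp continuous_snd).continuousOn
  obtain ⟨M, hM⟩ := (isCompact_Icc.prod isCompact_Icc).exists_bound_of_continuousOn hcont
  have hpi : (0 : ℝ) ≤ 2 * π := by positivity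
  refine (intervalIntegral.hasDerivAt_integral_of_dominated_loc_of_deriv_le
    (F := fun y θ => g y θ * c θ) (F' := fun y θ => _root_.pdy g y θ * c θ)
    (s := Icc (y - δ) (y + δ)) (bound := fun _ => M)
    (Icc_mem_nhds (by linarith) (by linarith)) ?_ ?_ ?_ ?_ ?_ ?_).2
  · filter_upwards [eventually_lt_nhds hy] with s hs
    exact ((hg.continuous_t hs).mul hc).aestronglyMeasurable
  · exact ((hg.continuous_t hy).mul hc).intervalIntegrable _ _
  · exact ((hg.pdy.continuous_t hy).mul hc).aestronglyMeasurable
  · refine Eventually.of_forall fun t ht s hs => ?_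
    rw [uIoc_of_le hpi] at ht
    exact hM (s, t) ⟨hs, ht.1.le, ht.2⟩
  · exact intervalIntegrable_const
  · refine Eventually.of_forall fun t _ s hs => ?_
    exact (hg.hasDerivAt_y (hs.2.trans_lt hδY)).mul_const _

theorem hasDerivAt_integral' (hg : Sm Y g) (hy : y < Y) :
    HasDerivAt (fun y => ∫ θ in (0 : ℝ)..(2 * π), g y θ)
      (∫ θ in (0 : ℝ)..(2 * π), _root_.pdy g y θ) y := by
  simpa using hg.hasDerivAt_integral (c := fun _ => 1) continuous_const hy

theorem integral_pdt_mul (hg : Sm Y g) (hy : y < Y) (hp : Function.Periodic (g y) (2 * π))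
    {c c' : ℝ → ℝ} (hc : ∀ t, HasDerivAt c (c' t) t) (hc' : Continuous c')
    (hcp : Function.Periodic c (2 * π)) :
    ∫ θ in (0 : ℝ)..(2 * π), _root_.pdt g y θ * c θ
      = - ∫ θ in (0 : ℝ)..(2 * π), g y θ * c' θ := by
  have h := intervalIntegral.integral_mul_deriv_eq_deriv_mul (a := 0) (b := 2 * π)
    (u := g y) (u' := _root_.pdt g y) (v := c) (v' := c')
    (fun t _ => hg.hasDerivAt_t hy) (fun t _ => hc t)
    ((hg.pdt.continuous_t hy).intervalIntegrable _ _) (hc'.intervalIntegrable _ _)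
  have e1 := hp 0
  have e2 := hcp 0
  rw [zero_add] at e1 e2
  rw [h, e1, e2]
  ring

theorem integral_pdt (hg : Sm Y g) (hy : y < Y) (hp : Function.Periodic (g y) (2 * π)) :
    ∫ θ in (0 : ℝ)..(2 * π), _root_.pdt g y θ = 0 := by
  simpa using hg.integral_pdt_mul hy hp (c := fun _ => 1) (c' := fun _ => 0)
    (fun t => hasDerivAt_const t 1) continuous_const (fun _ => rfl)

end Sm

theorem periodic_pdt {g : ℝ → ℝ → ℝ} {y p : ℝ} (h : Function.Periodic (g y) p) :
    Function.Periodic (pdt g y) p := by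
  intro t
  unfold pdt
  rw [← deriv_comp_add_const]
  congr 1
  exact funext h

theorem periodic_pdy {g : ℝ → ℝ → ℝ} {Y y p : ℝ} (hy : y < Y)
    (h : ∀ y < Y, Function.Periodic (g y) p) :
    Function.Periodic (pdy g y) p := by
  intro t
  unfold pdy
  apply Filter.EventuallyEq.deriv_eq
  filter_upwards [eventually_lt_nhds hy] with s hs
  exact h s hs t

theorem norm_sq_fourierCoeffOn_one {g : ℝ → ℝ} (hg : Continuous g) {n : ℤ}
    (hn : n = 1 ∨ n = -1) :
    ‖fourierCoeffOn two_pi_pos (fun t => (g t : ℂ)) n‖ ^ 2 = (2 * π)⁻¹ ^ 2 *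
      ((∫ t in (0 : ℝ)..(2 * π), g t * cos t) ^ 2 + (∫ t in (0 : ℝ)..(2 * π), g t * sin t) ^ 2) := by
  set A := ∫ t in (0 : ℝ)..(2 * π), g t * cos t
  set B := ∫ t in (0 : ℝ)..(2 * π), g t * sin t
  have hi1 : IntervalIntegrable (fun t => ((g t * cos t : ℝ) : ℂ)) volume 0 (2 * π) :=
    Continuous.intervalIntegrable (by fun_prop) _ _
  have hi2 : IntervalIntegrable (fun t => (((-n : ℤ) : ℂ) * ((g t * sin t : ℝ) : ℂ)) * Complex.I)
      volume 0 (2 * π) := Continuous.intervalIntegrable (by fun_prop) _ _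
  have key : (∫ t in (0 : ℝ)..(2 * π),
      (fourier (-n)) ((t : ℝ) : AddCircle (2 * π - 0)) • (fun t => (g t : ℂ)) t)
      = (A : ℂ) + ((-n : ℤ) : ℂ) * B * Complex.I := by
    have : ∀ t : ℝ, (fourier (-n)) ((t : ℝ) : AddCircle (2 * π - 0)) • (fun t => (g t : ℂ)) t
        = ((g t * cos t : ℝ) : ℂ) + (((-n : ℤ) : ℂ) * ((g t * sin t : ℝ) : ℂ)) * Complex.I := by
      intro t
      rw [fourier_coe_apply]
      have hpi : (π : ℂ) ≠ 0 := by exact_mod_cast pi_ne_zero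
      have e : (2 * (π : ℂ) * Complex.I * ((-n : ℤ) : ℂ) * (t : ℂ) / ((2 * π - 0 : ℝ) : ℂ))
          = ((-n : ℤ) : ℂ) * (t : ℂ) * Complex.I := by
        push_cast
        rw [sub_zero]
        field_simp
      rw [e, Complex.exp_mul_I]
      rcases hn with rfl | rfl
      · push_cast
        simp only [neg_mul, one_mul, Complex.cos_neg, Complex.sin_neg, smul_eq_mul]
        ring
      · push_cast
        simp only [one_mul, smul_eq_mul]
        ring
    simp_rw [this]
    rw [intervalIntegral.integral_add hi1 hi2, intervalIntegral.integral_mul_const,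
      intervalIntegral.integral_const_mul, intervalIntegral.integral_ofReal,
      intervalIntegral.integral_ofReal]
  rw [fourierCoeffOn_eq_integral, key, norm_smul, mul_pow]
  congr 1
  · simp [abs_of_pos pi_pos]
  · rw [← Complex.normSq_eq_norm_sq]
    have : (A : ℂ) + ((-n : ℤ) : ℂ) * B * Complex.I = ⟨A, (-n : ℤ) * B⟩ := by
      apply Complex.ext <;> simp
    rw [this, Complex.normSq_mk]
    rcases hn with rfl | rfl <;> push_cast <;> ring

/-- Wirtinger's inequality with the first mode as defect. -/
theorem wirtinger_modeOne {g g' : ℝ → ℝ} (hg : ∀ t, HasDerivAt g (g' t) t) (hg' : Continuous g')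
    (hp : g (2 * π) = g 0) (h0 : ∫ t in (0 : ℝ)..(2 * π), g t = 0) :
    4 * ∫ t in (0 : ℝ)..(2 * π), g t ^ 2 ≤ (∫ t in (0 : ℝ)..(2 * π), g' t ^ 2) + 3 / π *
      ((∫ t in (0 : ℝ)..(2 * π), g t * cos t) ^ 2 + (∫ t in (0 : ℝ)..(2 * π), g t * sin t) ^ 2) := by
  have hc : Continuous g := continuous_iff_continuousAt.2 fun t => (hg t).continuousAt
  set D := (∫ t in (0 : ℝ)..(2 * π), g t * cos t) ^ 2 +
    (∫ t in (0 : ℝ)..(2 * π), g t * sin t) ^ 2 with hD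
  have mem : ∀ {h : ℝ → ℝ}, Continuous h →
      MemLp (fun t => (h t : ℂ)) 2 (volume.restrict (Ioc 0 (2 * π))) := by
    intro h hh
    have hh' : Continuous fun t => (h t : ℂ) := by fun_prop
    obtain ⟨M, hM⟩ := (isCompact_Icc (a := (0 : ℝ)) (b := 2 * π)).exists_bound_of_continuousOn
      hh'.continuousOn
    refine MemLp.of_bound hh'.aestronglyMeasurable M ?_
    filter_upwards [ae_restrict_mem measurableSet_Ioc] with t ht
    exact hM t ⟨ht.1.le, ht.2⟩
  have s1 := hasSum_sq_fourierCoeffOn two_pi_pos (mem hc)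
  have s2 := hasSum_sq_fourierCoeffOn two_pi_pos (mem hg')
  simp only [Complex.norm_real, norm_eq_abs, sq_abs, sub_zero, smul_eq_mul] at s1 s2
  set c := fun n => ‖fourierCoeffOn two_pi_pos (fun t => (g t : ℂ)) n‖ ^ 2 with hcdef
  set d := fun n => ‖fourierCoeffOn two_pi_pos (fun t => (g' t : ℂ)) n‖ ^ 2 with hddef
  have hcd : ∀ n : ℤ, n ≠ 0 → d n = (n : ℝ) ^ 2 * c n := by
    intro n hn
    have h := fourierCoeffOn_of_hasDerivAt (n := n) two_pi_pos (f := fun t => (g t : ℂ))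
      (f' := fun t => (g' t : ℂ)) hn (fun t _ => (hg t).ofReal_comp)
      (Continuous.intervalIntegrable (by fun_prop) _ _)
    simp only [hp, sub_self, mul_zero, zero_sub, Complex.ofReal_zero, sub_zero] at h
    simp only [hcdef, hddef, h]
    simp only [norm_mul, norm_div, norm_neg, norm_one, Complex.norm_I, Complex.norm_real,
      Complex.norm_intCast, mul_pow, div_pow, one_pow]
    have : (n : ℝ) ≠ 0 := by exact_mod_cast hn
    simp
    field_simp
  have c0 : c 0 = 0 := by
    have : fourierCoeffOn two_pi_pos (fun t => (g t : ℂ)) 0 = 0 := by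
      rw [fourierCoeffOn_eq_integral]
      simp [intervalIntegral.integral_ofReal, h0]
    simp only [hcdef, this]
    simp
  set e : ℤ → ℝ := fun n => if n ∈ ({1, -1} : Finset ℤ) then (2 * π)⁻¹ ^ 2 * D else 0 with he
  have s3 : HasSum e (2 * ((2 * π)⁻¹ ^ 2 * D)) := by
    have : HasSum e (∑ n ∈ ({1, -1} : Finset ℤ), e n) := hasSum_sum_of_ne_finset_zero
      (fun n hn => by simp only [he]; rw [if_neg hn])
    convert this using 1
    rw [Finset.sum_pair (by decide)]
    simp [he]
    ring
  have hle : ∀ n, 4 * c n ≤ d n + 3 * e n := by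
    intro n
    have hcn : 0 ≤ c n := by simp only [hcdef]; positivity
    have hdn : 0 ≤ d n := by simp only [hddef]; positivity
    by_cases hn : n = 1 ∨ n = -1
    · have h1 : c n = e n := by
        simp only [hcdef, he]
        rw [norm_sq_fourierCoeffOn_one hc hn, if_pos (by simpa using hn)]
      have h2 : d n = c n := by
        rcases hn with rfl | rfl <;> rw [hcd _ (by decide)] <;> norm_num
      linarith
    · have h1 : e n = 0 := by
        simp only [he]
        rw [if_neg (by simpa using hn)]
      rw [h1]
      by_cases hn0 : n = 0
      · subst hn0
        rw [c0]; linarith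
      · rw [hcd n hn0]
        have : (4 : ℝ) ≤ (n : ℝ) ^ 2 := by
          push Not at hn
          have : 2 ≤ |n| := by
            rcases abs_cases n with h | h <;> omega
          have h4 : (2 : ℤ) ^ 2 ≤ n ^ 2 := by
            rw [← sq_abs n]; gcongr
          exact_mod_cast h4
        nlinarith
  have := hasSum_le hle (s1.mul_left 4) (s2.add (s3.mul_left 3))
  have hpi := pi_pos
  have e1 : 2 * π * (4 * ((2 * π)⁻¹ * ∫ t in (0 : ℝ)..(2 * π), g t ^ 2))
      = 4 * ∫ t in (0 : ℝ)..(2 * π), g t ^ 2 := by field_simp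
  have e2 : 2 * π * ((2 * π)⁻¹ * (∫ t in (0 : ℝ)..(2 * π), g' t ^ 2) +
      3 * (2 * ((2 * π)⁻¹ ^ 2 * D))) = (∫ t in (0 : ℝ)..(2 * π), g' t ^ 2) + 3 / π * D := by
    field_simp
  rw [← e1, ← e2]
  gcongr

theorem deriv_nonneg_of_nonneg_right {g : ℝ → ℝ} {g' : ℝ} (hg : HasDerivAt g g' 0) (h0 : g 0 = 0)
    (h : ∀ s ∈ Ioo (0 : ℝ) 1, 0 ≤ g s) : 0 ≤ g' := by
  have h1 := hg.tendsto_slope_zero_right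
  refine ge_of_tendsto h1 ?_
  filter_upwards [Ioo_mem_nhdsGT (zero_lt_one' ℝ)] with s hs
  simp only [zero_add, h0, sub_zero, smul_eq_mul]
  exact mul_nonneg (inv_nonneg.2 hs.1.le) (h s hs)

theorem interior_deriv_le {w ws wss wt wtt : ℝ → ℝ → ℝ} {M : ℝ}
    (hc : ContinuousOn (fun p : ℝ × ℝ => w p.1 p.2) (Icc (-1) 1 ×ˢ Icc (-1) 1))
    (h1 : ∀ s ∈ Ioo (-1 : ℝ) 1, ∀ t ∈ Ioo (-1 : ℝ) 1, HasDerivAt (fun s => w s t) (ws s t) s)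
    (h2 : ∀ s ∈ Ioo (-1 : ℝ) 1, ∀ t ∈ Ioo (-1 : ℝ) 1, HasDerivAt (fun s => ws s t) (wss s t) s)
    (h3 : ∀ s ∈ Ioo (-1 : ℝ) 1, ∀ t ∈ Ioo (-1 : ℝ) 1, HasDerivAt (w s) (wt s t) t)
    (h4 : ∀ s ∈ Ioo (-1 : ℝ) 1, ∀ t ∈ Ioo (-1 : ℝ) 1, HasDerivAt (wt s) (wtt s t) t)
    (hM : ∀ s ∈ Icc (-1 : ℝ) 1, ∀ t ∈ Icc (-1 : ℝ) 1, |w s t| ≤ M)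
    (hΔ : ∀ s ∈ Ioo (-1 : ℝ) 1, ∀ t ∈ Ioo (-1 : ℝ) 1, |wss s t + wtt s t| ≤ M) :
    ws 0 0 ≤ 4 * M := by
  refine le_of_forall_gt_imp_ge_of_dense fun c hcM => ?_
  obtain ⟨N, rfl⟩ : ∃ N, c = 4 * N := ⟨c / 4, by ring⟩
  replace hcM : M < N := by linarith
  have hM0 : 0 ≤ M := (abs_nonneg _).trans (hM 0 (by norm_num) 0 (by norm_num))
  set h : ℝ × ℝ → ℝ := fun p =>
    N * (p.2 ^ 2 + 4 * p.1 - 2 * p.1 ^ 2) - (w p.1 p.2 - w (-p.1) p.2) / 2 with hh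
  have hsub : Icc (0 : ℝ) 1 ×ˢ Icc (-1 : ℝ) 1 ⊆ Icc (-1) 1 ×ˢ Icc (-1) 1 :=
    prod_mono (Icc_subset_Icc (by norm_num) le_rfl) le_rfl
  have hcont : ContinuousOn h (Icc 0 1 ×ˢ Icc (-1) 1) := by
    have c2 : ContinuousOn (fun p : ℝ × ℝ => w (-p.1) p.2) (Icc 0 1 ×ˢ Icc (-1) 1) := by
      refine hc.comp (f := fun p : ℝ × ℝ => (-p.1, p.2)) (by fun_prop) ?_
      rintro ⟨s, t⟩ ⟨hs, ht⟩
      exact ⟨⟨by linarith [hs.2], by linarith [hs.1]⟩, ht⟩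
    exact ContinuousOn.sub (by fun_prop) (((hc.mono hsub).sub c2).div_const 2)
  obtain ⟨⟨s₀, t₀⟩, ⟨hs₀, ht₀⟩, hmin⟩ := (isCompact_Icc.prod isCompact_Icc).exists_isMinOn
    ⟨((0 : ℝ), (0 : ℝ)), ⟨by norm_num, by norm_num⟩⟩ hcont
  simp only at hs₀ ht₀
  have key : 0 ≤ h (s₀, t₀) := by
    by_contra hneg
    push Not at hneg
    have hw1 := abs_le.1 (hM s₀ ⟨by linarith [hs₀.1], hs₀.2⟩ t₀ ht₀)
    have hw2 := abs_le.1 (hM (-s₀) ⟨by linarith [hs₀.2], by linarith [hs₀.1]⟩ t₀ ht₀)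
    have a1 : 0 < s₀ := by
      refine lt_of_le_of_ne hs₀.1 fun e => ?_
      subst e
      simp only [hh, neg_zero, sub_self] at hneg
      nlinarith [sq_nonneg t₀]
    have a2 : s₀ < 1 := by
      refine lt_of_le_of_ne hs₀.2 fun e => ?_
      subst e
      simp only [hh] at hneg
      nlinarith [sq_nonneg t₀]
    have a3 : -1 < t₀ := by
      refine lt_of_le_of_ne ht₀.1 fun e => ?_
      subst e
      simp only [hh] at hneg
      nlinarith [mul_nonneg (hM0.trans hcM.le) (mul_nonneg hs₀.1 (by linarith : 0 ≤ 2 - s₀))]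
    have a4 : t₀ < 1 := by
      refine lt_of_le_of_ne ht₀.2 fun e => ?_
      subst e
      simp only [hh] at hneg
      nlinarith [mul_nonneg (hM0.trans hcM.le) (mul_nonneg hs₀.1 (by linarith : 0 ≤ 2 - s₀))]
    have ms : s₀ ∈ Ioo (-1 : ℝ) 1 := ⟨by linarith, a2⟩
    have ms' : -s₀ ∈ Ioo (-1 : ℝ) 1 := ⟨by linarith, by linarith⟩
    have mt : t₀ ∈ Ioo (-1 : ℝ) 1 := ⟨a3, a4⟩
    have dneg : ∀ {f f' : ℝ → ℝ} {s : ℝ}, HasDerivAt f (f' (-s)) (-s) →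
        HasDerivAt (fun s => f (-s)) (-f' (-s)) s := by
      intro f f' s hf
      have := hf.comp s (hasDerivAt_neg s)
      simpa [Function.comp_def] using this
    have S := secondDeriv_nonneg_of_isLocalMin (f := fun s => h (s, t₀)) (x := s₀)
      (f' := fun s => N * (4 - 4 * s) - (ws s t₀ + ws (-s) t₀) / 2)
      (f'' := -(4 * N) - (wss s₀ t₀ - wss (-s₀) t₀) / 2)
      (by
        filter_upwards [Ioo_mem_nhds ms.1 ms.2] with s hs
        have hs' : -s ∈ Ioo (-1 : ℝ) 1 := ⟨by linarith [hs.2], by linarith [hs.1]⟩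
        have d1 := h1 s hs t₀ mt
        have d2 := dneg (f := fun s => w s t₀) (f' := fun s => ws s t₀) (h1 (-s) hs' t₀ mt)
        have d3 : HasDerivAt (fun s : ℝ => N * (t₀ ^ 2 + 4 * s - 2 * s ^ 2)) (N * (4 - 4 * s)) s := by
          have := ((((hasDerivAt_id s).const_mul 4).const_add (t₀ ^ 2)).sub
            (((hasDerivAt_id s).pow 2).const_mul 2)).const_mul N
          refine this.congr_deriv ?_
          simp only [id, Nat.cast_ofNat, Nat.add_one_sub_one, pow_one]
          ring
        refine (d3.sub ((d1.sub d2).div_const 2)).congr_deriv ?_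
        ring)
      (by
        have d1 := h2 s₀ ms t₀ mt
        have d2 := dneg (f := fun s => ws s t₀) (f' := fun s => wss s t₀) (h2 (-s₀) ms' t₀ mt)
        have d3 : HasDerivAt (fun s : ℝ => N * (4 - 4 * s)) (-(4 * N)) s₀ := by
          refine ((((hasDerivAt_id s₀).const_mul 4).const_sub 4).const_mul N).congr_deriv ?_
          ring
        refine (d3.sub ((d1.add d2).div_const 2)).congr_deriv ?_
        ring)
      (by
        filter_upwards [Ioo_mem_nhds a1 a2] with s hs
        exact hmin ⟨⟨hs.1.le, hs.2.le⟩, ht₀⟩)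
    have T := secondDeriv_nonneg_of_isLocalMin (f := fun t => h (s₀, t)) (x := t₀)
      (f' := fun t => N * (2 * t) - (wt s₀ t - wt (-s₀) t) / 2)
      (f'' := 2 * N - (wtt s₀ t₀ - wtt (-s₀) t₀) / 2)
      (by
        filter_upwards [Ioo_mem_nhds a3 a4] with t ht
        have d1 := h3 s₀ ms t ht
        have d2 := h3 (-s₀) ms' t ht
        have d3 : HasDerivAt (fun t : ℝ => N * (t ^ 2 + 4 * s₀ - 2 * s₀ ^ 2)) (N * (2 * t)) t := by
          have := ((((hasDerivAt_id t).pow 2).add_const (4 * s₀)).sub_const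
            (2 * s₀ ^ 2)).const_mul N
          refine this.congr_deriv ?_
          simp
        exact d3.sub ((d1.sub d2).div_const 2))
      (by
        have d1 := h4 s₀ ms t₀ mt
        have d2 := h4 (-s₀) ms' t₀ mt
        have d3 : HasDerivAt (fun t : ℝ => N * (2 * t)) (2 * N) t₀ := by
          refine (((hasDerivAt_id t₀).const_mul 2).const_mul N).congr_deriv ?_
          ring
        exact d3.sub ((d1.sub d2).div_const 2))
      (by
        filter_upwards [Ioo_mem_nhds a3 a4] with t ht
        exact hmin ⟨hs₀, ⟨ht.1.le, ht.2.le⟩⟩)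
    have b1 := abs_le.1 (hΔ s₀ ms t₀ mt)
    have b2 := abs_le.1 (hΔ (-s₀) ms' t₀ mt)
    linarith
  have hpos : ∀ s ∈ Ioo (0 : ℝ) 1, 0 ≤ h (s, 0) := fun s hs =>
    key.trans (hmin (show (s, (0 : ℝ)) ∈ _ from ⟨⟨hs.1.le, hs.2.le⟩, by norm_num⟩))
  have hder : HasDerivAt (fun s => 4 * N * s - (w s 0 - w (-s) 0) / 2) (4 * N - ws 0 0) 0 := by
    have d1 := h1 0 (by norm_num) 0 (by norm_num)
    have d2 : HasDerivAt (fun s => w (-s) 0) (-ws 0 0) 0 := by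
      have d1' : HasDerivAt (fun s => w s 0) (ws 0 0) (-(0 : ℝ)) := by simpa using d1
      have := d1'.comp 0 (hasDerivAt_neg (0 : ℝ))
      simpa [Function.comp_def] using this
    refine (((hasDerivAt_id (0 : ℝ)).const_mul (4 * N)).sub ((d1.sub d2).div_const 2)).congr_deriv ?_
    ring
  have := deriv_nonneg_of_nonneg_right hder (by simp) (fun s hs => by
    have := hpos s hs
    simp only [hh] at this
    nlinarith [mul_nonneg (hM0.trans hcM.le) (sq_nonneg s)])
  linarith

theorem Sm.interior_grad {Y M y₀ θ₀ : ℝ} {z : ℝ → ℝ → ℝ} (hz : Sm Y z) (hy : y₀ + 1 < Y)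
    (hM : ∀ y ∈ Icc (y₀ - 1) (y₀ + 1), ∀ θ, |z y θ| ≤ M)
    (hΔ : ∀ y ∈ Icc (y₀ - 1) (y₀ + 1), ∀ θ, |_root_.pdy (_root_.pdy z) y θ
      + _root_.pdt (_root_.pdt z) y θ| ≤ M) :
    |_root_.pdy z y₀ θ₀| ≤ 4 * M ∧ |_root_.pdt z y₀ θ₀| ≤ 4 * M := by
  have hlt : ∀ {s : ℝ}, s ≤ 1 → y₀ + s < Y := fun hs => by linarith
  have main : ∀ σ : ℝ, σ = 1 ∨ σ = -1 →
      σ * _root_.pdy z y₀ θ₀ ≤ 4 * M ∧ σ * _root_.pdt z y₀ θ₀ ≤ 4 * M := by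
    intro σ hσ
    have hσ1 : |σ| = 1 := by rcases hσ with rfl | rfl <;> simp
    have hcz : ContinuousOn (fun p : ℝ × ℝ => σ * z (y₀ + p.1) (θ₀ + p.2))
        (Icc (-1) 1 ×ˢ Icc (-1) 1) := by
      refine continuousOn_const.mul
        (hz.continuousOn.comp (f := fun p : ℝ × ℝ => (y₀ + p.1, θ₀ + p.2)) (by fun_prop) ?_)
      rintro ⟨s, t⟩ ⟨hs, -⟩
      exact hlt hs.2
    have hb : ∀ s ∈ Icc (-1 : ℝ) 1, ∀ t, |σ * z (y₀ + s) (θ₀ + t)| ≤ M := by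
      intro s hs t
      rw [abs_mul, hσ1, one_mul]
      exact hM _ ⟨by linarith [hs.1], by linarith [hs.2]⟩ _
    have hb2 : ∀ s ∈ Icc (-1 : ℝ) 1, ∀ t, |σ * _root_.pdy (_root_.pdy z) (y₀ + s) (θ₀ + t)
        + σ * _root_.pdt (_root_.pdt z) (y₀ + s) (θ₀ + t)| ≤ M := by
      intro s hs t
      rw [← mul_add, abs_mul, hσ1, one_mul]
      exact hΔ _ ⟨by linarith [hs.1], by linarith [hs.2]⟩ _
    have dy : ∀ {g : ℝ → ℝ → ℝ}, Sm Y g → ∀ {s : ℝ}, s < 1 → ∀ t,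
        HasDerivAt (fun s => σ * g (y₀ + s) (θ₀ + t)) (σ * _root_.pdy g (y₀ + s) (θ₀ + t)) s := by
      intro g hg s hs t
      exact ((hg.hasDerivAt_y (hlt hs.le)).comp_const_add y₀ s).const_mul σ
    have dt : ∀ {g : ℝ → ℝ → ℝ}, Sm Y g → ∀ {s : ℝ}, s < 1 → ∀ t,
        HasDerivAt (fun t => σ * g (y₀ + s) (θ₀ + t)) (σ * _root_.pdt g (y₀ + s) (θ₀ + t)) t := by
      intro g hg s hs t
      exact ((hg.hasDerivAt_t (hlt hs.le)).comp_const_add θ₀ t).const_mul σ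
    constructor
    · have := interior_deriv_le (M := M) hcz (fun s hs t _ => dy hz hs.2 t)
        (fun s hs t _ => dy hz.pdy hs.2 t) (fun s hs t _ => dt hz hs.2 t)
        (fun s hs t _ => dt hz.pdt hs.2 t) (fun s hs t _ => hb s hs t)
        (fun s hs t _ => hb2 s ⟨hs.1.le, hs.2.le⟩ t)
      simpa using this
    · have hsw : ContinuousOn (fun p : ℝ × ℝ => σ * z (y₀ + p.2) (θ₀ + p.1))
          (Icc (-1) 1 ×ˢ Icc (-1) 1) := by
        refine hcz.comp (f := fun p : ℝ × ℝ => (p.2, p.1)) (by fun_prop) ?_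
        rintro ⟨s, t⟩ ⟨hs, ht⟩
        exact ⟨ht, hs⟩
      have := interior_deriv_le (M := M) (w := fun t s => σ * z (y₀ + s) (θ₀ + t))
        (ws := fun t s => σ * _root_.pdt z (y₀ + s) (θ₀ + t))
        (wss := fun t s => σ * _root_.pdt (_root_.pdt z) (y₀ + s) (θ₀ + t))
        (wt := fun t s => σ * _root_.pdy z (y₀ + s) (θ₀ + t))
        (wtt := fun t s => σ * _root_.pdy (_root_.pdy z) (y₀ + s) (θ₀ + t)) hsw
        (fun t _ s hs => dt hz hs.2 t)
        (fun t _ s hs => dt hz.pdt hs.2 t) (fun t _ s hs => dy hz hs.2 t)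
        (fun t _ s hs => dy hz.pdy hs.2 t) (fun t _ s hs => hb s hs t)
        (fun t _ s hs => by rw [add_comm]; exact hb2 s ⟨hs.1.le, hs.2.le⟩ t)
      simpa using this
  have m1 := main 1 (Or.inl rfl)
  have m2 := main (-1) (Or.inr rfl)
  exact ⟨abs_le.2 ⟨by linarith [m2.1], by linarith [m1.1]⟩,
    abs_le.2 ⟨by linarith [m2.2], by linarith [m1.2]⟩⟩

/-- The derivative of the nonlinearity `s e^{s²}`. -/
theorem hasDerivAt_mul_exp_sq (s : ℝ) :
    HasDerivAt (fun s : ℝ => s * exp (s ^ 2)) ((1 + 2 * s ^ 2) * exp (s ^ 2)) s := by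
  refine ((hasDerivAt_id s).mul ((hasDerivAt_id s).pow 2).exp).congr_deriv ?_
  simp
  ring

/-- Angular mean. -/
def avg (g : ℝ → ℝ → ℝ) (y : ℝ) : ℝ := (2 * π)⁻¹ * ∫ θ in (0 : ℝ)..(2 * π), g y θ

theorem avg_mono {g h : ℝ → ℝ → ℝ} {y : ℝ} (hg : Continuous (g y)) (hh : Continuous (h y))
    (hgh : ∀ θ, g y θ ≤ h y θ) : avg g y ≤ avg h y := by
  unfold avg
  gcongr
  exact intervalIntegral.integral_mono (by positivity) (hg.intervalIntegrable _ _)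
    (hh.intervalIntegrable _ _) hgh

theorem avg_const (c y : ℝ) : avg (fun _ _ => c) y = c := by
  have := pi_pos
  unfold avg
  simp
  field_simp

theorem abs_avg_le {g : ℝ → ℝ → ℝ} {y M : ℝ} (hg : Continuous (g y)) (h : ∀ θ, |g y θ| ≤ M) :
    |avg g y| ≤ M := by
  refine abs_le.2 ⟨?_, ?_⟩
  · calc -M = avg (fun _ _ => -M) y := (avg_const _ _).symm
      _ ≤ _ := avg_mono continuous_const hg fun θ => (abs_le.1 (h θ)).1
  · calc avg g y ≤ avg (fun _ _ => M) y := avg_mono hg continuous_const fun θ => (abs_le.1 (h θ)).2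
      _ = M := avg_const _ _

theorem Sm.hasDerivAt_avg {Y y : ℝ} {g : ℝ → ℝ → ℝ} (hg : Sm Y g) (hy : y < Y) :
    HasDerivAt (avg g) (avg (_root_.pdy g) y) y :=
  (hg.hasDerivAt_integral' hy).const_mul _

/-- A periodic function deviates from its mean by at most the integral of its derivative. -/
theorem Sm.abs_sub_avg_le {Y y : ℝ} {g : ℝ → ℝ → ℝ} (hg : Sm Y g) (hy : y < Y)
    (hp : Function.Periodic (g y) (2 * π)) (θ : ℝ) :
    |g y θ - avg g y| ≤ ∫ t in (0 : ℝ)..(2 * π), |_root_.pdt g y t| := by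
  have hpi := pi_pos
  set I := ∫ t in (0 : ℝ)..(2 * π), |_root_.pdt g y t| with hI
  have hcp : Continuous (_root_.pdt g y) := hg.pdt.continuous_t hy
  have e1 : avg g y = (2 * π)⁻¹ * ∫ t in θ..(θ + 2 * π), g y t := by
    have := hp.intervalIntegral_add_eq θ 0
    rw [zero_add] at this
    rw [this, avg]
  have e2 : I = ∫ t in θ..(θ + 2 * π), |_root_.pdt g y t| := by
    have hq : Function.Periodic (fun t => |_root_.pdt g y t|) (2 * π) := fun t => by
      simp only [periodic_pdt hp t]
    have := hq.intervalIntegral_add_eq θ 0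
    rw [zero_add] at this
    rw [this]
  have bd : ∀ t ∈ Icc θ (θ + 2 * π), |g y θ - g y t| ≤ I := by
    intro t ht
    have h1 : ∫ s in θ..t, _root_.pdt g y s = g y t - g y θ :=
      intervalIntegral.integral_eq_sub_of_hasDerivAt (fun s _ => hg.hasDerivAt_t hy)
        (hcp.intervalIntegrable _ _)
    rw [abs_sub_comm, ← h1]
    refine (intervalIntegral.abs_integral_le_integral_abs ht.1).trans ?_
    rw [e2]
    exact intervalIntegral.integral_mono_interval le_rfl ht.1 ht.2
      (Eventually.of_forall fun s => abs_nonneg _) (hcp.abs.intervalIntegrable _ _)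
  have hcg := hg.continuous_t hy
  have e3 : g y θ - avg g y = (2 * π)⁻¹ * ∫ t in θ..(θ + 2 * π), (g y θ - g y t) := by
    rw [intervalIntegral.integral_sub intervalIntegrable_const (hcg.intervalIntegrable _ _), e1]
    simp
    field_simp
  rw [e3, abs_mul, abs_of_pos (by positivity)]
  have : |∫ t in θ..(θ + 2 * π), (g y θ - g y t)| ≤ I * |θ + 2 * π - θ| := by
    have := intervalIntegral.norm_integral_le_of_norm_le_const (a := θ) (b := θ + 2 * π)
      (f := fun t => g y θ - g y t) (C := I) (fun t ht => by
        rw [uIoc_of_le (by linarith)] at ht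
        exact bd t ⟨ht.1.le, ht.2⟩)
    exact this
  rw [add_sub_cancel_left, abs_of_pos (a := 2 * π) (by positivity)] at this
  calc (2 * π)⁻¹ * |∫ t in θ..(θ + 2 * π), (g y θ - g y t)| ≤ (2 * π)⁻¹ * (I * (2 * π)) := by gcongr
    _ = I := by field_simp

/-- The problem in logarithmic polar coordinates `x = μ e^y (cos θ, sin θ)`. -/
structure Cyl (K : ℝ) where
  γ : ℝ
  φ : ℝ
  Y : ℝ
  u : ℝ → ℝ → ℝ
  F : ℝ → ℝ → ℝ
  β : ℝ → ℝ
  dβ : ℝ → ℝ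
  one_le_K : 1 ≤ K
  one_le_γ : 1 ≤ γ
  γ_sq : 10 * K ≤ γ ^ 2
  le_φ : K⁻¹ ≤ φ
  φ_le : φ ≤ K
  Y_bd : exp (2 * Y - γ ^ 2) ≤ K * γ ^ 2
  su : Sm Y u
  sF : Sm Y F
  pu : ∀ y < Y, Function.Periodic (u y) (2 * π)
  u_pos : ∀ y < Y, ∀ θ, 0 < u y θ
  F_pos : ∀ y < Y, ∀ θ, 0 < F y θ
  pde : ∀ y < Y, ∀ θ, pdy (pdy u) y θ + pdt (pdt u) y θ
    = -(exp (2 * y - γ ^ 2) / (φ * γ ^ 2) * F y θ * (u y θ * exp (u y θ ^ 2)))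
  u_y : ∀ y < Y, ∀ θ, |pdy u y θ| ≤ K / γ
  u_t : ∀ y < Y, ∀ θ, |pdt u y θ| ≤ K / γ
  F_sub : ∀ y < Y, ∀ θ, |F y θ - φ| ≤ K * exp (y - Y)
  F_t : ∀ y < Y, ∀ θ, |pdt F y θ| ≤ K * exp (y - Y)
  init : ∀ ε > 0, ∃ y₀ < Y, ∀ y ≤ y₀, ∀ θ,
    |u y θ - γ| ≤ ε * exp y ∧ |pdy u y θ| ≤ ε * exp y ∧ |pdt u y θ| ≤ ε * exp y
  hβ : ∀ y, HasDerivAt β (dβ y) y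
  hdβ : ∀ y, HasDerivAt dβ
    (-(exp (2 * y - γ ^ 2) / (φ * γ ^ 2) * φ * (β y * exp (β y ^ 2)))) y
  initβ : ∀ ε > 0, ∃ y₀, ∀ y ≤ y₀, |β y - γ| ≤ ε * exp y ∧ |dβ y| ≤ ε * exp y

namespace Cyl

variable {K : ℝ} (d : Cyl K)

/-- The weight `λ r²` in logarithmic coordinates. -/
def k (y : ℝ) : ℝ := exp (2 * y - d.γ ^ 2) / (d.φ * d.γ ^ 2)

/-- The density of the Laplacian of `u`. -/
def nl (y θ : ℝ) : ℝ := d.k y * d.F y θ * (d.u y θ * exp (d.u y θ ^ 2))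

theorem K_pos (d : Cyl K) : 0 < K := by linarith [d.one_le_K]
theorem γ_pos : 0 < d.γ := by linarith [d.one_le_γ]
theorem φ_pos : 0 < d.φ := (inv_pos.2 d.K_pos).trans_le d.le_φ
theorem k_pos (y : ℝ) : 0 < d.k y := by
  have := d.φ_pos; have := d.γ_pos
  unfold k; positivity

theorem k_le_exp (y : ℝ) : d.k y ≤ K * exp (2 * y - d.γ ^ 2) / d.γ ^ 2 := by
  have h1 := d.φ_pos; have h2 := d.γ_pos; have hK := d.K_pos
  have h3 : 1 ≤ K * d.φ := by
    calc 1 = K * K⁻¹ := by field_simp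
      _ ≤ _ := by gcongr; exact d.le_φ
  unfold k
  rw [div_le_div_iff₀ (by positivity) (by positivity)]
  have h4 : 0 < exp (2 * y - d.γ ^ 2) * d.γ ^ 2 := by positivity
  nlinarith

theorem k_le (y : ℝ) : d.k y ≤ K ^ 2 * exp (2 * (y - d.Y)) := by
  have h2 := d.γ_pos; have hK := d.K_pos
  refine (d.k_le_exp y).trans ?_
  rw [div_le_iff₀ (by positivity)]
  have e : exp (2 * y - d.γ ^ 2) = exp (2 * d.Y - d.γ ^ 2) * exp (2 * (y - d.Y)) := by
    rw [← exp_add]; ring_nf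
  rw [e]
  calc K * (exp (2 * d.Y - d.γ ^ 2) * exp (2 * (y - d.Y)))
      ≤ K * ((K * d.γ ^ 2) * exp (2 * (y - d.Y))) := by gcongr; exact d.Y_bd
    _ = _ := by ring

theorem k_add (y s : ℝ) : d.k (y + s) = exp (2 * s) * d.k y := by
  unfold k
  rw [show 2 * (y + s) - d.γ ^ 2 = 2 * s + (2 * y - d.γ ^ 2) by ring, exp_add]
  ring

theorem Y_le : d.Y ≤ d.γ ^ 2 := by
  have hK := d.K_pos
  have h1 := quadratic_le_exp_of_nonneg (sq_nonneg d.γ)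
  have h2 : exp (2 * d.Y - d.γ ^ 2) ≤ exp (d.γ ^ 2) := by
    refine d.Y_bd.trans (le_trans ?_ h1)
    nlinarith [d.γ_sq, d.one_le_K]
  have := exp_le_exp.1 h2
  linarith

theorem exp_sub_le_one {y : ℝ} (hy : y < d.Y) : exp (y - d.Y) ≤ 1 :=
  exp_le_one_iff.2 (by linarith)

theorem F_le {y : ℝ} (hy : y < d.Y) (θ : ℝ) : d.F y θ ≤ 2 * K := by
  have h1 := abs_le.1 (d.F_sub y hy θ)
  have h2 := d.exp_sub_le_one hy
  have h3 := d.φ_le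
  nlinarith [d.K_pos]

theorem smk : Sm d.Y (fun y _ => d.k y) := by
  unfold k
  exact Sm.of_fst (f := fun y => exp (2 * y - d.γ ^ 2) / (d.φ * d.γ ^ 2)) (by fun_prop)

theorem sm_nl : Sm d.Y d.nl :=
  (d.smk.mul d.sF).mul (d.su.comp (f := fun s => s * exp (s ^ 2)) (by fun_prop))

theorem nl_pos {y : ℝ} (hy : y < d.Y) (θ : ℝ) : 0 < d.nl y θ := by
  have := d.k_pos y; have := d.F_pos y hy θ; have := d.u_pos y hy θ
  unfold nl; positivity

theorem pde' {y : ℝ} (hy : y < d.Y) (θ : ℝ) :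
    pdy (pdy d.u) y θ + pdt (pdt d.u) y θ = -d.nl y θ := d.pde y hy θ

theorem lip {y y' : ℝ} (hy : y < d.Y) (hy' : y' < d.Y) (θ θ' : ℝ) :
    |d.u y θ - d.u y' θ'| ≤ K / d.γ * (|y - y'| + |θ - θ'|) := by
  have h1 : |d.u y θ - d.u y' θ| ≤ K / d.γ * |y - y'| := by
    have := (convex_Iio d.Y).norm_image_sub_le_of_norm_hasDerivWithin_le
      (f := fun s => d.u s θ) (f' := fun s => pdy d.u s θ) (C := K / d.γ)
      (fun s hs => (d.su.hasDerivAt_y hs).hasDerivWithinAt) (fun s hs => d.u_y s hs θ) hy' hy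
    simpa using this
  have h2 : |d.u y' θ - d.u y' θ'| ≤ K / d.γ * |θ - θ'| := by
    have := convex_univ.norm_image_sub_le_of_norm_hasDerivWithin_le
      (f := d.u y') (f' := fun s => pdt d.u y' s) (C := K / d.γ)
      (fun s _ => (d.su.hasDerivAt_t hy').hasDerivWithinAt) (fun s _ => d.u_t y' hy' s)
      (mem_univ θ') (mem_univ θ)
    simpa using this
  calc |d.u y θ - d.u y' θ'| ≤ |d.u y θ - d.u y' θ| + |d.u y' θ - d.u y' θ'| := abs_sub_le _ _ _
    _ ≤ _ := by rw [mul_add]; exact add_le_add h1 h2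

theorem hasDerivAt_b {y : ℝ} (hy : y < d.Y) : HasDerivAt (avg d.u) (avg (pdy d.u) y) y :=
  d.su.hasDerivAt_avg hy

theorem hasDerivAt_db {y : ℝ} (hy : y < d.Y) :
    HasDerivAt (avg (pdy d.u)) (-avg d.nl y) y := by
  refine (d.su.pdy.hasDerivAt_avg hy).congr_deriv ?_
  have e : ∀ θ, pdy (pdy d.u) y θ = -d.nl y θ - pdt (pdt d.u) y θ := fun θ => by
    linarith [d.pde' hy θ]
  have h0 := d.su.pdt.integral_pdt hy (periodic_pdt (d.pu y hy))
  unfold avg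
  simp_rw [e]
  rw [intervalIntegral.integral_sub, h0, intervalIntegral.integral_neg]
  · ring
  · exact (d.sm_nl.continuous_t hy).neg.intervalIntegrable _ _
  · exact (d.su.pdt.pdt.continuous_t hy).intervalIntegrable _ _

theorem avg_nl_nonneg {y : ℝ} (hy : y < d.Y) : 0 ≤ avg d.nl y := by
  rw [← avg_const 0 y]
  exact avg_mono continuous_const (d.sm_nl.continuous_t hy) fun θ => (d.nl_pos hy θ).le

theorem abs_db_le {y : ℝ} (hy : y < d.Y) : |avg (pdy d.u) y| ≤ K / d.γ :=
  abs_avg_le (d.su.pdy.continuous_t hy) (d.u_y y hy)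

theorem avg_init {ε : ℝ} (hε : 0 < ε) : ∃ y₀ < d.Y, ∀ y ≤ y₀,
    |avg d.u y - d.γ| ≤ ε * exp y ∧ |avg (pdy d.u) y| ≤ ε * exp y := by
  obtain ⟨y₀, h0, h⟩ := d.init ε hε
  refine ⟨y₀, h0, fun y hy => ⟨?_, ?_⟩⟩
  · have hc := d.su.continuous_t (hy.trans_lt h0)
    have e : avg d.u y - d.γ = avg (fun y θ => d.u y θ - d.γ) y := by
      have hpi := pi_pos
      unfold avg
      rw [intervalIntegral.integral_sub (hc.intervalIntegrable _ _) intervalIntegrable_const]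
      simp
      field_simp
    rw [e]
    exact abs_avg_le (hc.sub continuous_const) fun θ => (h y hy θ).1
  · exact abs_avg_le (d.su.pdy.continuous_t (hy.trans_lt h0)) fun θ => (h y hy θ).2.1

theorem db_antitone : AntitoneOn (avg (pdy d.u)) (Iio d.Y) := by
  refine antitoneOn_of_deriv_nonpos (convex_Iio _)
    (fun y hy => (d.hasDerivAt_db hy).continuousAt.continuousWithinAt) ?_ ?_
  · rw [interior_Iio]
    exact fun y hy => (d.hasDerivAt_db hy).differentiableAt.differentiableWithinAt
  · rw [interior_Iio]
    intro y hy
    rw [(d.hasDerivAt_db hy).deriv]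
    linarith [d.avg_nl_nonneg hy]

theorem db_nonpos {y : ℝ} (hy : y < d.Y) : avg (pdy d.u) y ≤ 0 := by
  refine le_of_forall_pos_le_add fun ε hε => ?_
  obtain ⟨y₀, -, h⟩ := d.avg_init hε
  set s := min (min y y₀) 0
  have hs1 : s ≤ y := (min_le_left _ _).trans (min_le_left _ _)
  have hs2 : s ≤ y₀ := (min_le_left _ _).trans (min_le_right _ _)
  have hs3 : exp s ≤ 1 := exp_le_one_iff.2 (min_le_right _ _)
  have h1 := d.db_antitone (show s ∈ Iio d.Y from hs1.trans_lt hy) hy hs1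
  have h2 := (abs_le.1 (h s hs2).2).2
  nlinarith

theorem b_le {y : ℝ} (hy : y < d.Y) : avg d.u y ≤ d.γ := by
  have anti : AntitoneOn (avg d.u) (Iio d.Y) := by
    refine antitoneOn_of_deriv_nonpos (convex_Iio _)
      (fun y hy => (d.hasDerivAt_b hy).continuousAt.continuousWithinAt) ?_ ?_
    · rw [interior_Iio]
      exact fun y hy => (d.hasDerivAt_b hy).differentiableAt.differentiableWithinAt
    · rw [interior_Iio]
      intro y hy
      rw [(d.hasDerivAt_b hy).deriv]
      exact d.db_nonpos hy
  refine le_of_forall_pos_le_add fun ε hε => ?_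
  obtain ⟨y₀, -, h⟩ := d.avg_init hε
  set s := min (min y y₀) 0
  have hs1 : s ≤ y := (min_le_left _ _).trans (min_le_left _ _)
  have hs2 : s ≤ y₀ := (min_le_left _ _).trans (min_le_right _ _)
  have hs3 : exp s ≤ 1 := exp_le_one_iff.2 (min_le_right _ _)
  have h1 := anti (show s ∈ Iio d.Y from hs1.trans_lt hy) hy hs1
  have h2 := (abs_le.1 (h s hs2).1).2
  nlinarith

theorem abs_u_sub_b_le {y : ℝ} (hy : y < d.Y) (θ : ℝ) :
    |d.u y θ - avg d.u y| ≤ 2 * π * K / d.γ := by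
  have hpi := pi_pos
  refine (d.su.abs_sub_avg_le hy (d.pu y hy) θ).trans ?_
  have : ∫ t in (0 : ℝ)..(2 * π), |pdt d.u y t| ≤ ∫ t in (0 : ℝ)..(2 * π), K / d.γ :=
    intervalIntegral.integral_mono (by positivity)
      ((d.su.pdt.continuous_t hy).abs.intervalIntegrable _ _) intervalIntegrable_const
      (d.u_t y hy)
  refine this.trans (le_of_eq ?_)
  rw [intervalIntegral.integral_const, smul_eq_mul]
  ring

theorem two_pi_K_div_le : 2 * π * K / d.γ ≤ d.γ := by
  have := d.γ_pos
  rw [div_le_iff₀ this]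
  have := pi_lt_d2
  nlinarith [d.γ_sq, d.K_pos]

theorem u_le {y : ℝ} (hy : y < d.Y) (θ : ℝ) : d.u y θ ≤ 2 * d.γ := by
  have h1 := (abs_le.1 (d.abs_u_sub_b_le hy θ)).2
  have h2 := d.b_le hy
  linarith [d.two_pi_K_div_le]

end Cyl

namespace Cyl

variable {K : ℝ} (d : Cyl K)

/-- A majorant, up to constants, of all coefficients of the linearised problem. -/
def dens (y θ : ℝ) : ℝ := d.k y * (4 * K + d.γ * d.u y θ) * exp (d.u y θ ^ 2)

theorem dens_le_exp {y : ℝ} (hy : y < d.Y) (θ : ℝ) :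
    d.dens y θ ≤ K * (4 * K + 2) * exp (2 * y - d.γ ^ 2 + d.u y θ ^ 2) := by
  have hK := d.K_pos; have hγ := d.γ_pos; have hu := d.u_pos y hy θ
  have hγ1 := d.one_le_γ
  have h1 : 4 * K + d.γ * d.u y θ ≤ (4 * K + 2) * d.γ ^ 2 := by
    have := d.u_le hy θ
    have h2 : 1 ≤ d.γ ^ 2 := one_le_pow₀ hγ1
    nlinarith
  unfold dens
  calc d.k y * (4 * K + d.γ * d.u y θ) * exp (d.u y θ ^ 2)
      ≤ (K * exp (2 * y - d.γ ^ 2) / d.γ ^ 2) * ((4 * K + 2) * d.γ ^ 2) * exp (d.u y θ ^ 2) := by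
        have := d.k_le_exp y
        gcongr
    _ = _ := by rw [exp_add]; field_simp

theorem abs_u_sub_u_le {y y' : ℝ} (hy : y < d.Y) (hy' : y' < d.Y) (h : |y - y'| ≤ 1) (θ θ' : ℝ) :
    |d.u y θ - d.u y' θ'| ≤ 14 * K / d.γ := by
  have hγ := d.γ_pos
  have h1 := d.lip hy hy' θ θ
  have h2 := d.abs_u_sub_b_le hy' θ
  have h3 := d.abs_u_sub_b_le hy' θ'
  have e : 14 * K / d.γ = K / d.γ * 14 := by ring
  have e2 : 2 * π * K / d.γ = K / d.γ * (2 * π) := by ring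
  have hp : 0 < K / d.γ := div_pos d.K_pos hγ
  rw [e2, abs_le] at h2 h3
  rw [sub_self, abs_zero, add_zero, abs_le] at h1
  have h4 : K / d.γ * |y - y'| ≤ K / d.γ * 1 := by gcongr
  have h5 : K / d.γ * π ≤ K / d.γ * 3.15 := by gcongr; exact pi_lt_d2.le
  rw [e, abs_le]
  constructor <;> nlinarith

/-- A constant depending only on `K`. -/
def densConst (K : ℝ) : ℝ := K ^ 2 * (104 * K) * exp ((100 * K) ^ 2) + 8 * K ^ 2 * exp (56 * K)

theorem dens_le_inner {y : ℝ} (hy : y ≤ d.Y - (1 + 2 * K ^ 2)) (θ : ℝ) :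
    d.dens y θ ≤ densConst K := by
  have hK := d.K_pos; have hγ := d.γ_pos; have hγ1 := d.one_le_γ; have hK1 := d.one_le_K
  have hyY : y < d.Y := by nlinarith
  have hu := d.u_pos y hyY θ
  have hk := d.k_pos y
  by_cases hc : d.γ * d.u y θ ≤ 100 * K
  · have h1 : d.u y θ ≤ 100 * K := by nlinarith
    have h2 : d.k y ≤ K ^ 2 := by
      refine (d.k_le y).trans ?_
      have : exp (2 * (y - d.Y)) ≤ 1 := exp_le_one_iff.2 (by linarith)
      have := mul_le_mul_of_nonneg_left this (sq_nonneg K)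
      linarith
    have : d.dens y θ ≤ K ^ 2 * (104 * K) * exp ((100 * K) ^ 2) := by
      unfold dens
      gcongr
      linarith
    refine this.trans ?_
    unfold densConst
    have : 0 < 8 * K ^ 2 * exp (56 * K) := by positivity
    linarith
  · push Not at hc
    have hFlow : ∀ y' ∈ Icc y (y + 1), ∀ θ', 1 / (2 * K) ≤ d.F y' θ' := by
      intro y' hy' θ'
      have hy'Y : y' < d.Y := by nlinarith [hy'.2]
      have h1 := (abs_le.1 (d.F_sub y' hy'Y θ')).1
      have h2 : exp (y' - d.Y) ≤ 1 / (2 * K ^ 2) := by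
        calc exp (y' - d.Y) ≤ exp (-(2 * K ^ 2)) := exp_le_exp.2 (by linarith [hy'.2])
          _ = 1 / exp (2 * K ^ 2) := by rw [exp_neg, one_div]
          _ ≤ _ := by
            gcongr
            linarith [add_one_le_exp (2 * K ^ 2)]
      have h3 := d.le_φ
      have h4 : K * exp (y' - d.Y) ≤ 1 / (2 * K) := by
        calc K * exp (y' - d.Y) ≤ K * (1 / (2 * K ^ 2)) := by gcongr
          _ = _ := by field_simp
      have h5 : K⁻¹ = 1 / (2 * K) + 1 / (2 * K) := by field_simp; norm_num
      linarith
    have hnl : ∀ y' ∈ Icc y (y + 1), ∀ θ',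
        d.dens y θ / (4 * K * d.γ * exp (56 * K)) ≤ d.nl y' θ' := by
      intro y' hy' θ'
      have hy'Y : y' < d.Y := by nlinarith [hy'.2]
      have hu' := d.u_pos y' hy'Y θ'
      have hd := abs_le.1 (d.abs_u_sub_u_le hyY hy'Y
        (abs_le.2 ⟨by linarith [hy'.2], by linarith [hy'.1]⟩) θ θ')
      have e14 : d.γ * (14 * K / d.γ) = 14 * K := by field_simp
      have h1 : d.γ * d.u y θ ≤ d.γ * d.u y' θ' + 14 * K := by nlinarith
      have h2 : d.u y θ ^ 2 ≤ 56 * K + d.u y' θ' ^ 2 := by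
        have a1 := d.u_le hyY θ
        have a2 := d.u_le hy'Y θ'
        have a3 : (d.u y θ - d.u y' θ') * (d.u y θ + d.u y' θ')
            ≤ (14 * K / d.γ) * (4 * d.γ) := by
          apply mul_le_mul hd.2 (by linarith) (by positivity) (by positivity)
        have e : (14 * K / d.γ) * (4 * d.γ) = 56 * K := by field_simp; norm_num
        nlinarith
      have h3 : d.k y ≤ d.k y' := by
        have : y' = y + (y' - y) := by ring
        rw [this, d.k_add]
        have : 1 ≤ exp (2 * (y' - y)) := one_le_exp (by linarith [hy'.1])
        nlinarith
      rw [div_le_iff₀ (by positivity)]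
      unfold dens nl
      have h4 := hFlow y' hy' θ'
      have hk' := d.k_pos y'
      calc d.k y * (4 * K + d.γ * d.u y θ) * exp (d.u y θ ^ 2)
          ≤ d.k y' * (2 * (d.γ * d.u y' θ')) * exp (56 * K + d.u y' θ' ^ 2) := by
            gcongr
            linarith
        _ = d.k y' * (1 / (2 * K)) * (d.u y' θ' * exp (d.u y' θ' ^ 2))
            * (4 * K * d.γ * exp (56 * K)) := by
            rw [exp_add]; field_simp; ring
        _ ≤ _ := by gcongr
    have h2K : 1 ≤ 2 * K ^ 2 := by nlinarith
    have hlt : ∀ s ≤ y + 1, s < d.Y := fun s hs => by linarith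
    obtain ⟨y', hy', e⟩ := exists_hasDerivAt_eq_slope (avg (pdy d.u)) (fun s => -avg d.nl s)
      (show y < y + 1 by linarith)
      (fun s hs => (d.hasDerivAt_db (hlt s hs.2)).continuousAt.continuousWithinAt)
      (fun s hs => d.hasDerivAt_db (hlt s hs.2.le))
    have h1 := (abs_le.1 (d.abs_db_le (hlt _ le_rfl))).1
    have h2 := (abs_le.1 (d.abs_db_le hyY)).2
    have h3 : avg d.nl y' ≤ 2 * K / d.γ := by
      have e3 : 2 * K / d.γ = K / d.γ + K / d.γ := by ring
      rw [add_sub_cancel_left, div_one] at e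
      linarith
    have h4 : d.dens y θ / (4 * K * d.γ * exp (56 * K)) ≤ avg d.nl y' := by
      rw [← avg_const (d.dens y θ / (4 * K * d.γ * exp (56 * K))) y']
      exact avg_mono continuous_const (d.sm_nl.continuous_t (hlt _ hy'.2.le))
        (hnl y' ⟨hy'.1.le, hy'.2.le⟩)
    have h5 : d.dens y θ ≤ 8 * K ^ 2 * exp (56 * K) := by
      have := h4.trans h3
      rw [div_le_iff₀ (by positivity)] at this
      refine this.trans (le_of_eq ?_)
      field_simp
      ring
    refine h5.trans ?_
    unfold densConst
    have : 0 < K ^ 2 * (104 * K) * exp ((100 * K) ^ 2) := by positivity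
    linarith

/-- A constant depending only on `K`. -/
def densConst' (K : ℝ) : ℝ := exp (2 * (1 + 2 * K ^ 2)) * (1 + (1 + 2 * K ^ 2) * K)
  * exp (4 * (1 + 2 * K ^ 2) * K) * densConst K

theorem densConst'_pos (d : Cyl K) : 0 < densConst' K := by
  have := d.K_pos
  unfold densConst' densConst
  positivity

theorem dens_le {y : ℝ} (hy : y < d.Y) (θ : ℝ) : d.dens y θ ≤ densConst' K := by
  have hK := d.K_pos; have hγ := d.γ_pos
  set T := 1 + 2 * K ^ 2 with hT
  have hT0 : 0 < T := by positivity
  have hyT : y - T < d.Y := by linarith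
  have hu := d.u_pos y hy θ
  have hu' := d.u_pos _ hyT θ
  have h0 := d.dens_le_inner (y := y - T) (by linarith) θ
  have hd := (abs_le.1 (d.lip hy hyT θ θ)).2
  rw [sub_self, abs_zero, add_zero, sub_sub_cancel, abs_of_pos hT0] at hd
  have h1 : d.γ * d.u y θ ≤ d.γ * d.u (y - T) θ + T * K := by
    have : d.γ * (K / d.γ * T) = T * K := by field_simp
    nlinarith
  have h2 : d.u y θ ^ 2 ≤ 4 * T * K + d.u (y - T) θ ^ 2 := by
    have a1 := d.u_le hy θ
    have a2 := d.u_le hyT θ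
    have a3 : (d.u y θ - d.u (y - T) θ) * (d.u y θ + d.u (y - T) θ)
        ≤ (K / d.γ * T) * (4 * d.γ) := by
      apply mul_le_mul hd (by linarith) (by positivity) (by positivity)
    have e : (K / d.γ * T) * (4 * d.γ) = 4 * T * K := by field_simp
    nlinarith
  have h3 : d.k y = exp (2 * T) * d.k (y - T) := by
    rw [← d.k_add, sub_add_cancel]
  have hk' := d.k_pos (y - T)
  have h4 : 4 * K + d.γ * d.u y θ ≤ (1 + T * K) * (4 * K + d.γ * d.u (y - T) θ) := by
    have : 0 < T * K * (d.γ * d.u (y - T) θ) := by positivity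
    nlinarith [d.one_le_K, mul_pos hT0 hK]
  calc d.dens y θ = d.k y * (4 * K + d.γ * d.u y θ) * exp (d.u y θ ^ 2) := rfl
    _ ≤ (exp (2 * T) * d.k (y - T)) * ((1 + T * K) * (4 * K + d.γ * d.u (y - T) θ))
        * exp (4 * T * K + d.u (y - T) θ ^ 2) := by rw [h3]; gcongr
    _ = exp (2 * T) * (1 + T * K) * exp (4 * T * K) * d.dens (y - T) θ := by
      rw [exp_add, dens]; ring
    _ ≤ _ := by unfold densConst'; gcongr

/-- Where `u` is small compared with `γ`, the density grows along rays. -/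
theorem dens_le_right {y : ℝ} (hy0 : 0 ≤ y) (hy : y < d.Y) (θ : ℝ)
    (hu : d.u y θ ≤ 1 / (8 * K) * d.γ) :
    d.dens y θ ≤ densConst' K * exp (-(1 / (8 * K ^ 2)) * (d.Y - y)) := by
  have hK := d.K_pos; have hγ := d.γ_pos; have hK1 := d.one_le_K
  set κ := 1 / (8 * K ^ 2) with hκ
  have hκ0 : 0 < κ := by positivity
  have hκ1 : κ < 1 := by
    rw [hκ, div_lt_one (by positivity)]; nlinarith
  set T := κ * (d.Y - y) with hT
  have hT0 : 0 ≤ T := mul_nonneg hκ0.le (by linarith)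
  have hTY : y + T < d.Y := by
    have : T < 1 * (d.Y - y) := mul_lt_mul_of_pos_right hκ1 (by linarith)
    linarith
  have hTγ : K / d.γ * T ≤ 1 / (8 * K) * d.γ := by
    have h1 : T ≤ κ * d.γ ^ 2 := by
      rw [hT]; gcongr; linarith [d.Y_le]
    calc K / d.γ * T ≤ K / d.γ * (κ * d.γ ^ 2) := by gcongr
      _ = _ := by rw [hκ]; field_simp
  have hus : ∀ s ∈ Icc 0 T, d.u (y + s) θ ≤ 1 / (4 * K) * d.γ := by
    intro s hs
    have h1 := (abs_le.1 (d.lip (y := y + s) (by linarith [hs.2]) hy θ θ)).2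
    rw [sub_self, abs_zero, add_zero, add_sub_cancel_left, abs_of_nonneg hs.1] at h1
    have h2 : K / d.γ * s ≤ K / d.γ * T := by
      have := hs.2; gcongr
    have e : 1 / (4 * K) * d.γ = 1 / (8 * K) * d.γ + 1 / (8 * K) * d.γ := by
      field_simp; norm_num
    linarith
  set g : ℝ → ℝ := fun s => exp s * (4 * K + d.γ * d.u (y + s) θ) * exp (d.u (y + s) θ ^ 2)
    with hg
  have hgd : ∀ s ≤ T, HasDerivAt g (exp s * exp (d.u (y + s) θ ^ 2) *
      ((4 * K + d.γ * d.u (y + s) θ) + d.γ * pdy d.u (y + s) θ +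
        (4 * K + d.γ * d.u (y + s) θ) * (2 * d.u (y + s) θ * pdy d.u (y + s) θ))) s := by
    intro s hs
    have h1 : HasDerivAt (fun s => d.u (y + s) θ) (pdy d.u (y + s) θ) s :=
      (d.su.hasDerivAt_y (θ := θ) (show y + s < d.Y by linarith)).comp_const_add y s
    refine (((hasDerivAt_exp s).mul ((h1.const_mul d.γ).const_add (4 * K))).mul
      (h1.pow 2).exp).congr_deriv ?_
    simp
    ring
  have hmono : MonotoneOn g (Icc 0 T) := by
    refine monotoneOn_of_deriv_nonneg (convex_Icc _ _)
      (fun s hs => (hgd s hs.2).continuousAt.continuousWithinAt) ?_ ?_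
    · rw [interior_Icc]
      exact fun s hs => (hgd s hs.2.le).differentiableAt.differentiableWithinAt
    · rw [interior_Icc]
      intro s hs
      rw [(hgd s hs.2.le).deriv]
      have hsY : y + s < d.Y := by linarith [hs.2]
      have a1 := (abs_le.1 (d.u_y _ hsY θ)).1
      have a2 := hus s ⟨hs.1.le, hs.2.le⟩
      have a3 := d.u_pos _ hsY θ
      set U := d.u (y + s) θ
      set p := pdy d.u (y + s) θ
      have b1 : -K ≤ d.γ * p := by
        have : d.γ * (-(K / d.γ)) = -K := by field_simp
        rw [← this]
        gcongr
      have b2 : -(1 / 2) ≤ 2 * U * p := by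
        have c1 : 2 * U * (-(K / d.γ)) ≤ 2 * U * p := by gcongr
        have c2 : 2 * U * (K / d.γ) ≤ 2 * (1 / (4 * K) * d.γ) * (K / d.γ) := by gcongr
        have c3 : 2 * (1 / (4 * K) * d.γ) * (K / d.γ) = 1 / 2 := by field_simp; norm_num
        linarith
      have b3 : 0 < d.γ * U := by positivity
      refine mul_nonneg (by positivity) ?_
      nlinarith
  have hfin := hmono ⟨le_rfl, hT0⟩ ⟨hT0, le_rfl⟩ hT0
  have e0 : d.dens y θ = d.k y * g 0 := by simp [hg, dens, mul_assoc]
  have e1 : d.dens (y + T) θ = exp T * (d.k y * g T) := by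
    simp only [hg, dens, d.k_add]
    rw [two_mul, exp_add]; ring
  have h5 := d.dens_le hTY θ
  have hk := d.k_pos y
  rw [e1] at h5
  calc d.dens y θ = d.k y * g 0 := e0
    _ ≤ d.k y * g T := by gcongr
    _ = (exp T * (d.k y * g T)) * exp (-T) := by
      rw [mul_comm (exp T), mul_assoc, ← exp_add]; simp
    _ ≤ densConst' K * exp (-T) := by gcongr
    _ = _ := by rw [hT]; ring_nf

end Cyl

/-- Sequences of problems blowing up along the standard profile. -/
structure Adm {K : ℝ} (d : ℕ → Cyl K) : Prop where
  γ_top : Tendsto (fun n => (d n).γ) atTop atTop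
  Y_top : Tendsto (fun n => (d n).Y) atTop atTop
  conv : ∀ S, ∀ ε > 0, ∀ᶠ n in atTop, ∀ y ≤ S, ∀ θ,
    |(d n).γ * ((d n).u y θ - (d n).γ) + log (1 + exp (2 * y) / 4)| ≤ ε

theorem log_profile_nonneg (y : ℝ) : 0 ≤ log (1 + exp (2 * y) / 4) :=
  log_nonneg (by linarith [exp_pos (2 * y)])

theorem log_profile_mono {y S : ℝ} (h : y ≤ S) :
    log (1 + exp (2 * y) / 4) ≤ log (1 + exp (2 * S) / 4) := by
  have : exp (2 * y) ≤ exp (2 * S) := exp_le_exp.2 (by linarith)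
  exact log_le_log (by positivity) (by linarith)

theorem profile_slope {δ : ℝ} (hδ : 0 < δ) : ∃ y₀ : ℝ, 1 ≤ y₀ ∧
    2 - δ ≤ log (1 + exp (2 * y₀) / 4) - log (1 + exp (2 * (y₀ - 1)) / 4) := by
  have h1 : 0 < 1 - exp (-δ) := by
    have : exp (-δ) < 1 := by rw [← exp_zero]; exact exp_lt_exp.2 (by linarith)
    linarith
  set A := 4 * exp (2 - δ) / (1 - exp (-δ)) with hA
  have hA0 : 0 < A := by positivity
  refine ⟨A + 1, by linarith, ?_⟩
  have h2 : A ≤ exp (2 * (A + 1)) := by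
    have := add_one_le_exp (2 * (A + 1))
    linarith
  have h3 : 4 * exp (2 - δ) ≤ exp (2 * (A + 1)) * (1 - exp (-δ)) := by
    have := mul_le_mul_of_nonneg_right h2 h1.le
    rwa [hA, div_mul_cancel₀ _ h1.ne'] at this
  have e : exp (2 - δ) * exp (2 * (A + 1 - 1)) = exp (2 * (A + 1)) * exp (-δ) := by
    rw [← exp_add, ← exp_add]; ring_nf
  rw [← log_div (by positivity) (by positivity), le_log_iff_exp_le (by positivity),
    le_div_iff₀ (by positivity)]
  nlinarith

namespace Adm

variable {K : ℝ} {d : ℕ → Cyl K}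

theorem eventually_lt_Y (h : Adm d) (S : ℝ) : ∀ᶠ n in atTop, S < (d n).Y :=
  h.Y_top.eventually_gt_atTop S

theorem eventually_lt_γ (h : Adm d) (S : ℝ) : ∀ᶠ n in atTop, S < (d n).γ :=
  h.γ_top.eventually_gt_atTop S

theorem dens_le_left (h : Adm d) (S : ℝ) : ∃ C > 0, ∀ᶠ n in atTop, ∀ y ≤ S, ∀ θ,
    (d n).dens y θ ≤ C * exp (2 * y) := by
  have hK := (d 0).K_pos
  set L := log (1 + exp (2 * S) / 4) with hL
  have hL0 : 0 ≤ L := log_profile_nonneg S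
  refine ⟨K * (4 * K + 2) * exp (2 + (1 + L) ^ 2), by positivity, ?_⟩
  filter_upwards [h.eventually_lt_Y S, h.conv S 1 one_pos] with n hn hc y hy θ
  have hγ := (d n).γ_pos
  have hγ1 := (d n).one_le_γ
  refine ((d n).dens_le_exp (hy.trans_lt hn) θ).trans ?_
  rw [mul_assoc (K * (4 * K + 2)), ← exp_add]
  have h1 := abs_le.1 (hc y hy θ)
  have h2 := log_profile_nonneg y
  have h3 := log_profile_mono hy
  set u := (d n).u y θ
  set γ := (d n).γ
  have h4 : (u - γ) ^ 2 ≤ (γ * (u - γ)) ^ 2 := by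
    rw [mul_pow]
    have : 1 ≤ γ ^ 2 := one_le_pow₀ hγ1
    nlinarith [sq_nonneg (u - γ)]
  have h5 : (γ * (u - γ)) ^ 2 ≤ (1 + L) ^ 2 := by
    apply sq_le_sq'
    · linarith [h1.1]
    · linarith [h1.2]
  refine mul_le_mul_of_nonneg_left (exp_le_exp.2 ?_) (by positivity)
  nlinarith [h1.2]

theorem avg_conv (h : Adm d) (S ε : ℝ) (hε : 0 < ε) : ∀ᶠ n in atTop, ∀ y ≤ S,
    |(d n).γ * (avg (d n).u y - (d n).γ) + log (1 + exp (2 * y) / 4)| ≤ ε := by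
  filter_upwards [h.eventually_lt_Y S, h.conv S ε hε] with n hn hc y hy
  have hcu := (d n).su.continuous_t (hy.trans_lt hn)
  have e : (d n).γ * (avg (d n).u y - (d n).γ) + log (1 + exp (2 * y) / 4) =
      avg (fun y θ => (d n).γ * ((d n).u y θ - (d n).γ) + log (1 + exp (2 * y) / 4)) y := by
    have hpi := pi_pos
    unfold avg
    rw [intervalIntegral.integral_add _ intervalIntegrable_const,
      intervalIntegral.integral_const_mul, intervalIntegral.integral_sub
      (hcu.intervalIntegrable _ _) intervalIntegrable_const]
    · simp
      field_simp
    · exact Continuous.intervalIntegrable (by fun_prop) _ _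
  rw [e]
  exact abs_avg_le (by fun_prop) (hc y hy)

/-- Exponential decay of the density where `u` is comparable to `γ`. -/
theorem dens_le_mid (h : Adm d) {c : ℝ} (hc : 0 < c) (hc1 : c ≤ 1) :
    ∃ C > 0, ∃ κ > 0, κ ≤ 1 ∧ ∀ᶠ n in atTop, ∀ y, 0 ≤ y → y < (d n).Y → ∀ θ,
      c * (d n).γ ≤ (d n).u y θ → (d n).dens y θ ≤ C * exp (-κ * y) := by
  have hK := (d 0).K_pos
  obtain ⟨y₀, hy₀, hslope⟩ := profile_slope (δ := c / 8) (by positivity)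
  obtain ⟨C₁, hC₁, hleft⟩ := h.dens_le_left y₀
  refine ⟨C₁ * exp (3 * y₀) + K * (4 * K + 2) * exp (2 * y₀ + 21 * K + y₀), by positivity, c / 2,
    by positivity, by linarith, ?_⟩
  filter_upwards [hleft, h.avg_conv y₀ (c / 16) (by positivity), h.eventually_lt_Y y₀,
    h.eventually_lt_γ (14 * K / c)] with n hl hconv hYn hγn y hy hyY θ hu
  set D := d n with hD
  have hγ := D.γ_pos
  have hpi := pi_lt_d2
  have hpi' := pi_pos
  by_cases hyy : y ≤ y₀
  · refine (hl y hyy θ).trans ?_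
    have : C₁ * exp (2 * y) ≤ C₁ * exp (3 * y₀) * exp (-(c / 2) * y) := by
      rw [mul_assoc, ← exp_add]
      gcongr
      nlinarith
    rw [add_mul]
    have : 0 < K * (4 * K + 2) * exp (2 * y₀ + 21 * K + y₀) * exp (-(c / 2) * y) := by positivity
    linarith
  · push Not at hyy
    have hlt : ∀ s ≤ y, s < D.Y := fun s hs => hs.trans_lt hyY
    set m := 2 - c / 4 with hm
    have sl0 : avg (pdy D.u) y₀ ≤ -m / D.γ := by
      obtain ⟨ξ, hξ, e⟩ := exists_hasDerivAt_eq_slope (avg D.u) (avg (pdy D.u))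
        (show y₀ - 1 < y₀ by linarith)
        (fun s hs => (D.hasDerivAt_b (hlt s (hs.2.trans hyy.le))).continuousAt.continuousWithinAt)
        (fun s hs => D.hasDerivAt_b (hlt s (hs.2.le.trans hyy.le)))
      rw [sub_sub_cancel, div_one] at e
      have h1 := D.db_antitone (hlt ξ (hξ.2.le.trans hyy.le)) (hlt y₀ hyy.le) hξ.2.le
      have h2 := (abs_le.1 (hconv y₀ le_rfl)).2
      have h3 := (abs_le.1 (hconv (y₀ - 1) (by linarith))).1
      refine h1.trans ?_
      rw [e, le_div_iff₀ hγ]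
      nlinarith
    have hb : avg D.u y ≤ D.γ - m / D.γ * (y - y₀) := by
      obtain ⟨ξ, hξ, e⟩ := exists_hasDerivAt_eq_slope (avg D.u) (avg (pdy D.u)) hyy
        (fun s hs => (D.hasDerivAt_b (hlt s hs.2)).continuousAt.continuousWithinAt)
        (fun s hs => D.hasDerivAt_b (hlt s hs.2.le))
      have h1 := D.db_antitone (hlt y₀ hyy.le) (hlt ξ hξ.2.le) hξ.1.le
      have h2 := D.b_le (hlt y₀ hyy.le)
      rw [eq_div_iff (by linarith)] at e
      have h3 : avg (pdy D.u) ξ * (y - y₀) ≤ -m / D.γ * (y - y₀) := by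
        have : 0 ≤ y - y₀ := by linarith
        gcongr
        exact h1.trans sl0
      have e2 : -m / D.γ * (y - y₀) = -(m / D.γ * (y - y₀)) := by ring
      linarith
    have hub := abs_le.1 (D.abs_u_sub_b_le hyY θ)
    have hosc : 2 * π * K / D.γ ≤ 7 * K / D.γ := by gcongr; linarith
    set o := 7 * K / D.γ with ho
    have hoγ : o * D.γ = 7 * K := by rw [ho]; field_simp
    have hoc : o ≤ c / 2 * D.γ := by
      rw [ho, div_le_iff₀ hγ]
      rw [div_lt_iff₀ hc] at hγn
      have := D.one_le_γ
      nlinarith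
    have hbl : c / 2 * D.γ ≤ avg D.u y := by linarith [hub.2]
    have hbγ := D.b_le hyY
    have hu2 := D.u_le hyY θ
    have hu0 := D.u_pos y hyY θ
    have ho0 : 0 < o := by rw [ho]; positivity
    have e1 : D.u y θ ^ 2 ≤ 21 * K + avg D.u y ^ 2 := by
      have a3 : (D.u y θ - avg D.u y) * (D.u y θ + avg D.u y) ≤ o * (3 * D.γ) := by
        apply mul_le_mul _ (by linarith) (by nlinarith) ho0.le
        linarith [hub.2]
      nlinarith
    have e2 : avg D.u y ^ 2 ≤ D.γ ^ 2 - m * (1 + c / 2) * (y - y₀) := by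
      have h1 : m * (y - y₀) ≤ (D.γ - avg D.u y) * D.γ := by
        have : m / D.γ * (y - y₀) * D.γ = m * (y - y₀) := by field_simp
        nlinarith
      have h2 : (D.γ - avg D.u y) * ((1 + c / 2) * D.γ) ≤ (D.γ - avg D.u y) * (D.γ + avg D.u y) := by
        apply mul_le_mul_of_nonneg_left _ (by linarith)
        linarith
      have h3 := mul_le_mul_of_nonneg_left h1 (show 0 ≤ 1 + c / 2 by linarith)
      linarith
    have e3 : 2 + c / 2 ≤ m * (1 + c / 2) := by rw [hm]; nlinarith
    refine (D.dens_le_exp hyY θ).trans ?_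
    have h5 : exp (2 * y - D.γ ^ 2 + D.u y θ ^ 2)
        ≤ exp (2 * y₀ + 21 * K + y₀) * exp (-(c / 2) * y) := by
      rw [← exp_add, exp_le_exp]
      have : (2 + c / 2) * (y - y₀) ≤ m * (1 + c / 2) * (y - y₀) := by
        apply mul_le_mul_of_nonneg_right e3 (by linarith)
      nlinarith
    rw [add_mul, mul_assoc (K * (4 * K + 2))]
    have h6 : 0 < C₁ * exp (3 * y₀) * exp (-(c / 2) * y) := by positivity
    have h7 : K * (4 * K + 2) * exp (2 * y - D.γ ^ 2 + D.u y θ ^ 2) ≤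
        K * (4 * K + 2) * (exp (2 * y₀ + 21 * K + y₀) * exp (-(c / 2) * y)) := by gcongr
    linarith

end Adm

theorem wt_mono {κ κ' Y y : ℝ} (h : κ ≤ κ') (hy : y ≤ Y) : wt κ' Y y ≤ wt κ Y y := by
  unfold wt
  have h1 : -κ' * |y| ≤ -κ * |y| := by nlinarith [abs_nonneg y]
  have h2 : -κ' * (Y - y) ≤ -κ * (Y - y) := by nlinarith
  gcongr

theorem Adm.dens_le_wt {K : ℝ} {d : ℕ → Cyl K} (h : Adm d) :
    ∃ C > 0, ∃ κ > 0, κ ≤ 1 ∧ ∀ᶠ n in atTop, ∀ y < (d n).Y, ∀ θ,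
      (d n).dens y θ ≤ C * wt κ (d n).Y y := by
  have hK := (d 0).K_pos
  have hK1 := (d 0).one_le_K
  obtain ⟨C₁, hC₁, κ₁, hκ₁, hκ₁1, h1⟩ := h.dens_le_mid (c := 1 / (8 * K)) (by positivity)
    (by rw [div_le_one (by positivity)]; linarith)
  obtain ⟨C₂, hC₂, h2⟩ := h.dens_le_left 0
  have hC₃ := (d 0).densConst'_pos
  set C₃ := Cyl.densConst' K
  set κ₂ := 1 / (8 * K ^ 2) with hκ₂
  have hκ₂0 : 0 < κ₂ := by positivity
  refine ⟨C₁ + C₂ + C₃, by positivity, min κ₁ κ₂, lt_min hκ₁ hκ₂0,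
    (min_le_left _ _).trans hκ₁1, ?_⟩
  filter_upwards [h1, h2] with n h1 h2 y hy θ
  set κ := min κ₁ κ₂ with hκ
  set Y := (d n).Y
  have hw1 : exp (-κ * |y|) ≤ wt κ Y y := by unfold wt; linarith [exp_pos (-κ * (Y - y))]
  have hw2 : exp (-κ * (Y - y)) ≤ wt κ Y y := by unfold wt; linarith [exp_pos (-κ * |y|)]
  have hw := wt_pos κ Y y
  have k1 : κ ≤ κ₁ := min_le_left _ _
  have k2 : κ ≤ κ₂ := min_le_right _ _
  have fin : ∀ {C e : ℝ}, 0 < C → C ≤ C₁ + C₂ + C₃ → e ≤ wt κ Y y →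
      C * e ≤ (C₁ + C₂ + C₃) * wt κ Y y := by
    intro C e h0 h1 h2
    calc C * e ≤ C * wt κ Y y := by gcongr
      _ ≤ _ := by gcongr
  rcases le_total y 0 with h0 | h0
  · refine (h2 y h0 θ).trans (fin hC₂ (by linarith) (le_trans ?_ hw1))
    rw [abs_of_nonpos h0, exp_le_exp]
    nlinarith
  · by_cases hu : (d n).u y θ ≤ 1 / (8 * K) * (d n).γ
    · refine ((d n).dens_le_right h0 hy θ hu).trans
        (fin hC₃ (by linarith) (le_trans ?_ hw2))
      rw [exp_le_exp]
      nlinarith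
    · push Not at hu
      refine (h1 y h0 hy θ hu.le).trans (fin hC₁ (by linarith) (le_trans ?_ hw1))
      rw [abs_of_nonneg h0, exp_le_exp]
      nlinarith

/-- The linearized potential of the standard bubble. -/
def potStd (y : ℝ) : ℝ := 2 * exp (2 * y) / (1 + exp (2 * y) / 4) ^ 2

theorem potStd_nonneg (y : ℝ) : 0 ≤ potStd y := by unfold potStd; positivity

theorem potStd_le_two (y : ℝ) : potStd y ≤ 2 := by
  unfold potStd
  rw [div_le_iff₀ (by positivity)]
  nlinarith [sq_nonneg (1 - exp (2 * y) / 4)]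

theorem potStd_le_exp (y : ℝ) : potStd y ≤ 32 * exp (-2 * |y|) := by
  unfold potStd
  rw [div_le_iff₀ (by positivity)]
  have h0 := exp_pos (2 * y)
  rcases le_total 0 y with h | h
  · rw [abs_of_nonneg h]
    have e : exp (-2 * y) * exp (2 * y) = 1 := by rw [← exp_add]; simp
    set E := exp (2 * y)
    have : 32 * exp (-2 * y) * (1 + E / 4) ^ 2 =
        32 * exp (-2 * y) + 16 * (exp (-2 * y) * E) + 2 * (exp (-2 * y) * E) * E := by ring
    rw [this, e]
    have := exp_pos (-2 * y)
    linarith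
  · rw [abs_of_nonpos h, show -2 * -y = 2 * y by ring]
    nlinarith [sq_nonneg (exp (2 * y)), mul_nonneg h0.le (sq_nonneg (exp (2 * y)))]

theorem potStd_le_wt {κ Y y : ℝ} (hκ1 : κ ≤ 1) : potStd y ≤ 32 * wt κ Y y := by
  refine (potStd_le_exp y).trans ?_
  unfold wt
  have : exp (-2 * |y|) ≤ exp (-κ * |y|) := exp_le_exp.2 (by nlinarith [abs_nonneg y])
  linarith [exp_pos (-κ * (Y - y))]

theorem wt_le_sq (κ Y y : ℝ) : wt κ Y y ≤ wt (κ / 2) Y y ^ 2 := by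
  unfold wt
  have e1 : exp (-κ * |y|) = exp (-(κ / 2) * |y|) ^ 2 := by
    rw [← exp_nat_mul]; congr 1; push_cast; ring
  have e2 : exp (-κ * (Y - y)) = exp (-(κ / 2) * (Y - y)) ^ 2 := by
    rw [← exp_nat_mul]; congr 1; push_cast; ring
  rw [e1, e2]
  nlinarith [exp_pos (-(κ / 2) * |y|), exp_pos (-(κ / 2) * (Y - y)),
    mul_pos (exp_pos (-(κ / 2) * |y|)) (exp_pos (-(κ / 2) * (Y - y)))]

namespace Cyl

variable {K : ℝ} (d : Cyl K)

/-- The linearized potential along `u`. -/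
def pot (y θ : ℝ) : ℝ := d.k y * d.F y θ * ((1 + 2 * d.u y θ ^ 2) * exp (d.u y θ ^ 2))

theorem pot_nonneg {y : ℝ} (hy : y < d.Y) (θ : ℝ) : 0 ≤ d.pot y θ := by
  have := d.k_pos y; have := d.F_pos y hy θ
  unfold pot; positivity

theorem pot_le_dens {y : ℝ} (hy : y < d.Y) (θ : ℝ) : d.pot y θ ≤ 8 * K * d.dens y θ := by
  have h1 := d.k_pos y
  have h2 := d.F_pos y hy θ
  have h3 := d.F_le hy θ
  have h4 := d.u_le hy θ
  have h5 := d.u_pos y hy θ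
  have h6 := d.γ_pos
  have hK := d.one_le_K
  unfold pot dens
  have a : 1 + 2 * d.u y θ ^ 2 ≤ 4 * (4 * K + d.γ * d.u y θ) := by nlinarith
  calc d.k y * d.F y θ * ((1 + 2 * d.u y θ ^ 2) * exp (d.u y θ ^ 2))
      ≤ d.k y * (2 * K) * (4 * (4 * K + d.γ * d.u y θ) * exp (d.u y θ ^ 2)) := by gcongr
    _ = _ := by ring

/-- The potential as a perturbation of the standard one. -/
theorem pot_eq (y θ : ℝ) :
    let a := d.γ * (d.u y θ - d.γ)
    let l := log (1 + exp (2 * y) / 4)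
    d.pot y θ = potStd y / 2 * (d.F y θ / d.φ * (1 / d.γ ^ 2 + 2 * (1 + a / d.γ ^ 2) ^ 2) *
      exp (2 * (a + l) + a ^ 2 / d.γ ^ 2)) := by
  intro a l
  have hγ := d.γ_pos
  have hφ := d.φ_pos
  have e1 : d.u y θ = d.γ + a / d.γ := by simp only [a]; field_simp; ring
  have e2 : exp (2 * l) = (1 + exp (2 * y) / 4) ^ 2 := by
    rw [show 2 * l = l + l by ring, exp_add, exp_log (by positivity)]; ring
  have e3 : d.u y θ ^ 2 = d.γ ^ 2 + 2 * a + a ^ 2 / d.γ ^ 2 := by rw [e1]; field_simp; ring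
  have e4 : exp (2 * (a + l) + a ^ 2 / d.γ ^ 2) =
      (1 + exp (2 * y) / 4) ^ 2 * exp (2 * a + a ^ 2 / d.γ ^ 2) := by
    rw [← e2, ← exp_add]; ring_nf
  have e5 : exp (2 * y - d.γ ^ 2) * exp (d.u y θ ^ 2) =
      exp (2 * y) * exp (2 * a + a ^ 2 / d.γ ^ 2) := by
    rw [e3, ← exp_add, ← exp_add]; ring_nf
  have e6 : 1 + 2 * d.u y θ ^ 2 = d.γ ^ 2 * (1 / d.γ ^ 2 + 2 * (1 + a / d.γ ^ 2) ^ 2) := by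
    rw [e1]; field_simp
  have e7 : d.pot y θ = d.F y θ / (d.φ * d.γ ^ 2) * (1 + 2 * d.u y θ ^ 2) *
      (exp (2 * y - d.γ ^ 2) * exp (d.u y θ ^ 2)) := by
    unfold pot k; field_simp
  rw [e7, e5, e6, e4]
  have : (0 : ℝ) < 1 + exp (2 * y) / 4 := by positivity
  unfold potStd
  field_simp

theorem abs_F_div_sub_one_le {y : ℝ} (hy : y < d.Y) (θ : ℝ) :
    |d.F y θ / d.φ - 1| ≤ K ^ 2 * exp (y - d.Y) := by
  have hφ := d.φ_pos
  have hK := d.K_pos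
  have h1 : 1 ≤ K * d.φ := by
    calc 1 = K * K⁻¹ := by field_simp
      _ ≤ _ := by gcongr; exact d.le_φ
  rw [show d.F y θ / d.φ - 1 = (d.F y θ - d.φ) / d.φ by field_simp, abs_div, abs_of_pos hφ,
    div_le_iff₀ hφ]
  have h2 := d.F_sub y hy θ
  have h3 : K * exp (y - d.Y) * 1 ≤ K * exp (y - d.Y) * (K * d.φ) := by gcongr
  linarith

end Cyl

namespace Adm

variable {K : ℝ} {d : ℕ → Cyl K}

theorem pot_left (h : Adm d) (S : ℝ) {ε : ℝ} (hε : 0 < ε) : ∀ᶠ n in atTop, ∀ y ≤ S, ∀ θ,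
    |(d n).pot y θ - potStd y| ≤ ε := by
  set l : Filter (ℕ × ℝ × ℝ) := atTop ×ˢ 𝓟 (Iic S ×ˢ univ) with hl
  have toL : ∀ {p : ℕ → ℝ → ℝ → Prop}, (∀ᶠ n in atTop, ∀ y ≤ S, ∀ θ, p n y θ) →
      ∀ᶠ q in l, p q.1 q.2.1 q.2.2 := by
    intro p hp
    rw [hl, eventually_prod_principal_iff]
    filter_upwards [hp] with n hn q hq using hn q.1 hq.1 q.2
  have ofL : ∀ {p : ℕ → ℝ → ℝ → Prop}, (∀ᶠ q in l, p q.1 q.2.1 q.2.2) →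
      (∀ᶠ n in atTop, ∀ y ≤ S, ∀ θ, p n y θ) := by
    intro p hp
    rw [hl, eventually_prod_principal_iff] at hp
    filter_upwards [hp] with n hn y hy θ using hn (y, θ) ⟨hy, mem_univ _⟩
  have hfst : Tendsto (fun q : ℕ × ℝ × ℝ => q.1) l atTop := tendsto_fst
  set a : ℕ × ℝ × ℝ → ℝ := fun q => (d q.1).γ * ((d q.1).u q.2.1 q.2.2 - (d q.1).γ)
  set lg : ℕ × ℝ × ℝ → ℝ := fun q => log (1 + exp (2 * q.2.1) / 4)
  have t1 : Tendsto (fun q => a q + lg q) l (𝓝 0) := by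
    rw [Metric.tendsto_nhds]
    intro δ hδ
    refine (toL (h.conv S (δ / 2) (by positivity))).mono fun q hq => ?_
    rw [dist_zero_right, Real.norm_eq_abs]
    exact hq.trans_lt (by linarith)
  have bd : ∀ᶠ q in l, |a q| ≤ 1 + log (1 + exp (2 * S) / 4) := by
    refine toL (p := fun n y θ => |(d n).γ * ((d n).u y θ - (d n).γ)| ≤ _) ?_
    filter_upwards [h.conv S 1 one_pos] with n hn y hy θ
    have h1 := abs_le.1 (hn y hy θ)
    have h2 := log_profile_nonneg y
    have h3 := log_profile_mono hy
    exact abs_le.2 ⟨by linarith, by linarith⟩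
  have tγ : Tendsto (fun q : ℕ × ℝ × ℝ => 1 / (d q.1).γ ^ 2) l (𝓝 0) := by
    have := (((tendsto_pow_atTop two_ne_zero).comp h.γ_top).inv_tendsto_atTop).comp hfst
    refine this.congr fun q => by simp
  have small : ∀ {f : ℕ × ℝ × ℝ → ℝ} {M : ℝ}, (∀ᶠ q in l, |f q| ≤ M) →
      Tendsto (fun q => f q / (d q.1).γ ^ 2) l (𝓝 0) := by
    intro f M hf
    have := tγ.const_mul M
    rw [mul_zero] at this
    refine squeeze_zero_norm' ?_ this
    refine hf.mono fun q hq => ?_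
    rw [Real.norm_eq_abs, abs_div, abs_of_nonneg (sq_nonneg (d q.1).γ), ← mul_one_div]
    gcongr
  have t2 : Tendsto (fun q => a q / (d q.1).γ ^ 2) l (𝓝 0) := small bd
  have t3 : Tendsto (fun q => a q ^ 2 / (d q.1).γ ^ 2) l (𝓝 0) := by
    refine small (M := (1 + log (1 + exp (2 * S) / 4)) ^ 2) (bd.mono fun q hq => ?_)
    rw [abs_pow]
    gcongr
  have t4 : Tendsto (fun q : ℕ × ℝ × ℝ => (d q.1).F q.2.1 q.2.2 / (d q.1).φ) l (𝓝 1) := by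
    have hY : Tendsto (fun q : ℕ × ℝ × ℝ => K ^ 2 * exp (S - (d q.1).Y)) l (𝓝 0) := by
      have h1 : Tendsto (fun q : ℕ × ℝ × ℝ => (d q.1).Y - S) l atTop :=
        (tendsto_atTop_add_const_right _ (-S) h.Y_top).comp hfst
      have h2 := (tendsto_exp_neg_atTop_nhds_zero.comp h1).const_mul (K ^ 2)
      rw [mul_zero] at h2
      refine h2.congr fun q => by simp
    rw [tendsto_iff_norm_sub_tendsto_zero]
    refine squeeze_zero' (Eventually.of_forall fun q => norm_nonneg _) ?_ hY
    refine toL (p := fun n y θ => ‖(d n).F y θ / (d n).φ - 1‖ ≤ K ^ 2 * exp (S - (d n).Y)) ?_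
    filter_upwards [h.eventually_lt_Y S] with n hn y hy θ
    refine ((d n).abs_F_div_sub_one_le (hy.trans_lt hn) θ).trans ?_
    gcongr
  have t5 := (t4.mul (tγ.add (((t2.const_add 1).pow 2).const_mul 2))).mul
    (((t1.const_mul 2).add t3).rexp)
  norm_num at t5
  rw [tendsto_iff_norm_sub_tendsto_zero] at t5
  have t6 := t5.eventually (ge_mem_nhds hε)
  refine ofL (p := fun n y θ => |(d n).pot y θ - potStd y| ≤ ε) (t6.mono fun q hq => ?_)
  have e := (d q.1).pot_eq q.2.1 q.2.2
  simp only [one_div] at e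
  have e' : (d q.1).pot q.2.1 q.2.2 - potStd q.2.1 = potStd q.2.1 / 2 *
      ((d q.1).pot q.2.1 q.2.2 / (potStd q.2.1 / 2) - 2) := by
    have : 0 < potStd q.2.1 := by unfold potStd; positivity
    field_simp
  have p0 : 0 < potStd q.2.1 := by unfold potStd; positivity
  have p2 := potStd_le_two q.2.1
  rw [e', e, mul_div_cancel_left₀ _ (by positivity), abs_mul, abs_of_pos (by positivity)]
  rw [Real.norm_eq_abs] at hq
  have : potStd q.2.1 / 2 ≤ 1 := by linarith
  calc _ ≤ 1 * ε := by
        apply mul_le_mul this _ (abs_nonneg _) zero_le_one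
        exact hq
    _ = ε := one_mul _

theorem pot_sub_le (h : Adm d) {C κ : ℝ} (hC : 0 < C) (hκ : 0 < κ) (hκ1 : κ ≤ 1)
    (hd : ∀ᶠ n in atTop, ∀ y < (d n).Y, ∀ θ, (d n).dens y θ ≤ C * wt κ (d n).Y y)
    {ε : ℝ} (hε : 0 < ε) : ∃ T > 0, ∀ᶠ n in atTop, ∀ y ≤ (d n).Y - T, ∀ θ,
      |(d n).pot y θ - potStd y| ≤ ε * wt (κ / 2) (d n).Y y := by
  have hK := (d 0).K_pos
  set A := 8 * K * C + 32 with hA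
  have hA0 : 0 < A := by positivity
  obtain ⟨T, hT0, hT⟩ : ∃ T > 0, A * exp (-(κ / 2) * T) ≤ ε / 2 := by
    have t1 : Tendsto (fun T : ℝ => A * exp (-(κ / 2 * T))) atTop (𝓝 0) := by
      have := (tendsto_exp_neg_atTop_nhds_zero.comp
        (tendsto_id.const_mul_atTop (show 0 < κ / 2 by positivity))).const_mul A
      rw [mul_zero] at this
      exact this
    obtain ⟨T, h1, h2⟩ := ((t1.eventually (ge_mem_nhds (half_pos hε))).and
      (eventually_gt_atTop 0)).exists
    exact ⟨T, h2, by rwa [neg_mul]⟩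
  refine ⟨T, hT0, ?_⟩
  filter_upwards [hd, h.pot_left T (ε := ε * exp (-(κ / 2) * T)) (by positivity)]
    with n hd hl y hy θ
  set Y := (d n).Y
  have hyY : y < Y := by linarith
  by_cases hyT : |y| ≤ T
  · refine (hl y (abs_le.1 hyT).2 θ).trans ?_
    have : exp (-(κ / 2) * T) ≤ wt (κ / 2) Y y := by
      have : exp (-(κ / 2) * T) ≤ exp (-(κ / 2) * |y|) := exp_le_exp.2 (by nlinarith)
      unfold wt
      linarith [exp_pos (-(κ / 2) * (Y - y))]
    gcongr
  · push Not at hyT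
    have h1 : |(d n).pot y θ - potStd y| ≤ A * wt κ Y y := by
      have a1 := (d n).pot_nonneg hyY θ
      have a2 := (d n).pot_le_dens hyY θ
      have a3 := potStd_nonneg y
      have a4 : potStd y ≤ 32 * wt κ Y y := potStd_le_wt hκ1
      have a5 : 8 * K * (d n).dens y θ ≤ 8 * K * (C * wt κ Y y) := by
        gcongr
        exact hd y hyY θ
      have := wt_pos κ Y y
      have : 0 < 8 * K * (C * wt κ Y y) := by positivity
      exact abs_le.2 ⟨by rw [hA]; linarith, by rw [hA]; linarith⟩
    have h2 : A * wt (κ / 2) Y y ≤ ε := by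
      unfold wt
      have b1 : exp (-(κ / 2) * |y|) ≤ exp (-(κ / 2) * T) := exp_le_exp.2 (by nlinarith)
      have b2 : exp (-(κ / 2) * (Y - y)) ≤ exp (-(κ / 2) * T) := exp_le_exp.2 (by nlinarith)
      nlinarith
    have h3 := wt_le_sq κ Y y
    have h4 := wt_pos (κ / 2) Y y
    calc _ ≤ A * wt κ Y y := h1
      _ ≤ A * wt (κ / 2) Y y ^ 2 := by gcongr
      _ = (A * wt (κ / 2) Y y) * wt (κ / 2) Y y := by ring
      _ ≤ _ := by gcongr

end Adm

namespace Cyl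

variable {K : ℝ} (d : Cyl K)

theorem near_le_dens {y ξ m : ℝ} (hy : y < d.Y) (θ : ℝ) (h1 : |ξ - d.u y θ| ≤ 1)
    (h2 : 2 * d.u y θ * |ξ - d.u y θ| + 1 ≤ m) :
    d.k y * ((1 + 2 * ξ ^ 2) * exp (ξ ^ 2)) ≤ 8 * exp m * d.dens y θ := by
  have hk := d.k_pos y
  have h4 := d.u_le hy θ
  have h5 := d.u_pos y hy θ
  have h6 := d.γ_pos
  have hK := d.one_le_K
  set u := d.u y θ
  have e : ξ ^ 2 = u ^ 2 + 2 * u * (ξ - u) + (ξ - u) ^ 2 := by ring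
  have a1 : (ξ - u) ^ 2 ≤ 1 := by
    rw [← sq_abs]; exact pow_le_one₀ (abs_nonneg _) h1
  have a2 : 2 * u * (ξ - u) ≤ 2 * u * |ξ - u| := by
    gcongr; exact le_abs_self _
  have a3 : ξ ^ 2 ≤ m + u ^ 2 := by linarith
  have a4 : 1 + 2 * ξ ^ 2 ≤ 8 * (4 * K + d.γ * u) := by
    have : ξ ^ 2 ≤ 2 * u ^ 2 + 2 * (ξ - u) ^ 2 := by nlinarith [sq_nonneg (u - (ξ - u))]
    nlinarith
  unfold dens
  calc d.k y * ((1 + 2 * ξ ^ 2) * exp (ξ ^ 2))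
      ≤ d.k y * (8 * (4 * K + d.γ * u) * exp (m + u ^ 2)) := by gcongr
    _ = _ := by rw [exp_add]; ring

end Cyl

theorem Adm.near_le_wt {K : ℝ} {d : ℕ → Cyl K} (h : Adm d) {C κ : ℝ} (hC : 0 < C) (hκ : 0 < κ)
    (hd : ∀ᶠ n in atTop, ∀ y < (d n).Y, ∀ θ, (d n).dens y θ ≤ C * wt κ (d n).Y y)
    {M : ℝ} (hM : 1 ≤ M) : ∀ᶠ n in atTop, ∀ y < (d n).Y, ∀ θ ξ,
      (d n).γ * |ξ - (d n).u y θ| ≤ M * exp (y - (d n).Y) →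
      (d n).k y * ((1 + 2 * ξ ^ 2) * exp (ξ ^ 2)) ≤ (8 * exp 5 * C + 1) * wt κ (d n).Y y := by
  have hM0 : 0 < M := by linarith
  obtain ⟨C₁, hC₁, κ₁, hκ₁, -, hmid⟩ := h.dens_le_mid (c := 1 / M) (by positivity)
    (by rw [div_le_one hM0]; exact hM)
  have ev : ∀ᶠ n in atTop, 8 * exp (4 * M + 1) * C₁ * exp (-(κ₁ * ((d n).Y - log M)))
      ≤ exp (-κ * log M) := by
    have t1 : Tendsto (fun Y : ℝ => 8 * exp (4 * M + 1) * C₁ * exp (-(κ₁ * (Y - log M))))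
        atTop (𝓝 0) := by
      have := (tendsto_exp_neg_atTop_nhds_zero.comp
        ((tendsto_atTop_add_const_right atTop (-log M) tendsto_id).const_mul_atTop hκ₁)).const_mul
        (8 * exp (4 * M + 1) * C₁)
      rw [mul_zero] at this
      exact this
    exact (t1.comp h.Y_top).eventually (ge_mem_nhds (exp_pos _))
  filter_upwards [hd, hmid, ev, h.eventually_lt_γ M, h.eventually_lt_Y (log M)]
    with n hd hmid ev hγM hYM y hy θ ξ hξ
  have hγ := (d n).γ_pos
  have hu := (d n).u_le hy θ
  have hu0 := (d n).u_pos y hy θ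
  have hγ1 := (d n).one_le_γ
  set u := (d n).u y θ
  set γ := (d n).γ
  set Y := (d n).Y
  have hw := wt_pos κ Y y
  have hexp : exp (y - Y) ≤ 1 := exp_le_one_iff.2 (by linarith)
  have hξM : γ * |ξ - u| ≤ M := hξ.trans (by nlinarith)
  have h1 : |ξ - u| ≤ 1 := by
    by_contra hc
    push Not at hc
    nlinarith
  have fin : 2 * u * |ξ - u| ≤ 4 → (d n).k y * ((1 + 2 * ξ ^ 2) * exp (ξ ^ 2)) ≤
      (8 * exp 5 * C + 1) * wt κ Y y := by
    intro h2
    refine ((d n).near_le_dens hy θ h1 (m := 5) (by linarith)).trans ?_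
    calc 8 * exp 5 * (d n).dens y θ ≤ 8 * exp 5 * (C * wt κ Y y) := by
          gcongr; exact hd y hy θ
      _ ≤ _ := by linarith
  by_cases hA : M * exp (y - Y) ≤ 1
  · apply fin
    have := abs_nonneg (ξ - u)
    nlinarith
  · push Not at hA
    have hyM : Y - log M < y := by
      have : -log M < y - Y := by
        rw [← log_inv, log_lt_iff_lt_exp (by positivity)]
        rw [inv_lt_iff_one_lt_mul₀ hM0]
        linarith
      linarith
    by_cases hB : u ≤ 1 / M * γ
    · apply fin
      have : u * |ξ - u| ≤ 1 := by
        calc u * |ξ - u| ≤ 1 / M * γ * |ξ - u| := by gcongr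
          _ = (γ * |ξ - u|) / M := by ring
          _ ≤ M / M := by gcongr
          _ = 1 := div_self hM0.ne'
      linarith
    · push Not at hB
      have hy0 : 0 ≤ y := by linarith
      have h3 := hmid y hy0 hy θ hB.le
      have h4 : 2 * u * |ξ - u| + 1 ≤ 4 * M + 1 := by
        have := abs_nonneg (ξ - u)
        nlinarith
      refine ((d n).near_le_dens hy θ h1 h4).trans ?_
      calc 8 * exp (4 * M + 1) * (d n).dens y θ
          ≤ 8 * exp (4 * M + 1) * (C₁ * exp (-(κ₁ * (Y - log M)))) := by
            gcongr
            refine h3.trans ?_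
            gcongr
            nlinarith
        _ = 8 * exp (4 * M + 1) * C₁ * exp (-(κ₁ * (Y - log M))) := by ring
        _ ≤ exp (-κ * log M) := ev
        _ ≤ exp (-κ * (Y - y)) := exp_le_exp.2 (by nlinarith)
        _ ≤ 1 * wt κ Y y := by unfold wt; linarith [exp_pos (-κ * |y|)]
        _ ≤ _ := by gcongr; linarith [show 0 < 8 * exp 5 * C by positivity]

theorem wt_le_two {κ Y y : ℝ} (hκ : 0 ≤ κ) (hy : y ≤ Y) : wt κ Y y ≤ 2 := by
  unfold wt
  have h1 : exp (-κ * |y|) ≤ 1 := exp_le_one_iff.2 (by nlinarith [abs_nonneg y])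
  have h2 : exp (-κ * (Y - y)) ≤ 1 := exp_le_one_iff.2 (by nlinarith)
  linarith

theorem abs_integral_le_of_bound {f : ℝ → ℝ} {M : ℝ} (h : ∀ θ, |f θ| ≤ M) :
    |∫ θ in (0 : ℝ)..(2 * π), f θ| ≤ 2 * π * M := by
  have := intervalIntegral.norm_integral_le_of_norm_le_const (a := 0) (b := 2 * π) (C := M)
    (f := f) fun θ _ => h θ
  rw [sub_zero, abs_of_pos two_pi_pos, Real.norm_eq_abs] at this
  linarith

theorem abs_integral_le_integral {f g : ℝ → ℝ} (hf : Continuous f) (hg : Continuous g)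
    (h : ∀ θ, |f θ| ≤ g θ) :
    |∫ θ in (0 : ℝ)..(2 * π), f θ| ≤ ∫ θ in (0 : ℝ)..(2 * π), g θ := by
  refine (intervalIntegral.abs_integral_le_integral_abs two_pi_pos.le).trans ?_
  exact intervalIntegral.integral_mono two_pi_pos.le (hf.abs.intervalIntegrable _ _)
    (hg.intervalIntegrable _ _) h

namespace Cyl

variable {K : ℝ} (d : Cyl K)

/-- The rescaled angular derivative. -/
def ang (y θ : ℝ) : ℝ := d.γ * pdt d.u y θ

/-- The forcing of the angular derivative by the coefficient `F`. -/
def src (y θ : ℝ) : ℝ := d.γ * (d.k y * pdt d.F y θ * (d.u y θ * exp (d.u y θ ^ 2)))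

theorem sm_ang : Sm d.Y d.ang := d.su.pdt.const_mul d.γ

theorem ang_periodic {y : ℝ} (hy : y < d.Y) : Function.Periodic (d.ang y) (2 * π) := by
  intro θ
  unfold ang
  rw [periodic_pdt (d.pu y hy) θ]

theorem integral_ang {y : ℝ} (hy : y < d.Y) : ∫ θ in (0 : ℝ)..(2 * π), d.ang y θ = 0 := by
  unfold ang
  rw [intervalIntegral.integral_const_mul, d.su.integral_pdt hy (d.pu y hy), mul_zero]

theorem abs_ang_le {y : ℝ} (hy : y < d.Y) (θ : ℝ) : |d.ang y θ| ≤ K := by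
  have := d.γ_pos
  unfold ang
  rw [abs_mul, abs_of_pos this]
  calc d.γ * |pdt d.u y θ| ≤ d.γ * (K / d.γ) := by gcongr; exact d.u_t y hy θ
    _ = K := by field_simp

theorem sm_src : Sm d.Y d.src :=
  ((d.smk.mul d.sF.pdt).mul (d.su.comp (f := fun s => s * exp (s ^ 2)) (by fun_prop))).const_mul d.γ

theorem sm_pot : Sm d.Y d.pot :=
  (d.smk.mul d.sF).mul (d.su.comp (f := fun s => (1 + 2 * s ^ 2) * exp (s ^ 2)) (by fun_prop))

theorem abs_src_le {y : ℝ} (hy : y < d.Y) (θ : ℝ) :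
    |d.src y θ| ≤ K * exp (y - d.Y) * d.dens y θ := by
  have h1 := d.k_pos y
  have h2 := d.u_pos y hy θ
  have h3 := d.γ_pos
  have h4 := d.F_t y hy θ
  have hK := d.K_pos
  unfold src dens
  rw [abs_mul, abs_mul, abs_mul, abs_of_pos h3, abs_of_pos h1,
    abs_of_pos (show 0 < d.u y θ * exp (d.u y θ ^ 2) by positivity)]
  calc d.γ * (d.k y * |pdt d.F y θ| * (d.u y θ * exp (d.u y θ ^ 2)))
      ≤ d.γ * (d.k y * (K * exp (y - d.Y)) * (d.u y θ * exp (d.u y θ ^ 2))) := by gcongr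
    _ = K * exp (y - d.Y) * (d.k y * (0 + d.γ * d.u y θ) * exp (d.u y θ ^ 2)) := by ring
    _ ≤ _ := by gcongr; positivity

theorem pdt_nl {y : ℝ} (hy : y < d.Y) (θ : ℝ) :
    d.γ * pdt d.nl y θ = d.pot y θ * d.ang y θ + d.src y θ := by
  have h1 := d.su.hasDerivAt_t (θ := θ) hy
  have h2 := d.sF.hasDerivAt_t (θ := θ) hy
  have h3 : HasDerivAt (d.nl y) _ θ :=
    (h2.const_mul (d.k y)).mul ((hasDerivAt_mul_exp_sq (d.u y θ)).comp θ h1)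
  rw [show pdt d.nl y θ = _ from h3.deriv]
  unfold pot ang src
  ring

theorem pde_ang {y : ℝ} (hy : y < d.Y) (θ : ℝ) :
    pdy (pdy d.ang) y θ + pdt (pdt d.ang) y θ = -(d.pot y θ * d.ang y θ + d.src y θ) := by
  have e1 : ∀ s < d.Y, ∀ t, pdy d.ang s t = d.γ * pdt (pdy d.u) s t := by
    intro s hs t
    have := ((d.su.pdt.hasDerivAt_y (θ := t) hs).const_mul d.γ).deriv
    rw [d.su.comm hs] at this
    exact this
  have e2 : pdy (pdy d.ang) y θ = d.γ * pdt (pdy (pdy d.u)) y θ := by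
    have h1 : (fun s => pdy d.ang s θ) =ᶠ[𝓝 y] fun s => d.γ * pdt (pdy d.u) s θ := by
      filter_upwards [Iio_mem_nhds hy] with s hs using e1 s hs θ
    have h2 := ((d.su.pdy.pdt.hasDerivAt_y (θ := θ) hy).const_mul d.γ).congr_of_eventuallyEq h1
    rw [d.su.pdy.comm hy] at h2
    exact h2.deriv
  have e3 : ∀ t, pdt d.ang y t = d.γ * pdt (pdt d.u) y t := fun t =>
    ((d.su.pdt.hasDerivAt_t (θ := t) hy).const_mul d.γ).deriv
  have e4 : pdt (pdt d.ang) y θ = d.γ * pdt (pdt (pdt d.u)) y θ := by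
    have h1 : pdt d.ang y = fun t => d.γ * pdt (pdt d.u) y t := funext e3
    have h2 := ((d.su.pdt.pdt.hasDerivAt_t (θ := θ) hy).const_mul d.γ).deriv
    conv_lhs => unfold pdt
    change deriv (pdt d.ang y) θ = _
    rw [h1]
    exact h2
  have e5 : pdt (pdy (pdy d.u)) y θ + pdt (pdt (pdt d.u)) y θ = -pdt d.nl y θ := by
    have h1 : (fun t => pdy (pdy d.u) y t + pdt (pdt d.u) y t) = fun t => -d.nl y t :=
      funext fun t => d.pde' hy t
    have h2 := (d.su.pdy.pdy.hasDerivAt_t (θ := θ) hy).add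
      (d.su.pdt.pdt.hasDerivAt_t (θ := θ) hy)
    have h3 := (d.sm_nl.hasDerivAt_t (θ := θ) hy).neg
    have h4 : HasDerivAt (fun t => pdy (pdy d.u) y t + pdt (pdt d.u) y t)
      (-pdt d.nl y θ) θ := by rw [h1]; exact h3
    exact h2.unique h4
  rw [e2, e4, ← mul_add, e5, mul_neg, d.pdt_nl hy]

/-- A weighted angular integral of `ang`. -/
def coef (c : ℝ → ℝ) (y : ℝ) : ℝ := ∫ θ in (0 : ℝ)..(2 * π), d.ang y θ * c θ

theorem abs_coef_le {κ ε X C y₁ : ℝ} (hκ : 0 < κ) (hκ1 : κ ≤ 1) (hε : 0 ≤ ε) (hX : 0 ≤ X)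
    (hC : 0 ≤ C) (hy₁ : y₁ < d.Y)
    (hP : ∀ y ≤ y₁, ∀ θ, |d.pot y θ - potStd y| ≤ ε * wt κ d.Y y)
    (hs : ∀ y ≤ y₁, ∀ θ, |d.src y θ| ≤ C * exp (y - d.Y) * wt κ d.Y y)
    (hA : ∀ y ≤ y₁, ∫ θ in (0 : ℝ)..(2 * π), |d.ang y θ| ≤ 4 * X * exp (y - d.Y))
    {c c' : ℝ → ℝ} (hc : ∀ t, HasDerivAt c (c' t) t) (hc' : ∀ t, HasDerivAt c' (-c t) t)
    (hc1 : ∀ t, |c t| ≤ 1) (hc1' : ∀ t, |c' t| ≤ 1) (hcp : Function.Periodic c (2 * π))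
    (hcp' : Function.Periodic c' (2 * π)) :
    ∀ y ≤ y₁, |d.coef c y| ≤ gronConst κ 32 * (4 * ε * X + 7 * C) * exp (y - d.Y) := by
  have hcc : Continuous c := continuous_iff_continuousAt.2 fun t => (hc t).continuousAt
  have hcc' : Continuous c' := continuous_iff_continuousAt.2 fun t => (hc' t).continuousAt
  have hγ := d.γ_pos
  have lt : ∀ {y}, y ≤ y₁ → y < d.Y := fun h => h.trans_lt hy₁
  set a' : ℝ → ℝ := fun y => ∫ θ in (0 : ℝ)..(2 * π), pdy d.ang y θ * c θ with ha'
  have hd1 : ∀ y ≤ y₁, HasDerivAt (d.coef c) (a' y) y := fun y hy =>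
    d.sm_ang.hasDerivAt_integral hcc (lt hy)
  set g : ℝ → ℝ := fun y =>
    -∫ θ in (0 : ℝ)..(2 * π), (d.pot y θ * d.ang y θ + d.src y θ) * c θ with hg
  have ctsA : ∀ {y}, y ≤ y₁ → Continuous (d.ang y) := fun h => d.sm_ang.continuous_t (lt h)
  have ctsP : ∀ {y}, y ≤ y₁ → Continuous (d.pot y) := fun h => d.sm_pot.continuous_t (lt h)
  have ctsS : ∀ {y}, y ≤ y₁ → Continuous (d.src y) := fun h => d.sm_src.continuous_t (lt h)
  have hd2 : ∀ y ≤ y₁, HasDerivAt a' (d.coef c y + g y) y := by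
    intro y hy
    refine (d.sm_ang.pdy.hasDerivAt_integral hcc (lt hy)).congr_deriv ?_
    have p1 : ∫ θ in (0 : ℝ)..(2 * π), pdt (pdt d.ang) y θ * c θ =
        -∫ θ in (0 : ℝ)..(2 * π), pdt d.ang y θ * c' θ :=
      d.sm_ang.pdt.integral_pdt_mul (lt hy) (periodic_pdt (d.ang_periodic (lt hy))) hc hcc' hcp
    have p2 : ∫ θ in (0 : ℝ)..(2 * π), pdt d.ang y θ * c' θ =
        -∫ θ in (0 : ℝ)..(2 * π), d.ang y θ * -c θ :=
      d.sm_ang.integral_pdt_mul (lt hy) (d.ang_periodic (lt hy)) hc' hcc.neg hcp'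
    have p3 : ∀ θ, pdy (pdy d.ang) y θ * c θ =
        -(pdt (pdt d.ang) y θ * c θ) - (d.pot y θ * d.ang y θ + d.src y θ) * c θ := fun θ => by
      have := d.pde_ang (lt hy) θ
      rw [show pdy (pdy d.ang) y θ = -(d.pot y θ * d.ang y θ + d.src y θ) -
        pdt (pdt d.ang) y θ by linarith]
      ring
    have cP := ctsP hy; have cA := ctsA hy; have cS := ctsS hy
    have cT := d.sm_ang.pdt.pdt.continuous_t (lt hy)
    simp_rw [p3]
    rw [intervalIntegral.integral_sub (Continuous.intervalIntegrable (by fun_prop) _ _)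
      (Continuous.intervalIntegrable (by fun_prop) _ _), intervalIntegral.integral_neg, p1, p2]
    simp only [mul_neg, intervalIntegral.integral_neg, hg, coef]
    ring
  have hgb : ∀ y ≤ y₁, ‖g y‖ ≤ wt κ d.Y y *
      (32 * ‖d.coef c y‖ + (4 * ε * X + 7 * C) * exp (-d.Y) * exp y) := by
    intro y hy
    have cP := ctsP hy; have cA := ctsA hy; have cS := ctsS hy
    have hw := wt_pos κ d.Y y
    have e : g y = -(potStd y * d.coef c y) - ∫ θ in (0 : ℝ)..(2 * π),
        ((d.pot y θ - potStd y) * d.ang y θ + d.src y θ) * c θ := by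
      simp only [hg, coef]
      rw [← intervalIntegral.integral_const_mul, ← intervalIntegral.integral_neg,
        ← intervalIntegral.integral_neg, ← intervalIntegral.integral_sub
        (Continuous.intervalIntegrable (by fun_prop) _ _)
        (Continuous.intervalIntegrable (by fun_prop) _ _)]
      congr 1
      ext θ
      ring
    have b1 : |∫ θ in (0 : ℝ)..(2 * π), ((d.pot y θ - potStd y) * d.ang y θ + d.src y θ) * c θ|
        ≤ ∫ θ in (0 : ℝ)..(2 * π),
          (ε * wt κ d.Y y * |d.ang y θ| + C * exp (y - d.Y) * wt κ d.Y y) := by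
      refine abs_integral_le_integral (by fun_prop) (by fun_prop) fun θ => ?_
      rw [abs_mul]
      have i1 := hP y hy θ
      have i2 := hs y hy θ
      have i3 : |(d.pot y θ - potStd y) * d.ang y θ + d.src y θ| ≤
          ε * wt κ d.Y y * |d.ang y θ| + C * exp (y - d.Y) * wt κ d.Y y := by
        refine (abs_add_le _ _).trans (add_le_add ?_ i2)
        rw [abs_mul]
        gcongr
      calc _ ≤ _ * 1 := mul_le_mul_of_nonneg_left (hc1 θ) (abs_nonneg _)
        _ ≤ _ := by rw [mul_one]; exact i3
    have b2 : ∫ θ in (0 : ℝ)..(2 * π),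
          (ε * wt κ d.Y y * |d.ang y θ| + C * exp (y - d.Y) * wt κ d.Y y) ≤
        ε * wt κ d.Y y * (4 * X * exp (y - d.Y)) + 7 * (C * exp (y - d.Y) * wt κ d.Y y) := by
      rw [intervalIntegral.integral_add (Continuous.intervalIntegrable (by fun_prop) _ _)
        (Continuous.intervalIntegrable (by fun_prop) _ _), intervalIntegral.integral_const_mul,
        intervalIntegral.integral_const, sub_zero, smul_eq_mul]
      have := hA y hy
      have hpi := pi_lt_d2
      gcongr
      linarith
    have b3 : |potStd y * d.coef c y| ≤ 32 * wt κ d.Y y * |d.coef c y| := by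
      rw [abs_mul, abs_of_nonneg (potStd_nonneg y)]
      gcongr
      exact potStd_le_wt hκ1
    rw [Real.norm_eq_abs, Real.norm_eq_abs, e]
    have b4 := abs_sub (-(potStd y * d.coef c y)) (∫ θ in (0 : ℝ)..(2 * π),
        ((d.pot y θ - potStd y) * d.ang y θ + d.src y θ) * c θ)
    rw [abs_neg] at b4
    have e5 : exp (-d.Y) * exp y = exp (y - d.Y) := by rw [← exp_add]; ring_nf
    rw [mul_assoc _ (exp (-d.Y)), e5]
    nlinarith [b1.trans b2]
  have hsm : ∀ {f : ℝ → ℝ}, (∀ ε > 0, ∃ y₀ < d.Y, ∀ y ≤ y₀, |f y| ≤ 2 * π * (d.γ * (ε * exp y))) →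
      Tendsto (fun y => exp (-y) * ‖f y‖) atBot (𝓝 0) := by
    intro f hf
    rw [Metric.tendsto_nhds]
    intro δ hδ
    have hpi := pi_pos
    obtain ⟨y₀, -, h⟩ := hf (δ / (2 * (2 * π * d.γ))) (by positivity)
    filter_upwards [eventually_le_atBot y₀] with y hy
    rw [dist_zero_right, norm_mul, norm_norm, Real.norm_eq_abs, Real.norm_eq_abs,
      abs_of_pos (exp_pos _)]
    calc exp (-y) * |f y| ≤ exp (-y) * (2 * π * (d.γ * (δ / (2 * (2 * π * d.γ)) * exp y))) := by
          gcongr; exact h y hy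
      _ = δ / 2 * (exp (-y) * exp y) := by field_simp
      _ = δ / 2 := by rw [← exp_add]; simp
      _ < δ := by linarith
  have h0 : Tendsto (fun y => exp (-y) * ‖d.coef c y‖) atBot (𝓝 0) := by
    refine hsm fun ε hε => ?_
    obtain ⟨y₀, hy₀, h⟩ := d.init ε hε
    refine ⟨y₀, hy₀, fun y hy => abs_integral_le_of_bound fun θ => ?_⟩
    have := (h y hy θ).2.2
    unfold ang
    rw [abs_mul, abs_mul, abs_of_pos hγ]
    calc d.γ * |pdt d.u y θ| * |c θ| ≤ d.γ * (ε * exp y) * 1 := by gcongr; exact hc1 θ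
      _ = _ := mul_one _
  have h0' : Tendsto (fun y => exp (-y) * ‖a' y‖) atBot (𝓝 0) := by
    refine hsm fun ε hε => ?_
    obtain ⟨y₀, hy₀, h⟩ := d.init ε hε
    refine ⟨y₀, hy₀, fun y hy => ?_⟩
    have hyY : y < d.Y := hy.trans_lt hy₀
    have e1 : a' y = -∫ θ in (0 : ℝ)..(2 * π), (d.γ * pdy d.u y θ) * c' θ := by
      have p1 := d.su.pdy.integral_pdt_mul hyY (periodic_pdy hyY d.pu) hc hcc' hcp
      have p2 : ∀ θ, pdy d.ang y θ = d.γ * pdt (pdy d.u) y θ := fun θ => by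
        have := ((d.su.pdt.hasDerivAt_y (θ := θ) hyY).const_mul d.γ).deriv
        rw [d.su.comm hyY] at this
        exact this
      simp only [ha', p2, mul_assoc]
      rw [intervalIntegral.integral_const_mul, intervalIntegral.integral_const_mul, p1, mul_neg]
    rw [e1, abs_neg]
    refine abs_integral_le_of_bound fun θ => ?_
    have := (h y hy θ).2.1
    rw [abs_mul, abs_mul, abs_of_pos hγ]
    calc d.γ * |pdy d.u y θ| * |c' θ| ≤ d.γ * (ε * exp y) * 1 := by gcongr; exact hc1' θ
      _ = _ := mul_one _
  intro y hy
  have := gronwall_modeOne hκ (by norm_num) (by positivity) hy₁.le hd1 hd2 hgb h0 h0' y hy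
  rw [Real.norm_eq_abs] at this
  refine this.trans_eq ?_
  rw [show y - d.Y = -d.Y + y by ring, exp_add]
  ring

end Cyl

namespace Cyl

variable {K : ℝ} (d : Cyl K)

/-- The angular energy. -/
def energy (y : ℝ) : ℝ := ∫ θ in (0 : ℝ)..(2 * π), d.ang y θ ^ 2

theorem energy_nonneg (y : ℝ) : 0 ≤ d.energy y :=
  intervalIntegral.integral_nonneg two_pi_pos.le fun _ _ => sq_nonneg _

theorem hasDerivAt_energy {y : ℝ} (hy : y < d.Y) :
    HasDerivAt d.energy (∫ θ in (0 : ℝ)..(2 * π), 2 * (d.ang y θ * pdy d.ang y θ)) y := by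
  have h := (d.sm_ang.mul d.sm_ang).hasDerivAt_integral' hy
  have e1 : d.energy = fun y => ∫ θ in (0 : ℝ)..(2 * π), d.ang y θ * d.ang y θ := by
    unfold energy; simp_rw [sq]
  rw [e1]
  refine h.congr_deriv ?_
  congr 1
  ext θ
  have h1 := d.sm_ang.hasDerivAt_y (θ := θ) hy
  rw [show pdy (fun y θ => d.ang y θ * d.ang y θ) y θ = _ from (h1.mul h1).deriv]
  ring

theorem hasDerivAt_denergy {y : ℝ} (hy : y < d.Y) :
    HasDerivAt (fun y => ∫ θ in (0 : ℝ)..(2 * π), 2 * (d.ang y θ * pdy d.ang y θ))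
      (∫ θ in (0 : ℝ)..(2 * π), 2 * (pdy d.ang y θ ^ 2 + d.ang y θ * pdy (pdy d.ang) y θ)) y := by
  refine (((d.sm_ang.mul d.sm_ang.pdy).const_mul 2).hasDerivAt_integral' hy).congr_deriv ?_
  congr 1
  ext θ
  have h1 := d.sm_ang.hasDerivAt_y (θ := θ) hy
  have h2 := d.sm_ang.pdy.hasDerivAt_y (θ := θ) hy
  rw [show pdy (fun y θ => 2 * (d.ang y θ * pdy d.ang y θ)) y θ = _ from
    ((h1.mul h2).const_mul 2).deriv]
  ring

theorem energy_init : Tendsto (fun y => d.energy y * exp (-(2 * y))) atBot (𝓝 0) := by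
  rw [Metric.tendsto_nhds]
  intro δ hδ
  have hpi := pi_pos
  have hγ := d.γ_pos
  obtain ⟨ε, hε, he⟩ : ∃ ε > 0, 2 * π * (d.γ ^ 2 * ε ^ 2) < δ := by
    refine ⟨√(δ / (2 * (2 * π * d.γ ^ 2))), by positivity, ?_⟩
    rw [sq_sqrt (by positivity)]
    have : 2 * π * (d.γ ^ 2 * (δ / (2 * (2 * π * d.γ ^ 2)))) = δ / 2 := by field_simp
    linarith
  obtain ⟨y₀, -, h⟩ := d.init ε hε
  filter_upwards [eventually_le_atBot y₀] with y hy
  rw [dist_zero_right, Real.norm_eq_abs,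
    abs_of_nonneg (mul_nonneg (d.energy_nonneg y) (exp_pos _).le)]
  have h1 : d.energy y ≤ 2 * π * (d.γ ^ 2 * ε ^ 2 * exp (2 * y)) := by
    refine (le_abs_self _).trans (abs_integral_le_of_bound fun θ => ?_)
    unfold ang
    rw [abs_pow, abs_mul, abs_of_pos hγ]
    calc (d.γ * |pdt d.u y θ|) ^ 2 ≤ (d.γ * (ε * exp y)) ^ 2 := by
          gcongr; exact (h y hy θ).2.2
      _ = _ := by rw [show 2 * y = y + y by ring, exp_add]; ring
  calc _ ≤ 2 * π * (d.γ ^ 2 * ε ^ 2 * exp (2 * y)) * exp (-(2 * y)) := by gcongr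
    _ = 2 * π * (d.γ ^ 2 * ε ^ 2) * (exp (2 * y) * exp (-(2 * y))) := by ring
    _ = 2 * π * (d.γ ^ 2 * ε ^ 2) := by rw [← exp_add]; simp
    _ < δ := he

/-- The energy at an interior critical point of the rescaled energy. -/
theorem energy_le_of_critical {y R S : ℝ} (hy : y < d.Y) (hP : ∀ θ, d.pot y θ ≤ 5 / 2)
    (hs : ∀ θ, |d.src y θ| ≤ S) (hc : |d.coef cos y| ≤ R) (hc' : |d.coef sin y| ≤ R)
    (h1 : (∫ θ in (0 : ℝ)..(2 * π), 2 * (d.ang y θ * pdy d.ang y θ)) = 2 * d.energy y)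
    (h2 : (∫ θ in (0 : ℝ)..(2 * π), 2 * (pdy d.ang y θ ^ 2 + d.ang y θ * pdy (pdy d.ang) y θ))
      ≤ 4 * d.energy y) : d.energy y ≤ 8 * R ^ 2 + 28 * S ^ 2 := by
  have cA := d.sm_ang.continuous_t hy
  have cAy := d.sm_ang.pdy.continuous_t hy
  have cAyy := d.sm_ang.pdy.pdy.continuous_t hy
  have cAt := d.sm_ang.pdt.continuous_t hy
  have cAtt := d.sm_ang.pdt.pdt.continuous_t hy
  have cP := d.sm_pot.continuous_t hy
  have cS := d.sm_src.continuous_t hy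
  have hp := d.ang_periodic hy
  have w := wirtinger_modeOne (fun t => d.sm_ang.hasDerivAt_t (θ := t) hy) cAt
    (by have := hp 0; rwa [zero_add] at this) (d.integral_ang hy)
  have w2 : 3 / π * (d.coef cos y ^ 2 + d.coef sin y ^ 2) ≤ 2 * R ^ 2 := by
    have : 3 / π ≤ 1 := by rw [div_le_one pi_pos]; exact pi_gt_three.le
    have a1 : d.coef cos y ^ 2 ≤ R ^ 2 := sq_le_sq' (abs_le.1 hc).1 (abs_le.1 hc).2
    have a2 : d.coef sin y ^ 2 ≤ R ^ 2 := sq_le_sq' (abs_le.1 hc').1 (abs_le.1 hc').2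
    calc _ ≤ 1 * (R ^ 2 + R ^ 2) := by gcongr
      _ = _ := by ring
  have ibp : ∫ θ in (0 : ℝ)..(2 * π), d.ang y θ * pdt (pdt d.ang) y θ =
      -∫ θ in (0 : ℝ)..(2 * π), pdt d.ang y θ ^ 2 := by
    have := d.sm_ang.pdt.integral_pdt_mul hy (periodic_pdt hp)
      (fun t => d.sm_ang.hasDerivAt_t (θ := t) hy) cAt hp
    simp_rw [sq, mul_comm (d.ang y _)]
    exact this
  have key : ∫ θ in (0 : ℝ)..(2 * π), (2 * (2 * (d.ang y θ * pdy d.ang y θ))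
      - 2 * d.ang y θ ^ 2 - 2 * (d.ang y θ * pdt (pdt d.ang) y θ) - 11 / 2 * d.ang y θ ^ 2
      - 2 * S ^ 2) ≤
      ∫ θ in (0 : ℝ)..(2 * π), 2 * (pdy d.ang y θ ^ 2 + d.ang y θ * pdy (pdy d.ang) y θ) := by
    refine intervalIntegral.integral_mono two_pi_pos.le
      (Continuous.intervalIntegrable (by fun_prop) _ _)
      (Continuous.intervalIntegrable (by fun_prop) _ _) fun θ => ?_
    have e := d.pde_ang hy θ
    have e' : pdy (pdy d.ang) y θ = -(d.pot y θ * d.ang y θ + d.src y θ) -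
      pdt (pdt d.ang) y θ := by linarith
    simp only [e']
    have i1 := mul_le_mul_of_nonneg_right (hP θ) (sq_nonneg (d.ang y θ))
    have i2 : d.src y θ ^ 2 ≤ S ^ 2 := sq_le_sq' (abs_le.1 (hs θ)).1 (abs_le.1 (hs θ)).2
    have i3 := sq_nonneg (pdy d.ang y θ - d.ang y θ)
    have i4 := sq_nonneg (1 / 2 * d.ang y θ - d.src y θ)
    nlinarith
  have split : ∫ θ in (0 : ℝ)..(2 * π), (2 * (2 * (d.ang y θ * pdy d.ang y θ))
      - 2 * d.ang y θ ^ 2 - 2 * (d.ang y θ * pdt (pdt d.ang) y θ) - 11 / 2 * d.ang y θ ^ 2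
      - 2 * S ^ 2) = 2 * (2 * d.energy y) - 2 * d.energy y
        + 2 * (∫ θ in (0 : ℝ)..(2 * π), pdt d.ang y θ ^ 2) - 11 / 2 * d.energy y
        - 2 * π * (2 * S ^ 2) := by
    rw [intervalIntegral.integral_sub (Continuous.intervalIntegrable (by fun_prop) _ _)
      (Continuous.intervalIntegrable (by fun_prop) _ _),
      intervalIntegral.integral_sub (Continuous.intervalIntegrable (by fun_prop) _ _)
      (Continuous.intervalIntegrable (by fun_prop) _ _),
      intervalIntegral.integral_sub (Continuous.intervalIntegrable (by fun_prop) _ _)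
      (Continuous.intervalIntegrable (by fun_prop) _ _),
      intervalIntegral.integral_sub (Continuous.intervalIntegrable (by fun_prop) _ _)
      (Continuous.intervalIntegrable (by fun_prop) _ _)]
    simp only [intervalIntegral.integral_const_mul] at h1 ⊢
    rw [ibp, h1, intervalIntegral.integral_const]
    simp only [energy, sub_zero, smul_eq_mul]
    ring
  rw [split] at key
  have hpi := pi_lt_d2
  change 4 * d.energy y ≤ _ + 3 / π * (d.coef cos y ^ 2 + d.coef sin y ^ 2) at w
  nlinarith [sq_nonneg S]

end Cyl

namespace Cyl

variable {K : ℝ} (d : Cyl K)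

theorem integral_abs_ang_le {y X : ℝ} (hy : y < d.Y) (hX : 0 < X)
    (h : d.energy y ≤ X ^ 2 * exp (2 * (y - d.Y))) :
    ∫ θ in (0 : ℝ)..(2 * π), |d.ang y θ| ≤ 4 * X * exp (y - d.Y) := by
  have cA := d.sm_ang.continuous_t hy
  set s := X * exp (y - d.Y) with hs
  have hs0 : 0 < s := by positivity
  have e2 : X ^ 2 * exp (2 * (y - d.Y)) = s ^ 2 := by
    rw [hs, mul_pow, ← exp_nat_mul]; push_cast; rfl
  have h1 : ∫ θ in (0 : ℝ)..(2 * π), |d.ang y θ| ≤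
      ∫ θ in (0 : ℝ)..(2 * π), ((2 * s)⁻¹ * d.ang y θ ^ 2 + s / 2) := by
    refine intervalIntegral.integral_mono two_pi_pos.le
      (Continuous.intervalIntegrable (by fun_prop) _ _)
      (Continuous.intervalIntegrable (by fun_prop) _ _) fun θ => ?_
    have e : (2 * s)⁻¹ * d.ang y θ ^ 2 + s / 2 - |d.ang y θ| =
        (|d.ang y θ| - s) ^ 2 * (2 * s)⁻¹ := by
      rw [sub_sq, sq_abs]; field_simp; ring
    have : 0 ≤ (|d.ang y θ| - s) ^ 2 * (2 * s)⁻¹ := by positivity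
    simp only
    linarith
  rw [intervalIntegral.integral_add (Continuous.intervalIntegrable (by fun_prop) _ _)
    intervalIntegrable_const, intervalIntegral.integral_const_mul,
    intervalIntegral.integral_const, sub_zero, smul_eq_mul] at h1
  have h2 : (2 * s)⁻¹ * d.energy y ≤ (2 * s)⁻¹ * s ^ 2 := by gcongr; rwa [← e2]
  have h3 : (2 * s)⁻¹ * s ^ 2 = s / 2 := by field_simp
  have hpi := pi_lt_d2
  change _ ≤ (2 * s)⁻¹ * d.energy y + _ at h1
  rw [mul_assoc, ← hs]
  nlinarith

theorem energy_le {κ ε C T : ℝ} (hκ : 0 < κ) (hκ1 : κ ≤ 1) (hε : 0 < ε) (hε1 : ε ≤ 1 / 4)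
    (hC : 0 ≤ C) (hT : 0 < T)
    (hP : ∀ y ≤ d.Y - T, ∀ θ, |d.pot y θ - potStd y| ≤ ε * wt κ d.Y y)
    (hs : ∀ y ≤ d.Y - T, ∀ θ, |d.src y θ| ≤ C * exp (y - d.Y) * wt κ d.Y y)
    (hG : 256 * gronConst κ 32 ^ 2 * ε ^ 2 ≤ 1 / 2) :
    ∀ y ≤ d.Y - T, d.energy y ≤ (7 * K ^ 2 * exp (2 * T) + 1 +
      1568 * gronConst κ 32 ^ 2 * C ^ 2 + 224 * C ^ 2) * exp (2 * (y - d.Y)) := by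
  have hK := d.K_pos
  have hlt : ∀ {y}, y ≤ d.Y - T → y < d.Y := fun h => by linarith
  set G := gronConst κ 32
  have hG0 : 0 < G := gronConst_pos hκ 32
  set h : ℝ → ℝ := fun y => d.energy y * exp (-(2 * y)) with hh
  set dE : ℝ → ℝ := fun y => ∫ θ in (0 : ℝ)..(2 * π), 2 * (d.ang y θ * pdy d.ang y θ) with hdE
  set ddE : ℝ → ℝ := fun y => ∫ θ in (0 : ℝ)..(2 * π),
    2 * (pdy d.ang y θ ^ 2 + d.ang y θ * pdy (pdy d.ang) y θ) with hddE
  have hexp : ∀ y : ℝ, HasDerivAt (fun y => exp (-(2 * y))) (exp (-(2 * y)) * -2) y := fun y => by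
    refine (((hasDerivAt_id y).const_mul 2).neg.exp).congr_deriv ?_
    simp
  have hd1 : ∀ {y}, y < d.Y → HasDerivAt h (exp (-(2 * y)) * (dE y - 2 * d.energy y)) y :=
    fun {y} hy => ((d.hasDerivAt_energy hy).mul (hexp y)).congr_deriv (by ring)
  have hd2 : ∀ {y}, y < d.Y → HasDerivAt (fun y => exp (-(2 * y)) * (dE y - 2 * d.energy y))
      (exp (-(2 * y)) * (ddE y - 4 * dE y + 4 * d.energy y)) y := fun {y} hy =>
    ((hexp y).mul ((d.hasDerivAt_denergy hy).sub
      ((d.hasDerivAt_energy hy).const_mul 2))).congr_deriv (by simp only [hdE, hddE, Pi.sub_apply]; ring)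
  obtain ⟨m, hm, hmax⟩ := exists_isMax_Iic (h := h) (y₁ := d.Y - T)
    (fun y hy => (hd1 (hlt hy)).continuousAt.continuousWithinAt)
    (fun y _ => mul_nonneg (d.energy_nonneg y) (exp_pos _).le) d.energy_init
  set H := h m * exp (2 * d.Y) with hH
  have hH0 : 0 ≤ H := mul_nonneg (mul_nonneg (d.energy_nonneg m) (exp_pos _).le) (exp_pos _).le
  have hb : ∀ y ≤ d.Y - T, d.energy y ≤ H * exp (2 * (y - d.Y)) := by
    intro y hy
    have e : H * exp (2 * (y - d.Y)) = h m * exp (2 * y) := by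
      rw [hH, mul_assoc, ← exp_add]; ring_nf
    have e' : d.energy y = h y * exp (2 * y) := by
      rw [hh, mul_assoc, ← exp_add]; simp
    rw [e, e']
    exact mul_le_mul_of_nonneg_right (hmax y hy) (exp_pos _).le
  have hEm : d.energy m = H * exp (2 * (m - d.Y)) := by
    rw [hH, hh, mul_assoc, mul_assoc, ← exp_add, ← exp_add]
    ring_nf
    simp
  have hHb : H ≤ 7 * K ^ 2 * exp (2 * T) + 1 + 1568 * G ^ 2 * C ^ 2 + 224 * C ^ 2 := by
    rcases hm.eq_or_lt with he | hlt'
    · have h1 : d.energy m ≤ 2 * π * K ^ 2 := by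
        refine (le_abs_self _).trans (abs_integral_le_of_bound fun θ => ?_)
        rw [abs_pow]
        gcongr
        exact d.abs_ang_le (hlt hm) θ
      rw [hEm, he, show 2 * (d.Y - T - d.Y) = -(2 * T) by ring] at h1
      have h2 : H ≤ 2 * π * K ^ 2 * exp (2 * T) := by
        calc H = H * exp (-(2 * T)) * exp (2 * T) := by rw [mul_assoc, ← exp_add]; simp
          _ ≤ _ := by gcongr
      have hpi := pi_lt_d2
      have h3 : 2 * π * K ^ 2 * exp (2 * T) ≤ 7 * K ^ 2 * exp (2 * T) := by gcongr; linarith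
      have : 0 ≤ 1568 * G ^ 2 * C ^ 2 + 224 * C ^ 2 := by positivity
      linarith
    · have hmY := hlt hm
      have hev : ∀ᶠ s in 𝓝 m, s < d.Y - T := Iio_mem_nhds hlt'
      have hmin : IsLocalMin (fun s => -h s) m := by
        filter_upwards [hev] with s hs using neg_le_neg (hmax s hs.le)
      have c1 : -(exp (-(2 * m)) * (dE m - 2 * d.energy m)) = 0 :=
        hmin.hasDerivAt_eq_zero (hd1 hmY).neg
      have c2 := secondDeriv_nonneg_of_isLocalMin
        (f' := fun s => -(exp (-(2 * s)) * (dE s - 2 * d.energy s)))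
        (hev.mono fun s hs => (hd1 (hlt hs.le)).neg) (hd2 hmY).neg hmin
      have hp := exp_pos (-(2 * m))
      have c1' : dE m = 2 * d.energy m := by
        have := (mul_eq_zero.1 (neg_eq_zero.1 c1)).resolve_left hp.ne'
        linarith
      have c2' : ddE m ≤ 4 * d.energy m := by
        by_contra hc
        push Not at hc
        have : 0 < exp (-(2 * m)) * (ddE m - 4 * dE m + 4 * d.energy m) :=
          mul_pos hp (by linarith)
        linarith
      set X := √(H + 1) with hX
      have hX0 : 0 < X := by positivity
      have hX2 : X ^ 2 = H + 1 := sq_sqrt (by positivity)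
      have hI : ∀ y ≤ d.Y - T, ∫ θ in (0 : ℝ)..(2 * π), |d.ang y θ| ≤ 4 * X * exp (y - d.Y) := by
        intro y hy
        refine d.integral_abs_ang_le (hlt hy) hX0 ((hb y hy).trans ?_)
        rw [hX2]
        gcongr
        linarith
      have r1 := d.abs_coef_le hκ hκ1 hε.le hX0.le hC (by linarith) hP hs hI (c := cos)
        (c' := fun t => -sin t) hasDerivAt_cos (fun t => (hasDerivAt_sin t).neg) abs_cos_le_one
        (fun t => by rw [abs_neg]; exact abs_sin_le_one t) cos_periodic
        (fun t => by simp) m hm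
      have r2 := d.abs_coef_le hκ hκ1 hε.le hX0.le hC (by linarith) hP hs hI (c := sin)
        (c' := cos) hasDerivAt_sin hasDerivAt_cos abs_sin_le_one abs_cos_le_one sin_periodic
        cos_periodic m hm
      have hw := wt_le_two hκ.le hmY.le
      have fin := d.energy_le_of_critical (S := 2 * C * exp (m - d.Y)) hmY
        (fun θ => by
          have a1 := (abs_le.1 (hP m hm θ)).2
          have a2 := potStd_le_two m
          nlinarith)
        (fun θ => (hs m hm θ).trans (by
          have := exp_pos (m - d.Y)
          calc _ ≤ C * exp (m - d.Y) * 2 := by gcongr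
            _ = _ := by ring)) r1 r2 c1' c2'
      have e2 : exp (2 * (m - d.Y)) = exp (m - d.Y) ^ 2 := by
        rw [← exp_nat_mul]; push_cast; rfl
      rw [hEm, e2] at fin
      have hE2 : 0 < exp (m - d.Y) ^ 2 := by positivity
      have fin2 : H ≤ 8 * (G * (4 * ε * X + 7 * C)) ^ 2 + 112 * C ^ 2 := by
        refine le_of_mul_le_mul_right (fin.trans_eq ?_) hE2
        ring
      have fin3 : (4 * ε * X + 7 * C) ^ 2 ≤ 2 * (16 * ε ^ 2 * X ^ 2 + 49 * C ^ 2) := by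
        nlinarith [sq_nonneg (4 * ε * X - 7 * C)]
      have fin4 : 8 * (G * (4 * ε * X + 7 * C)) ^ 2 ≤
          256 * G ^ 2 * ε ^ 2 * X ^ 2 + 784 * G ^ 2 * C ^ 2 := by
        have := mul_le_mul_of_nonneg_left fin3 (show 0 ≤ 8 * G ^ 2 by positivity)
        linarith
      have fin5 : 256 * G ^ 2 * ε ^ 2 * X ^ 2 ≤ 1 / 2 * (H + 1) := by
        rw [← hX2]
        gcongr
      have : 0 ≤ 7 * K ^ 2 * exp (2 * T) := by positivity
      linarith
  intro y hy
  exact (hb y hy).trans (mul_le_mul_of_nonneg_right hHb (exp_pos _).le)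

end Cyl

theorem Adm.integral_abs_ang_le {K : ℝ} {d : ℕ → Cyl K} (h : Adm d) :
    ∃ D > 0, ∀ᶠ n in atTop, ∀ y < (d n).Y,
      ∫ θ in (0 : ℝ)..(2 * π), |(d n).ang y θ| ≤ D * exp (y - (d n).Y) := by
  have hK := (d 0).K_pos
  obtain ⟨C, hC, κ, hκ, hκ1, hd⟩ := h.dens_le_wt
  set G := gronConst (κ / 2) 32 with hG
  have hG0 : 0 < G := gronConst_pos (by positivity) 32
  obtain ⟨ε, hε, hε1, hεG⟩ : ∃ ε > 0, ε ≤ 1 / 4 ∧ 256 * G ^ 2 * ε ^ 2 ≤ 1 / 2 := by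
    refine ⟨min (1 / 4) (1 / (32 * G)), by positivity, min_le_left _ _, ?_⟩
    have h1 : min (1 / 4) (1 / (32 * G)) ≤ 1 / (32 * G) := min_le_right _ _
    calc 256 * G ^ 2 * min (1 / 4) (1 / (32 * G)) ^ 2 ≤ 256 * G ^ 2 * (1 / (32 * G)) ^ 2 := by
          gcongr
      _ = 1 / 4 := by field_simp; norm_num
      _ ≤ _ := by norm_num
  obtain ⟨T, hT, hP⟩ := h.pot_sub_le hC hκ hκ1 hd hε
  set E := 7 * K ^ 2 * exp (2 * T) + 1 + 1568 * G ^ 2 * (K * C) ^ 2 + 224 * (K * C) ^ 2 with hE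
  have hE0 : 0 < E := by positivity
  refine ⟨4 * √E + 7 * K * exp T, by positivity, ?_⟩
  filter_upwards [hd, hP] with n hd hP y hy
  have hexp := exp_pos (y - (d n).Y)
  by_cases hyT : y ≤ (d n).Y - T
  · have h1 := (d n).energy_le (C := K * C) (half_pos hκ) (by linarith) hε hε1 (by positivity) hT hP
      (fun y hy θ => by
        have hyY : y < (d n).Y := by linarith
        refine ((d n).abs_src_le hyY θ).trans ?_
        have h2 := hd y hyY θ
        have h3 : wt κ (d n).Y y ≤ wt (κ / 2) (d n).Y y := wt_mono (by linarith) hyY.le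
        calc _ ≤ K * exp (y - (d n).Y) * (C * wt (κ / 2) (d n).Y y) := by
              gcongr; exact h2.trans (by gcongr)
          _ = _ := by ring) hεG y hyT
    refine ((d n).integral_abs_ang_le hy (X := √E) (by positivity) ?_).trans ?_
    · rw [sq_sqrt hE0.le]; exact h1
    · gcongr
      have : 0 < 7 * K * exp T := by positivity
      linarith
  · push Not at hyT
    have h1 : ∫ θ in (0 : ℝ)..(2 * π), |(d n).ang y θ| ≤ 2 * π * K := by
      refine (le_abs_self _).trans (abs_integral_le_of_bound fun θ => ?_)
      rw [abs_abs]
      exact (d n).abs_ang_le hy θ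
    have h2 : 1 ≤ exp T * exp (y - (d n).Y) := by
      rw [← exp_add]; exact one_le_exp (by linarith)
    have hpi := pi_lt_d2
    have h3 : 7 * K * 1 ≤ 7 * K * (exp T * exp (y - (d n).Y)) := by gcongr
    have h4 : 0 ≤ 4 * √E * exp (y - (d n).Y) := by positivity
    nlinarith

namespace Cyl

variable {K : ℝ} (d : Cyl K)

theorem contDiff_β : ContDiff ℝ (⊤ : ℕ∞) d.β := by
  have key : ∀ n : ℕ, ContDiff ℝ n d.β ∧ ContDiff ℝ n d.dβ := by
    have e1 : deriv d.β = d.dβ := funext fun y => (d.hβ y).deriv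
    have e2 : deriv d.dβ = fun y =>
      -(exp (2 * y - d.γ ^ 2) / (d.φ * d.γ ^ 2) * d.φ * (d.β y * exp (d.β y ^ 2))) :=
      funext fun y => (d.hdβ y).deriv
    have h1 : Differentiable ℝ d.β := fun y => (d.hβ y).differentiableAt
    have h2 : Differentiable ℝ d.dβ := fun y => (d.hdβ y).differentiableAt
    intro n
    induction n with
    | zero => exact ⟨contDiff_zero.2 h1.continuous, contDiff_zero.2 h2.continuous⟩
    | succ n ih =>
      obtain ⟨i1, i2⟩ := ih
      push_cast
      refine ⟨contDiff_succ_iff_deriv.2 ⟨h1, by simp, by rw [e1]; exact i2⟩,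
        contDiff_succ_iff_deriv.2 ⟨h2, by simp, ?_⟩⟩
      rw [e2]
      fun_prop
  exact contDiff_infty.2 fun n => (key n).1

/-- The difference of the nonlinearities. -/
def dnl (y θ : ℝ) : ℝ := d.nl y θ - d.k y * d.φ * (d.β y * exp (d.β y ^ 2))

theorem abs_dnl_le {C C₁ M κ y θ : ℝ} (hy : y < d.Y)
    (hd : d.dens y θ ≤ C * wt κ d.Y y)
    (hn : ∀ ξ, d.γ * |ξ - d.u y θ| ≤ M * exp (y - d.Y) →
      d.k y * ((1 + 2 * ξ ^ 2) * exp (ξ ^ 2)) ≤ C₁ * wt κ d.Y y)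
    (hβ : d.γ * |d.β y - d.u y θ| ≤ M * exp (y - d.Y)) :
    d.γ * |d.dnl y θ| ≤ wt κ d.Y y *
      (K * C * exp (y - d.Y) + K * C₁ * (d.γ * |d.β y - d.u y θ|)) := by
  have hk := d.k_pos y
  have hγ := d.γ_pos
  have hu := d.u_pos y hy θ
  have hF := d.F_sub y hy θ
  have hφ := d.φ_pos
  have hφK := d.φ_le
  have hK := d.K_pos
  set G : ℝ → ℝ := fun s => s * exp (s ^ 2) with hG
  have hw := wt_pos κ d.Y y
  have mv : |G (d.β y) - G (d.u y θ)| ≤ C₁ * wt κ d.Y y / d.k y * |d.β y - d.u y θ| := by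
    have hr : ∀ ξ ∈ closedBall (d.u y θ) |d.β y - d.u y θ|,
        ‖(1 + 2 * ξ ^ 2) * exp (ξ ^ 2)‖ ≤ C₁ * wt κ d.Y y / d.k y := by
      intro ξ hξ
      rw [mem_closedBall, Real.dist_eq] at hξ
      rw [Real.norm_eq_abs, abs_of_pos (by positivity), le_div_iff₀ hk, mul_comm]
      exact hn ξ (le_trans (by gcongr) hβ)
    have := (convex_closedBall (d.u y θ) |d.β y - d.u y θ|).norm_image_sub_le_of_norm_hasDerivWithin_le
      (f := G) (fun ξ _ => (hasDerivAt_mul_exp_sq ξ).hasDerivWithinAt) hr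
      (mem_closedBall_self (abs_nonneg _)) (by rw [mem_closedBall, Real.dist_eq])
    simpa only [Real.norm_eq_abs] using this
  have e : d.dnl y θ = d.k y * (d.F y θ - d.φ) * G (d.u y θ) -
      d.k y * d.φ * (G (d.β y) - G (d.u y θ)) := by
    simp only [dnl, nl, hG]; ring
  have a1 : d.γ * |d.k y * (d.F y θ - d.φ) * G (d.u y θ)| ≤ K * exp (y - d.Y) * d.dens y θ := by
    have hGu : 0 < G (d.u y θ) := by simp only [hG]; positivity
    rw [abs_mul, abs_mul, abs_of_pos hk, abs_of_pos hGu]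
    simp only [hG, dens]
    calc d.γ * (d.k y * |d.F y θ - d.φ| * (d.u y θ * exp (d.u y θ ^ 2)))
        ≤ d.γ * (d.k y * (K * exp (y - d.Y)) * (d.u y θ * exp (d.u y θ ^ 2))) := by gcongr
      _ = K * exp (y - d.Y) * (d.k y * (0 + d.γ * d.u y θ) * exp (d.u y θ ^ 2)) := by ring
      _ ≤ _ := by gcongr; positivity
  have a2 : d.γ * |d.k y * d.φ * (G (d.β y) - G (d.u y θ))| ≤
      K * C₁ * wt κ d.Y y * (d.γ * |d.β y - d.u y θ|) := by
    rw [abs_mul, abs_mul, abs_of_pos hk, abs_of_pos hφ]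
    have hC : 0 ≤ C₁ * wt κ d.Y y / d.k y * |d.β y - d.u y θ| := (abs_nonneg _).trans mv
    calc d.γ * (d.k y * d.φ * |G (d.β y) - G (d.u y θ)|)
        ≤ d.γ * (d.k y * K * (C₁ * wt κ d.Y y / d.k y * |d.β y - d.u y θ|)) := by gcongr
      _ = _ := by field_simp
  calc d.γ * |d.dnl y θ| ≤ d.γ * (|d.k y * (d.F y θ - d.φ) * G (d.u y θ)| +
        |d.k y * d.φ * (G (d.β y) - G (d.u y θ))|) := by
        rw [e]; gcongr; exact abs_sub _ _
    _ ≤ K * exp (y - d.Y) * (C * wt κ d.Y y) +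
        K * C₁ * wt κ d.Y y * (d.γ * |d.β y - d.u y θ|) := by
        rw [mul_add]
        refine add_le_add (a1.trans ?_) a2
        gcongr
    _ = _ := by ring

/-- The rescaled difference of radial averages. -/
def zer (y : ℝ) : ℝ := d.γ * (avg d.u y - d.β y)

def dzer (y : ℝ) : ℝ := d.γ * (avg (pdy d.u) y - d.dβ y)

theorem hasDerivAt_zer {y : ℝ} (hy : y < d.Y) : HasDerivAt d.zer (d.dzer y) y :=
  ((d.hasDerivAt_b hy).sub (d.hβ y)).const_mul _

theorem hasDerivAt_dzer {y : ℝ} (hy : y < d.Y) :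
    HasDerivAt d.dzer (-(d.γ * avg d.dnl y)) y := by
  refine (((d.hasDerivAt_db hy).sub (d.hdβ y)).const_mul d.γ).congr_deriv ?_
  have hc := d.sm_nl.continuous_t hy
  have hpi := pi_pos
  have e : avg d.dnl y = avg d.nl y - d.k y * d.φ * (d.β y * exp (d.β y ^ 2)) := by
    unfold avg dnl
    rw [intervalIntegral.integral_sub (hc.intervalIntegrable _ _) intervalIntegrable_const]
    simp
    field_simp
  rw [e]
  unfold k
  ring

theorem zer_init {ε : ℝ} (hε : 0 < ε) : ∃ y₀ < d.Y, ∀ y ≤ y₀,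
    |d.zer y| ≤ ε * exp y ∧ |d.dzer y| ≤ ε * exp y := by
  have hγ := d.γ_pos
  obtain ⟨y₁, h1, i1⟩ := d.avg_init (ε := ε / (2 * d.γ)) (by positivity)
  obtain ⟨y₂, i2⟩ := d.initβ (ε / (2 * d.γ)) (by positivity)
  refine ⟨min y₁ y₂, (min_le_left _ _).trans_lt h1, fun y hy => ?_⟩
  obtain ⟨a1, a2⟩ := i1 y (hy.trans (min_le_left _ _))
  obtain ⟨b1, b2⟩ := i2 y (hy.trans (min_le_right _ _))
  have e : ε * exp y = d.γ * (ε / (2 * d.γ) * exp y + ε / (2 * d.γ) * exp y) := by field_simp; ring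
  unfold zer dzer
  rw [abs_mul, abs_mul, abs_of_pos hγ, e]
  refine ⟨?_, ?_⟩
  · gcongr
    rw [show avg d.u y - d.β y = (avg d.u y - d.γ) - (d.β y - d.γ) by ring]
    exact (abs_sub _ _).trans (add_le_add a1 b1)
  · gcongr
    exact (abs_sub _ _).trans (add_le_add a2 b2)

theorem abs_u_sub_avg_le {D y : ℝ} (hy : y < d.Y)
    (hD : ∫ θ in (0 : ℝ)..(2 * π), |d.ang y θ| ≤ D * exp (y - d.Y)) (θ : ℝ) :
    d.γ * |d.u y θ - avg d.u y| ≤ D * exp (y - d.Y) := by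
  refine le_trans ?_ hD
  have hγ := d.γ_pos
  have := d.su.abs_sub_avg_le hy (d.pu y hy) θ
  unfold ang
  simp_rw [abs_mul, abs_of_pos hγ]
  rw [intervalIntegral.integral_const_mul]
  gcongr

theorem abs_sub_le_zer {D y : ℝ} (hy : y < d.Y)
    (hD : ∫ θ in (0 : ℝ)..(2 * π), |d.ang y θ| ≤ D * exp (y - d.Y)) (θ : ℝ) :
    d.γ * |d.β y - d.u y θ| ≤ |d.zer y| + D * exp (y - d.Y) := by
  have h1 := d.abs_u_sub_avg_le hy hD θ
  have hγ := d.γ_pos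
  unfold zer
  rw [abs_mul, abs_of_pos hγ]
  have h2 : |d.β y - d.u y θ| ≤ |avg d.u y - d.β y| + |d.u y θ - avg d.u y| := by
    rw [abs_sub_comm (avg d.u y), abs_sub_comm (d.u y θ)]
    exact abs_sub_le _ _ _
  nlinarith

theorem zer_le {C C₁ D κ : ℝ} (hC : 0 < C) (hC₁ : 0 < C₁) (hκ : 0 < κ) (hD0 : 0 < D)
    (hd : ∀ y < d.Y, ∀ θ, d.dens y θ ≤ C * wt κ d.Y y)
    (hD : ∀ y < d.Y, ∫ θ in (0 : ℝ)..(2 * π), |d.ang y θ| ≤ D * exp (y - d.Y))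
    (hn : ∀ y < d.Y, ∀ θ ξ, d.γ * |ξ - d.u y θ| ≤
      (2 * (gronConst κ (K * C₁) * (K * C + K * C₁ * D)) + 1 + D) * exp (y - d.Y) →
      d.k y * ((1 + 2 * ξ ^ 2) * exp (ξ ^ 2)) ≤ C₁ * wt κ d.Y y) :
    ∀ y < d.Y, |d.zer y| ≤ gronConst κ (K * C₁) * (K * C + K * C₁ * D) * exp (y - d.Y) ∧
      |d.dzer y| ≤ gronConst κ (K * C₁) * (K * C + K * C₁ * D) * exp (y - d.Y) := by
  have hK := d.K_pos
  have hγ := d.γ_pos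
  set S := K * C + K * C₁ * D with hS
  have hS0 : 0 < S := by positivity
  have hG := gronConst_pos hκ (K * C₁)
  set C₃ := gronConst κ (K * C₁) * S with hC₃
  have hC₃0 : 0 < C₃ := by positivity
  have lim : ∀ {f : ℝ → ℝ}, (∀ ε > 0, ∃ y₀, ∀ y ≤ y₀, |f y| ≤ ε * exp y) →
      Tendsto (fun y => exp (-y) * |f y|) atBot (𝓝 0) ∧ Tendsto f atBot (𝓝 0) := by
    intro f hf
    have t : Tendsto (fun y => exp (-y) * |f y|) atBot (𝓝 0) := by
      rw [Metric.tendsto_nhds]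
      intro δ hδ
      obtain ⟨y₀, h⟩ := hf (δ / 2) (by positivity)
      filter_upwards [eventually_le_atBot y₀] with y hy
      rw [dist_zero_right, norm_mul, Real.norm_eq_abs, Real.norm_eq_abs, abs_abs,
        abs_of_pos (exp_pos _)]
      calc exp (-y) * |f y| ≤ exp (-y) * (δ / 2 * exp y) := by gcongr; exact h y hy
        _ = δ / 2 * (exp (-y) * exp y) := by ring
        _ = δ / 2 := by rw [← exp_add]; simp
        _ < δ := by linarith
    refine ⟨t, ?_⟩
    have := tendsto_exp_atBot.mul t
    rw [mul_zero] at this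
    refine (tendsto_zero_iff_abs_tendsto_zero _).2 (this.congr fun y => ?_)
    rw [← mul_assoc, ← exp_add]
    simp
  have iz := lim (f := d.zer) fun ε hε => by
    obtain ⟨y₀, -, h⟩ := d.zer_init hε
    exact ⟨y₀, fun y hy => (h y hy).1⟩
  have idz := lim (f := d.dzer) fun ε hε => by
    obtain ⟨y₀, -, h⟩ := d.zer_init hε
    exact ⟨y₀, fun y hy => (h y hy).2⟩
  have step : ∀ y₁ < d.Y, (∀ y ≤ y₁, |d.zer y| ≤ (2 * C₃ + 1) * exp (y - d.Y)) →
      ∀ y ≤ y₁, |d.zer y| ≤ C₃ * exp (y - d.Y) ∧ |d.dzer y| ≤ C₃ * exp (y - d.Y) := by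
    intro y₁ hy₁ hb y hy
    have := gronwall_modeZero (z'' := fun y => -(d.γ * avg d.dnl y)) (S := S * exp (-d.Y)) hκ
      (L := K * C₁) (by positivity) (by positivity) hy₁.le
      (fun y hy => d.hasDerivAt_zer (hy.trans_lt hy₁))
      (fun y hy => d.hasDerivAt_dzer (hy.trans_lt hy₁)) (fun y hy => ?_) iz.1 iz.2 idz.2 y hy
    · have e : gronConst κ (K * C₁) * (S * exp (-d.Y)) * exp y = C₃ * exp (y - d.Y) := by
        rw [hC₃, show y - d.Y = -d.Y + y by ring, exp_add]
        ring
      rw [e] at this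
      exact this
    · have hyY := hy.trans_lt hy₁
      have hw := wt_pos κ d.Y y
      have hz := hb y hy
      have hc : Continuous (d.dnl y) := (d.sm_nl.continuous_t hyY).sub continuous_const
      have pt : ∀ θ, |d.dnl y θ| ≤ wt κ d.Y y * (K * C₁ * |d.zer y| +
          S * exp (y - d.Y)) / d.γ := by
        intro θ
        have h1 := d.abs_sub_le_zer hyY (hD y hyY) θ
        have h2 := d.abs_dnl_le hyY (hd y hyY θ) (hn y hyY θ) (by linarith)
        rw [le_div_iff₀ hγ, mul_comm]
        refine h2.trans (mul_le_mul_of_nonneg_left ?_ hw.le)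
        have h3 := mul_le_mul_of_nonneg_left h1 (show 0 ≤ K * C₁ by positivity)
        rw [hS]
        linarith
      have := abs_avg_le hc pt
      rw [abs_neg, abs_mul, abs_of_pos hγ]
      rw [le_div_iff₀ hγ] at this
      rw [mul_assoc S, ← exp_add, neg_add_eq_sub]
      linarith
  have good : ∀ y < d.Y, |d.zer y| < (2 * C₃ + 1) * exp (y - d.Y) := by
    by_contra hcon
    push Not at hcon
    obtain ⟨y₂, hy₂, hbad⟩ := hcon
    obtain ⟨y₀, hy₀, hinit⟩ := d.zer_init (ε := C₃ * exp (-d.Y)) (by positivity)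
    have hinit' : ∀ y ≤ y₀, |d.zer y| ≤ C₃ * exp (y - d.Y) := by
      intro y hy
      have := (hinit y hy).1
      rwa [mul_assoc, ← exp_add, neg_add_eq_sub] at this
    have hlt : ∀ s, C₃ * exp (s - d.Y) < (2 * C₃ + 1) * exp (s - d.Y) := fun s => by
      gcongr; linarith
    have h02 : y₀ < y₂ := by
      by_contra hc
      push Not at hc
      linarith [hinit' y₂ hc, hlt y₂]
    set q : ℝ → ℝ := fun s => |d.zer s| - (2 * C₃ + 1) * exp (s - d.Y) with hq
    have hqc : ContinuousOn q (Icc y₀ y₂) := by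
      intro s hs
      have := (d.hasDerivAt_zer (hs.2.trans_lt hy₂)).continuousAt
      exact (ContinuousAt.sub this.abs (by fun_prop)).continuousWithinAt
    have hcomp : IsCompact (Icc y₀ y₂ ∩ q ⁻¹' Ici 0) :=
      (isCompact_Icc).of_isClosed_subset (hqc.preimage_isClosed_of_isClosed isClosed_Icc isClosed_Ici)
        inter_subset_left
    obtain ⟨s, ⟨hs1, hs2⟩, hleast⟩ := hcomp.exists_isLeast
      ⟨y₂, ⟨h02.le, le_rfl⟩, by simp only [hq, mem_preimage, mem_Ici]; linarith⟩
    have hsY : s < d.Y := hs1.2.trans_lt hy₂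
    obtain ⟨t, ht, hqt⟩ := intermediate_value_Icc hs1.1
      (hqc.mono (Icc_subset_Icc_right hs1.2))
      (show (0 : ℝ) ∈ Icc (q y₀) (q s) from
        ⟨by simp only [hq]; linarith [hinit' y₀ le_rfl, hlt y₀], hs2⟩)
    have hts : s ≤ t := hleast ⟨⟨ht.1, ht.2.trans hs1.2⟩, by simp [hqt]⟩
    have hst : s = t := le_antisymm hts ht.2
    rw [← hst] at hqt
    have hbd : ∀ y ≤ s, |d.zer y| ≤ (2 * C₃ + 1) * exp (y - d.Y) := by
      intro y hy
      rcases hy.eq_or_lt with rfl | hys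
      · simp only [hq] at hqt; linarith
      · rcases le_total y y₀ with h | h
        · linarith [hinit' y h, hlt y]
        · by_contra hc
          push Not at hc
          have : s ≤ y := hleast ⟨⟨h, hys.le.trans hs1.2⟩, by
            simp only [hq, mem_preimage, mem_Ici]; linarith⟩
          linarith
    have := (step s hsY hbd s le_rfl).1
    simp only [hq] at hqt
    linarith [hlt s]
  exact fun y hy => step y hy (fun s hs => (good s (hs.trans_lt hy)).le) y le_rfl

end Cyl

namespace Cyl

variable {K : ℝ} (d : Cyl K)

theorem grad_le {C C₁ C₃ D κ : ℝ} (hC : 0 < C) (hC₁ : 0 < C₁) (hκ : 0 < κ) (hD0 : 0 < D)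
    (hC₃ : 0 < C₃)
    (hd : ∀ y < d.Y, ∀ θ, d.dens y θ ≤ C * wt κ d.Y y)
    (hD : ∀ y < d.Y, ∫ θ in (0 : ℝ)..(2 * π), |d.ang y θ| ≤ D * exp (y - d.Y))
    (hn : ∀ y < d.Y, ∀ θ ξ, d.γ * |ξ - d.u y θ| ≤ (2 * C₃ + 1 + D) * exp (y - d.Y) →
      d.k y * ((1 + 2 * ξ ^ 2) * exp (ξ ^ 2)) ≤ C₁ * wt κ d.Y y)
    (hz : ∀ y < d.Y, |d.zer y| ≤ C₃ * exp (y - d.Y) ∧ |d.dzer y| ≤ C₃ * exp (y - d.Y))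
    {E : ℝ} (hE : E = (C₃ + D) + 2 * (K * C + K * C₁ * (C₃ + D)) + 2 * K + C₃) :
    ∀ y < d.Y, ∀ θ, d.γ * |d.u y θ - d.β y| ≤ 12 * E * exp (y - d.Y) ∧
      d.γ * |pdy d.u y θ - d.dβ y| ≤ 12 * E * exp (y - d.Y) ∧
      d.γ * |pdt d.u y θ| ≤ 12 * E * exp (y - d.Y) := by
  have hK := d.K_pos
  have hγ := d.γ_pos
  have hA : 0 < K * C + K * C₁ * (C₃ + D) := by positivity
  have hE0 : 0 < E := by rw [hE]; positivity
  have he : exp 1 < 3 := exp_one_lt_d9.trans (by norm_num)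
  have hb : ∀ y < d.Y, ∀ θ, d.γ * |d.β y - d.u y θ| ≤ (C₃ + D) * exp (y - d.Y) := by
    intro y hy θ
    have := d.abs_sub_le_zer hy (hD y hy) θ
    linarith [(hz y hy).1]
  have hdn : ∀ y < d.Y, ∀ θ, d.γ * |d.dnl y θ| ≤
      2 * (K * C + K * C₁ * (C₃ + D)) * exp (y - d.Y) := by
    intro y hy θ
    have he := exp_pos (y - d.Y)
    have h0 := hb y hy θ
    have h1 := d.abs_dnl_le hy (hd y hy θ) (hn y hy θ) (h0.trans (by nlinarith))
    refine h1.trans ?_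
    calc wt κ d.Y y * (K * C * exp (y - d.Y) + K * C₁ * (d.γ * |d.β y - d.u y θ|))
        ≤ 2 * (K * C * exp (y - d.Y) + K * C₁ * ((C₃ + D) * exp (y - d.Y))) := by
          gcongr
          exact wt_le_two hκ.le hy.le
      _ = _ := by ring
  intro y hy θ
  have hey := exp_pos (y - d.Y)
  refine ⟨?_, ?_⟩
  · rw [abs_sub_comm]
    refine (hb y hy θ).trans ?_
    gcongr
    rw [hE]
    linarith
  by_cases hy1 : y + 1 < d.Y
  · set z : ℝ → ℝ → ℝ := fun y θ => d.γ * (d.u y θ - d.β y) with hzd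
    have hsm : Sm d.Y z := (d.su.sub (Sm.of_fst d.contDiff_β)).const_mul d.γ
    have e1 : ∀ s < d.Y, ∀ θ, pdy z s θ = d.γ * (pdy d.u s θ - d.dβ s) := fun s hs θ =>
      (((d.su.hasDerivAt_y hs).sub (d.hβ s)).const_mul d.γ).deriv
    have e2 : ∀ s < d.Y, ∀ θ, pdt z s θ = d.γ * pdt d.u s θ := fun s hs θ =>
      (((d.su.hasDerivAt_t hs).sub_const (d.β s)).const_mul d.γ).deriv
    have e3 : ∀ s < d.Y, ∀ θ, pdy (pdy z) s θ + pdt (pdt z) s θ = -(d.γ * d.dnl s θ) := by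
      intro s hs θ
      have a1 : pdy (pdy z) s θ = d.γ * (pdy (pdy d.u) s θ
          - -(d.k s * d.φ * (d.β s * exp (d.β s ^ 2)))) := by
        have := ((d.su.pdy.hasDerivAt_y (θ := θ) hs).sub (d.hdβ s)).const_mul d.γ
        refine (this.congr_of_eventuallyEq ?_).deriv
        filter_upwards [eventually_lt_nhds hs] with t ht
        exact e1 t ht θ
      have a2 : pdt (pdt z) s θ = d.γ * pdt (pdt d.u) s θ := by
        have := (d.su.pdt.hasDerivAt_t (θ := θ) hs).const_mul d.γ
        exact (this.congr_of_eventuallyEq (Eventually.of_forall fun t => e2 s hs t)).deriv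
      have a3 := d.pde s hs θ
      rw [a1, a2, dnl, nl, k]
      linear_combination d.γ * a3
    have hM : ∀ s ∈ Icc (y - 1) (y + 1), exp (s - d.Y) ≤ 3 * exp (y - d.Y) := by
      intro s hs
      calc exp (s - d.Y) ≤ exp (1 + (y - d.Y)) := exp_le_exp.2 (by linarith [hs.2])
        _ = exp 1 * exp (y - d.Y) := exp_add _ _
        _ ≤ _ := by gcongr
    have fin := hsm.interior_grad (M := 3 * E * exp (y - d.Y)) (θ₀ := θ) hy1 (fun s hs θ => by
      have hs' : s < d.Y := hs.2.trans_lt hy1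
      have := hb s hs' θ
      rw [abs_sub_comm] at this
      rw [hzd, abs_mul, abs_of_pos hγ]
      have h1 := hM s hs
      calc d.γ * |d.u s θ - d.β s| ≤ (C₃ + D) * exp (s - d.Y) := this
        _ ≤ E * (3 * exp (y - d.Y)) := by
          gcongr
          rw [hE]; linarith
        _ = _ := by ring) (fun s hs θ => by
      have hs' : s < d.Y := hs.2.trans_lt hy1
      rw [e3 s hs', abs_neg, abs_mul, abs_of_pos hγ]
      have h1 := hM s hs
      calc d.γ * |d.dnl s θ| ≤ 2 * (K * C + K * C₁ * (C₃ + D)) * exp (s - d.Y) := hdn s hs' θ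
        _ ≤ E * (3 * exp (y - d.Y)) := by
          gcongr
          rw [hE]; linarith
        _ = _ := by ring)
    rw [e1 y hy, e2 y hy, abs_mul, abs_mul, abs_of_pos hγ] at fin
    exact ⟨fin.1.trans (by linarith), fin.2.trans (by linarith)⟩
  · push Not at hy1
    have h1 : 1 ≤ 3 * exp (y - d.Y) := by
      have : exp (-1) ≤ exp (y - d.Y) := exp_le_exp.2 (by linarith)
      have h2 : exp 1 * exp (-1) = 1 := by rw [← exp_add]; simp
      nlinarith [exp_pos (-1)]
    have h2 : ∀ {a : ℝ}, |a| ≤ K / d.γ → d.γ * |a| ≤ K := fun h => by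
      rw [le_div_iff₀ hγ] at h; linarith
    have hfin : (2 * K + C₃) ≤ 12 * E * exp (y - d.Y) := by
      have : 2 * K + C₃ ≤ E := by rw [hE]; linarith
      nlinarith
    have h3 := h2 (d.u_y y hy θ)
    have h4 := h2 (d.u_t y hy θ)
    have h5 := h2 (d.abs_db_le hy)
    have h6 : d.γ * |avg (pdy d.u) y - d.dβ y| ≤ C₃ := by
      have := (hz y hy).2
      rw [dzer, abs_mul, abs_of_pos hγ] at this
      have : exp (y - d.Y) ≤ 1 := exp_le_one_iff.2 (by linarith)
      nlinarith
    refine ⟨?_, by linarith⟩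
    have h7 : |pdy d.u y θ - d.dβ y| ≤ |pdy d.u y θ| + |avg (pdy d.u) y|
        + |avg (pdy d.u) y - d.dβ y| := by
      have e : pdy d.u y θ - d.dβ y
        = pdy d.u y θ - avg (pdy d.u) y + (avg (pdy d.u) y - d.dβ y) := by ring
      rw [e]
      exact (abs_add_le _ _).trans (by gcongr; exact abs_sub _ _)
    calc d.γ * |pdy d.u y θ - d.dβ y| ≤ d.γ * (|pdy d.u y θ| + |avg (pdy d.u) y|
        + |avg (pdy d.u) y - d.dβ y|) := by gcongr
      _ ≤ _ := by linarith

end Cyl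

theorem Adm.main {K : ℝ} {d : ℕ → Cyl K} (h : Adm d) :
    ∃ C > 0, ∀ᶠ n in atTop, ∀ y < (d n).Y, ∀ θ,
      (d n).γ * |(d n).u y θ - (d n).β y| ≤ C * exp (y - (d n).Y) ∧
      (d n).γ * |pdy (d n).u y θ - (d n).dβ y| ≤ C * exp (y - (d n).Y) ∧
      (d n).γ * |pdt (d n).u y θ| ≤ C * exp (y - (d n).Y) := by
  have hK := (d 0).K_pos
  obtain ⟨C, hC, κ, hκ, -, hd⟩ := h.dens_le_wt
  obtain ⟨D, hD0, hD⟩ := h.integral_abs_ang_le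
  set C₁ := 8 * exp 5 * C + 1 with hC₁
  have hC₁0 : 0 < C₁ := by positivity
  set C₃ := gronConst κ (K * C₁) * (K * C + K * C₁ * D) with hC₃
  have hg := gronConst_pos hκ (K * C₁)
  have hC₃0 : 0 < C₃ := by positivity
  have hn := h.near_le_wt hC hκ hd (M := 2 * C₃ + 1 + D) (by linarith)
  refine ⟨12 * ((C₃ + D) + 2 * (K * C + K * C₁ * (C₃ + D)) + 2 * K + C₃), by positivity, ?_⟩
  filter_upwards [hd, hD, hn] with n hd hD hn
  exact (d n).grad_le hC hC₁0 hκ hD0 hC₃0 hd hD hn ((d n).zer_le hC hC₁0 hκ hD0 hd hD hn) rfl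

theorem mkPt_eq (a b : ℝ) :
    mkPt a b = a • EuclideanSpace.single 0 1 + b • EuclideanSpace.single 1 1 := by
  ext i
  fin_cases i <;> simp [mkPt]

/-- Logarithmic polar coordinates. -/
def polar (m y θ : ℝ) : Pt := (m * exp y) • mkPt (cos θ) (sin θ)

/-- The angular derivative of `polar`. -/
def polarPerp (m y θ : ℝ) : Pt := (m * exp y) • mkPt (-sin θ) (cos θ)

theorem contDiff_polar (m : ℝ) : ContDiff ℝ (⊤ : ℕ∞) (fun p : ℝ × ℝ => polar m p.1 p.2) := by
  simp only [polar, mkPt_eq]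
  fun_prop

theorem polar_periodic (m y : ℝ) : Function.Periodic (polar m y) (2 * π) := fun θ => by
  simp [polar]

theorem hasDerivAt_polar_y (m y θ : ℝ) :
    HasDerivAt (fun s => polar m s θ) (polar m y θ) y :=
  ((Real.hasDerivAt_exp y).const_mul m).smul_const _

theorem hasDerivAt_mkPt {a b : ℝ → ℝ} {a' b' t : ℝ} (ha : HasDerivAt a a' t)
    (hb : HasDerivAt b b' t) : HasDerivAt (fun s => mkPt (a s) (b s)) (mkPt a' b') t := by
  simp only [mkPt_eq]
  exact (ha.smul_const _).add (hb.smul_const _)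

theorem hasDerivAt_polar_t (m y θ : ℝ) : HasDerivAt (polar m y) (polarPerp m y θ) θ :=
  (hasDerivAt_mkPt (Real.hasDerivAt_cos θ) (Real.hasDerivAt_sin θ)).const_smul (m * exp y)

theorem hasDerivAt_polarPerp_t (m y θ : ℝ) :
    HasDerivAt (polarPerp m y) (-polar m y θ) θ := by
  refine ((hasDerivAt_mkPt (Real.hasDerivAt_sin θ).neg
    (Real.hasDerivAt_cos θ)).const_smul (m * exp y)).congr_deriv ?_
  simp only [polar, mkPt_eq]
  module

theorem norm_mkPt_sq (a b : ℝ) : ‖mkPt a b‖ ^ 2 = a ^ 2 + b ^ 2 := by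
  simp [mkPt, EuclideanSpace.norm_sq_eq]

theorem norm_polar {m : ℝ} (hm : 0 < m) (y θ : ℝ) : ‖polar m y θ‖ = m * exp y := by
  have h : ‖mkPt (cos θ) (sin θ)‖ = 1 := by
    rw [← sq_eq_sq₀ (norm_nonneg _) zero_le_one, norm_mkPt_sq]
    simp
  rw [polar, norm_smul, h, mul_one, Real.norm_of_nonneg (by positivity)]

theorem norm_polarPerp {m : ℝ} (hm : 0 < m) (y θ : ℝ) : ‖polarPerp m y θ‖ = m * exp y := by
  have h : ‖mkPt (-sin θ) (cos θ)‖ = 1 := by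
    rw [← sq_eq_sq₀ (norm_nonneg _) zero_le_one, norm_mkPt_sq]
    simp
  rw [polarPerp, norm_smul, h, mul_one, Real.norm_of_nonneg (by positivity)]

theorem exists_eq_polar {m : ℝ} (hm : 0 < m) {x : Pt} (hx : x ≠ 0) :
    ∃ y θ, x = polar m y θ := by
  set z : ℂ := ⟨x 0, x 1⟩ with hz
  have hz0 : z ≠ 0 := by
    intro h
    apply hx
    have h0 := congrArg Complex.re h
    have h1 := congrArg Complex.im h
    ext i
    fin_cases i
    · exact h0
    · exact h1
  have hn : 0 < ‖z‖ := norm_pos_iff.2 hz0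
  refine ⟨log (‖z‖ / m), Complex.arg z, ?_⟩
  have e : m * exp (log (‖z‖ / m)) = ‖z‖ := by
    rw [exp_log (by positivity)]
    field_simp
  rw [polar, e]
  ext i
  fin_cases i
  · simp [mkPt, Complex.norm_mul_cos_arg, hz]
  · simp [mkPt, Complex.norm_mul_sin_arg, hz]

theorem norm_sq_mul_polar {m : ℝ} (y θ : ℝ) (G : Pt →L[ℝ] ℝ) :
    (m * exp y) ^ 2 * ‖(InnerProductSpace.toDual ℝ Pt).symm G‖ ^ 2
      = G (polar m y θ) ^ 2 + G (polarPerp m y θ) ^ 2 := by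
  set g := (InnerProductSpace.toDual ℝ Pt).symm G with hg
  have hG : ∀ w, G w = g 0 * w 0 + g 1 * w 1 := fun w => by
    have : G w = ⟪g, w⟫ := by rw [hg, InnerProductSpace.toDual_symm_apply]
    rw [this, PiLp.inner_apply]
    simp [mul_comm]
  have hn : ‖g‖ ^ 2 = g 0 ^ 2 + g 1 ^ 2 := by simp [EuclideanSpace.norm_sq_eq]
  rw [hn, hG, hG]
  simp only [polar, polarPerp, mkPt]
  simp
  linear_combination -(m * exp y) ^ 2 * (g 0 ^ 2 + g 1 ^ 2) * sin_sq_add_cos_sq θ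

theorem polar_mem_ball {m R y : ℝ} (hm : 0 < m) (hR : 0 < R) (hy : y < log (R / m)) (θ : ℝ) :
    polar m y θ ∈ ball (0 : Pt) R := by
  rw [mem_ball_zero_iff, norm_polar hm]
  have := (Real.lt_log_iff_exp_lt (by positivity)).1 hy
  rw [lt_div_iff₀ hm] at this
  linarith

section polarPullback

variable {m R y θ : ℝ} {w : Pt → ℝ}

theorem sm_polar (hm : 0 < m) (hR : 0 < R) (hw : ContDiffOn ℝ (⊤ : ℕ∞) w (ball 0 R)) :
    Sm (log (R / m)) (fun y θ => w (polar m y θ)) :=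
  hw.comp (contDiff_polar m).contDiffOn fun p hp => polar_mem_ball hm hR hp p.2

theorem pdy_polar (hw : DifferentiableAt ℝ w (polar m y θ)) :
    pdy (fun y θ => w (polar m y θ)) y θ = fderiv ℝ w (polar m y θ) (polar m y θ) :=
  (HasFDerivAt.comp_hasDerivAt (f := fun s => polar m s θ) y hw.hasFDerivAt
    (hasDerivAt_polar_y m y θ)).deriv

theorem pdt_polar (hw : DifferentiableAt ℝ w (polar m y θ)) :
    pdt (fun y θ => w (polar m y θ)) y θ = fderiv ℝ w (polar m y θ) (polarPerp m y θ) :=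
  (HasFDerivAt.comp_hasDerivAt (f := polar m y) θ hw.hasFDerivAt
    (hasDerivAt_polar_t m y θ)).deriv

theorem laplacian_polar (hm : 0 < m) (hR : 0 < R) (hw : ContDiffOn ℝ (⊤ : ℕ∞) w (ball 0 R))
    (hy : y < log (R / m)) :
    pdy (pdy (fun y θ => w (polar m y θ))) y θ + pdt (pdt (fun y θ => w (polar m y θ))) y θ
      = -((m * exp y) ^ 2 * lap w (polar m y θ)) := by
  have hwd : ∀ x ∈ ball (0 : Pt) R, DifferentiableAt ℝ w x := fun x hx =>
    (hw.contDiffAt (isOpen_ball.mem_nhds hx)).differentiableAt (by simp)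
  have hw' : ContDiffOn ℝ (⊤ : ℕ∞) (fderiv ℝ w) (ball 0 R) :=
    hw.fderiv_of_isOpen isOpen_ball (by norm_cast)
  have hx := polar_mem_ball hm hR hy θ
  have hd : DifferentiableAt ℝ (fderiv ℝ w) (polar m y θ) :=
    (hw'.contDiffAt (isOpen_ball.mem_nhds hx)).differentiableAt (by simp)
  set H := fderiv ℝ (fderiv ℝ w) (polar m y θ) with hH
  have e1 : pdy (pdy (fun y θ => w (polar m y θ))) y θ
      = H (polar m y θ) (polar m y θ) + fderiv ℝ w (polar m y θ) (polar m y θ) := by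
    have h1 := HasFDerivAt.comp_hasDerivAt (f := fun s => polar m s θ) y hd.hasFDerivAt
      (hasDerivAt_polar_y m y θ)
    have h2 := h1.clm_apply (hasDerivAt_polar_y m y θ)
    refine (h2.congr_of_eventuallyEq ?_).deriv
    filter_upwards [eventually_lt_nhds hy] with s hs
    exact pdy_polar (hwd _ (polar_mem_ball hm hR hs θ))
  have e2 : pdt (pdt (fun y θ => w (polar m y θ))) y θ
      = H (polarPerp m y θ) (polarPerp m y θ) - fderiv ℝ w (polar m y θ) (polar m y θ) := by
    have h1 := HasFDerivAt.comp_hasDerivAt (f := polar m y) θ hd.hasFDerivAt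
      (hasDerivAt_polar_t m y θ)
    have h2 := h1.clm_apply (hasDerivAt_polarPerp_t m y θ)
    rw [map_neg, ← sub_eq_add_neg] at h2
    refine (h2.congr_of_eventuallyEq (Eventually.of_forall fun s => ?_)).deriv
    exact pdt_polar (hwd _ (polar_mem_ball hm hR hy s))
  have e3 : ∀ i : Fin 2, fderiv ℝ (fun z => fderiv ℝ w z (EuclideanSpace.single i 1))
      (polar m y θ) (EuclideanSpace.single i 1)
      = H (EuclideanSpace.single i 1) (EuclideanSpace.single i 1) := fun i => by
    have := hd.hasFDerivAt.clm_apply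
      (hasFDerivAt_const (EuclideanSpace.single i (1 : ℝ)) (polar m y θ))
    rw [this.fderiv]
    simp [hH]
  rw [e1, e2, lap, Fin.sum_univ_two, e3, e3]
  clear_value H
  have e4 : H (polar m y θ) (polar m y θ) + H (polarPerp m y θ) (polarPerp m y θ)
      = (m * exp y) ^ 2 * (H (EuclideanSpace.single 0 1) (EuclideanSpace.single 0 1)
        + H (EuclideanSpace.single 1 1) (EuclideanSpace.single 1 1)) := by
    simp only [polar, polarPerp, mkPt_eq, map_smul, map_add, add_apply, smul_apply, smul_eq_mul]
    linear_combination (m * exp y) ^ 2 * (H (EuclideanSpace.single 0 1) (EuclideanSpace.single 0 1)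
        + H (EuclideanSpace.single 1 1) (EuclideanSpace.single 1 1)) * sin_sq_add_cos_sq θ
  linear_combination e4

theorem norm_fderiv_eq_norm_gradient (w : Pt → ℝ) (x : Pt) : ‖fderiv ℝ w x‖ = ‖gradient w x‖ := by
  rw [gradient, LinearIsometryEquiv.norm_map]

theorem abs_pdy_polar_le (hm : 0 < m) (hw : DifferentiableAt ℝ w (polar m y θ)) :
    |pdy (fun y θ => w (polar m y θ)) y θ| ≤ m * exp y * ‖gradient w (polar m y θ)‖ := by
  rw [pdy_polar hw, mul_comm (m * exp y), ← norm_fderiv_eq_norm_gradient]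
  refine ((fderiv ℝ w (polar m y θ)).le_opNorm _).trans_eq ?_
  rw [norm_polar hm]

theorem abs_pdt_polar_le (hm : 0 < m) (hw : DifferentiableAt ℝ w (polar m y θ)) :
    |pdt (fun y θ => w (polar m y θ)) y θ| ≤ m * exp y * ‖gradient w (polar m y θ)‖ := by
  rw [pdt_polar hw, mul_comm (m * exp y), ← norm_fderiv_eq_norm_gradient]
  refine ((fderiv ℝ w (polar m y θ)).le_opNorm _).trans_eq ?_
  rw [norm_polarPerp hm]

theorem polar_init (hm : 0 < m) (hR : 0 < R) (hw : ContDiffOn ℝ (⊤ : ℕ∞) w (ball 0 R))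
    (h0 : gradient w 0 = 0) {ε : ℝ} (hε : 0 < ε) : ∃ y₀ < log (R / m), ∀ y ≤ y₀, ∀ θ,
      |w (polar m y θ) - w 0| ≤ ε * exp y ∧
      |pdy (fun y θ => w (polar m y θ)) y θ| ≤ ε * exp y ∧
      |pdt (fun y θ => w (polar m y θ)) y θ| ≤ ε * exp y := by
  have hwd : ∀ x ∈ ball (0 : Pt) R, DifferentiableAt ℝ w x := fun x hx =>
    (hw.contDiffAt (isOpen_ball.mem_nhds hx)).differentiableAt (by simp)
  have hw' : ContDiffOn ℝ (⊤ : ℕ∞) (fderiv ℝ w) (ball 0 R) :=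
    hw.fderiv_of_isOpen isOpen_ball (by norm_cast)
  have m0 : (0 : Pt) ∈ ball (0 : Pt) R := mem_ball_self hR
  have hf0 : fderiv ℝ w 0 = 0 := by
    rw [← norm_eq_zero, norm_fderiv_eq_norm_gradient, h0, norm_zero]
  have hc : Tendsto (fun x => ‖fderiv ℝ w x‖) (𝓝 0) (𝓝 0) := by
    have := (hw'.continuousOn.continuousAt (isOpen_ball.mem_nhds m0)).norm
    rwa [ContinuousAt, hf0, norm_zero] at this
  have ev := hc.eventually_lt_const (show 0 < ε / m by positivity)
  obtain ⟨δ, hδ, hb⟩ := Metric.eventually_nhds_iff_ball.1 ev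
  set r := min δ R with hr
  have hr0 : 0 < r := lt_min hδ hR
  have hrR : ball (0 : Pt) r ⊆ ball 0 R := ball_subset_ball (min_le_right _ _)
  have hrδ : ball (0 : Pt) r ⊆ ball 0 δ := ball_subset_ball (min_le_left _ _)
  have hlog : log (r / m) ≤ log (R / m) :=
    Real.log_le_log (by positivity) (by gcongr; exact min_le_right _ _)
  refine ⟨log (r / m) - 1, by linarith, fun y hy θ => ?_⟩
  have hP : polar m y θ ∈ ball (0 : Pt) r := polar_mem_ball hm hr0 (by linarith) θ
  have hg : m * exp y * ‖gradient w (polar m y θ)‖ ≤ ε * exp y := by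
    rw [← norm_fderiv_eq_norm_gradient]
    calc m * exp y * ‖fderiv ℝ w (polar m y θ)‖ ≤ m * exp y * (ε / m) := by
          gcongr; exact (hb _ (hrδ hP)).le
      _ = _ := by field_simp
  refine ⟨?_, (abs_pdy_polar_le hm (hwd _ (hrR hP))).trans hg,
    (abs_pdt_polar_le hm (hwd _ (hrR hP))).trans hg⟩
  have := (convex_ball (0 : Pt) r).norm_image_sub_le_of_norm_fderiv_le (𝕜 := ℝ)
    (fun x hx => hwd x (hrR hx)) (fun x hx => (hb x (hrδ hx)).le) (mem_ball_self hr0) hP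
  rw [Real.norm_eq_abs, sub_zero, norm_polar hm] at this
  refine this.trans_eq ?_
  field_simp

end polarPullback

theorem radial_init {m : ℝ} (hm : 0 < m) {b : ℝ → ℝ} (hb : ContDiff ℝ (⊤ : ℕ∞) b)
    (h0 : deriv b 0 = 0) {ε : ℝ} (hε : 0 < ε) : ∃ y₀, ∀ y ≤ y₀,
      |b (m * exp y) - b 0| ≤ ε * exp y ∧ |m * exp y * deriv b (m * exp y)| ≤ ε * exp y := by
  have hbd : Differentiable ℝ b := hb.differentiable (by simp)
  have hc : Tendsto (fun x => |deriv b x|) (𝓝 0) (𝓝 0) := by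
    have := ((hb.continuous_deriv (by norm_cast)).continuousAt (x := 0)).abs
    rwa [ContinuousAt, h0, abs_zero] at this
  have ev := hc.eventually_lt_const (show 0 < ε / m by positivity)
  obtain ⟨δ, hδ, hball⟩ := Metric.eventually_nhds_iff_ball.1 ev
  refine ⟨log (δ / m) - 1, fun y hy => ?_⟩
  have hlt : m * exp y < δ := by
    have := (Real.lt_log_iff_exp_lt (by positivity)).1 (show y < log (δ / m) by linarith)
    rw [lt_div_iff₀ hm] at this
    linarith
  have hpos : 0 < m * exp y := by positivity
  have hmem : m * exp y ∈ ball (0 : ℝ) δ := by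
    rw [mem_ball_zero_iff, Real.norm_of_nonneg hpos.le]; exact hlt
  constructor
  · have := (convex_ball (0 : ℝ) δ).norm_image_sub_le_of_norm_deriv_le (𝕜 := ℝ)
      (fun x _ => hbd x) (fun x hx => (hball x hx).le) (mem_ball_self hδ) hmem
    rw [sub_zero, Real.norm_eq_abs, Real.norm_of_nonneg hpos.le] at this
    refine this.trans_eq ?_
    field_simp
  · rw [abs_mul, abs_of_pos hpos]
    calc m * exp y * |deriv b (m * exp y)| ≤ m * exp y * (ε / m) := by
          gcongr; exact (hball _ hmem).le
      _ = _ := by field_simp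

theorem exists_cyl {K C₀ C₂ A L R l g m : ℝ} (hC₀ : 0 < C₀) (hK1 : 1 ≤ K) (hKC₀ : C₀ ≤ K)
    (hKC₂ : C₂ ≤ K) (hKA : C₀ * A ≤ K) (hKL : A ^ 2 * L * C₀ ≤ K)
    (hR : 0 < R) (hRA : R ≤ A) (hl : 0 < l) (hlL : l ≤ L) (hm : 0 < m) (hg1 : 1 ≤ g)
    (hgK : 10 * K ≤ g ^ 2)
    {f v : Pt → ℝ} (hfs : ContDiffOn ℝ (⊤ : ℕ∞) f (ball 0 R))
    (hfpos : ∀ x ∈ ball (0 : Pt) R, 0 < f x)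
    (hf0 : C₀⁻¹ ≤ f 0 ∧ f 0 ≤ C₀)
    (hf1 : ∀ x ∈ ball (0 : Pt) R, ‖gradient f x‖ ≤ C₀)
    (hvs : ContDiffOn ℝ (⊤ : ℕ∞) v (ball 0 R))
    (hvpos : ∀ x ∈ ball (0 : Pt) R, 0 < v x)
    (hveq : ∀ x ∈ ball (0 : Pt) R, lap v x = l * f x * v x * exp (v x ^ 2))
    (hv0 : v 0 = g) (hgrad0 : gradient v 0 = 0)
    (hmdef : m ^ 2 * (l * f 0 * g ^ 2 * exp (g ^ 2)) = 1)
    (hC₂bd : ∀ x ∈ ball (0 : Pt) R, ‖x‖ * ‖gradient v x‖ ≤ C₂ / g)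
    {b : ℝ → ℝ} (hbs : ContDiff ℝ (⊤ : ℕ∞) b) (hb0 : b 0 = g) (hb0' : deriv b 0 = 0)
    (hbode : ∀ r > (0 : ℝ), deriv (deriv b) r + deriv b r / r
      = -(l * f 0 * b r * exp (b r ^ 2))) :
    ∃ d : Cyl K, d.γ = g ∧ d.Y = log (R / m) ∧ d.u = (fun y θ => v (polar m y θ)) ∧
      d.β = (fun y => b (m * exp y)) ∧ d.dβ = fun y => m * exp y * deriv b (m * exp y) := by
  have hg : 0 < g := by linarith
  have hf0pos : 0 < f 0 := (inv_pos.2 hC₀).trans_le hf0.1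
  have hA : 0 < A := hR.trans_le hRA
  have hK0 : 0 < K := by linarith
  have hvd : ∀ x ∈ ball (0 : Pt) R, DifferentiableAt ℝ v x := fun x hx =>
    (hvs.contDiffAt (isOpen_ball.mem_nhds hx)).differentiableAt (by simp)
  have hfd : ∀ x ∈ ball (0 : Pt) R, DifferentiableAt ℝ f x := fun x hx =>
    (hfs.contDiffAt (isOpen_ball.mem_nhds hx)).differentiableAt (by simp)
  have hmem : ∀ y < log (R / m), ∀ θ, polar m y θ ∈ ball (0 : Pt) R :=
    fun y hy θ => polar_mem_ball hm hR hy θ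
  have hk : ∀ y, exp (2 * y - g ^ 2) / (f 0 * g ^ 2) = l * (m * exp y) ^ 2 := fun y => by
    rw [exp_sub, two_mul, exp_add, div_div, div_eq_iff (by positivity)]
    linear_combination -exp y ^ 2 * hmdef
  have hr : ∀ y, m * exp y = R * exp (y - log (R / m)) := fun y => by
    rw [exp_sub, exp_log (by positivity)]
    field_simp
  have hCr : ∀ y, C₀ * (m * exp y) ≤ K * exp (y - log (R / m)) := fun y => by
    rw [hr, ← mul_assoc]
    gcongr
    exact (mul_le_mul_of_nonneg_left hRA hC₀.le).trans hKA
  have hmul : ∀ y < log (R / m), ∀ θ, m * exp y * ‖gradient v (polar m y θ)‖ ≤ K / g := by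
    intro y hy θ
    have := hC₂bd _ (hmem y hy θ)
    rw [norm_polar hm] at this
    exact this.trans (by gcongr)
  have hbd : Differentiable ℝ b := hbs.differentiable (by simp)
  have hbd' : Differentiable ℝ (deriv b) :=
    ((contDiff_infty_iff_deriv.1 hbs).2).differentiable (by simp)
  have hexp : ∀ y, HasDerivAt (fun y => m * exp y) (m * exp y) y := fun y =>
    (Real.hasDerivAt_exp y).const_mul m
  refine ⟨
    { γ := g
      φ := f 0
      Y := log (R / m)
      u := fun y θ => v (polar m y θ)
      F := fun y θ => f (polar m y θ)
      β := fun y => b (m * exp y)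
      dβ := fun y => m * exp y * deriv b (m * exp y)
      one_le_K := hK1
      one_le_γ := hg1
      γ_sq := hgK
      le_φ := (inv_anti₀ hC₀ hKC₀).trans hf0.1
      φ_le := hf0.2.trans hKC₀
      Y_bd := ?_
      su := sm_polar hm hR hvs
      sF := sm_polar hm hR hfs
      pu := fun y _ θ => by simp only [polar_periodic m y θ]
      u_pos := fun y hy θ => hvpos _ (hmem y hy θ)
      F_pos := fun y hy θ => hfpos _ (hmem y hy θ)
      pde := fun y hy θ => ?_
      u_y := fun y hy θ => (abs_pdy_polar_le hm (hvd _ (hmem y hy θ))).trans (hmul y hy θ)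
      u_t := fun y hy θ => (abs_pdt_polar_le hm (hvd _ (hmem y hy θ))).trans (hmul y hy θ)
      F_sub := fun y hy θ => ?_
      F_t := fun y hy θ => (abs_pdt_polar_le hm (hfd _ (hmem y hy θ))).trans ?_
      init := fun ε hε => by
        have := polar_init hm hR hvs hgrad0 hε
        rwa [hv0] at this
      hβ := fun y => ?_
      hdβ := fun y => ?_
      initβ := fun ε hε => by
        have := radial_init hm hbs hb0' hε
        rwa [hb0] at this }, rfl, rfl, rfl, rfl, rfl⟩
  · have h1 : exp (2 * log (R / m) - g ^ 2) = R ^ 2 * (l * f 0) * g ^ 2 := by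
      have := hk (log (R / m))
      rw [div_eq_iff (by positivity), exp_log (by positivity), mul_div_cancel₀ _ hm.ne'] at this
      rw [this]
      ring
    rw [h1]
    gcongr
    calc R ^ 2 * (l * f 0) ≤ A ^ 2 * (L * C₀) := by
          gcongr
          · exact hl.le.trans hlL
          · exact hf0.2
      _ = A ^ 2 * L * C₀ := by ring
      _ ≤ K := hKL
  · rw [laplacian_polar hm hR hvs hy, hveq _ (hmem y hy θ), hk]
    ring
  · have h0 := mem_ball_self (x := (0 : Pt)) hR
    have := (convex_ball (0 : Pt) R).norm_image_sub_le_of_norm_fderiv_le (𝕜 := ℝ) hfd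
      (fun x hx => (norm_fderiv_eq_norm_gradient f x).trans_le (hf1 x hx)) h0 (hmem y hy θ)
    rw [sub_zero, norm_polar hm, Real.norm_eq_abs] at this
    exact this.trans (hCr y)
  · rw [mul_comm]
    refine le_trans ?_ (hCr y)
    gcongr
    exact hf1 _ (hmem y hy θ)
  · rw [mul_comm]
    exact (hbd _).hasDerivAt.comp y (hexp y)
  · have h1 := (hexp y).mul ((hbd' (m * exp y)).hasDerivAt.comp y (hexp y))
    refine h1.congr_deriv ?_
    have hpos : 0 < m * exp y := by positivity
    have h2 := hbode _ hpos
    rw [hk]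
    have h3 : deriv b (m * exp y) = m * exp y * (deriv b (m * exp y) / (m * exp y)) := by
      field_simp
    simp only [Function.comp]
    rw [h3]
    linear_combination (m * exp y) ^ 2 * h2

theorem conv_polar {γ μ : ℕ → ℝ} {v : ℕ → Pt → ℝ}
    (hconv : TendstoCkLocOn (fun n x => γ n * (v n (μ n • x) - γ n)) Ustd Set.univ 2) (S : ℝ)
    {ε : ℝ} (hε : 0 < ε) : ∀ᶠ n in atTop, ∀ y ≤ S, ∀ θ,
      |γ n * (v n (polar (μ n) y θ) - γ n) + log (1 + exp (2 * y) / 4)| ≤ ε := by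
  have h1 := hconv 0 (by norm_num)
  have h2 := (tendstoLocallyUniformlyOn_iff_forall_isCompact isOpen_univ).1 h1
    (closedBall 0 (exp S)) (subset_univ _) (isCompact_closedBall _ _)
  filter_upwards [Metric.tendstoUniformlyOn_iff.1 h2 ε hε] with n hn y hy θ
  have hx : polar 1 y θ ∈ closedBall (0 : Pt) (exp S) := by
    rw [mem_closedBall_zero_iff, norm_polar one_pos, one_mul]
    exact exp_le_exp.2 hy
  have h3 := (hn _ hx).le
  simp only [iteratedFDeriv_zero_eq_comp, Function.comp, LinearIsometryEquiv.dist_map] at h3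
  rw [dist_comm, Real.dist_eq, Ustd, norm_polar one_pos, one_mul, sub_neg_eq_add] at h3
  have e1 : μ n • polar 1 y θ = polar (μ n) y θ := by
    rw [polar, polar, one_mul, smul_smul]
  rwa [e1, ← exp_nat_mul, Nat.cast_ofNat] at h3

theorem gradient_radial_zero {b : ℝ → ℝ} (hb : Differentiable ℝ b) (h0 : deriv b 0 = 0) :
    HasGradientAt (fun y : Pt => b ‖y‖) 0 0 := by
  rw [hasGradientAt_iff_isLittleO]
  have h1 := (hb 0).hasDerivAt
  rw [h0, hasDerivAt_iff_isLittleO] at h1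
  have ht : Tendsto (fun y : Pt => ‖y‖) (𝓝 0) (𝓝 0) := by
    simpa using (continuous_norm (E := Pt)).tendsto 0
  have h2 := (h1.comp_tendsto ht).norm_right
  simp only [Function.comp_def, sub_zero, smul_zero, norm_norm] at h2
  simpa using h2.of_norm_right

theorem gradient_sub_radial_le {m y θ M : ℝ} (hm : 0 < m) {w : Pt → ℝ}
    {b : ℝ → ℝ} (hb : Differentiable ℝ b) (hw : DifferentiableAt ℝ w (polar m y θ))
    (h1 : |pdy (fun y θ => w (polar m y θ)) y θ - m * exp y * deriv b (m * exp y)|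
      ≤ M * (m * exp y))
    (h2 : |pdt (fun y θ => w (polar m y θ)) y θ| ≤ M * (m * exp y)) :
    ‖gradient w (polar m y θ) - gradient (fun x => b ‖x‖) (polar m y θ)‖ ≤ 2 * M := by
  set x := polar m y θ with hx
  have hr : 0 < m * exp y := by positivity
  have hx0 : x ≠ 0 := by rw [← norm_pos_iff, hx, norm_polar hm]; exact hr
  have hn : DifferentiableAt ℝ (fun x : Pt => b ‖x‖) x :=
    (hb _).comp x (differentiableAt_id.norm ℝ hx0)
  have p1 : fderiv ℝ (fun x : Pt => b ‖x‖) x (polar m y θ) = m * exp y * deriv b (m * exp y) := by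
    rw [hx, ← pdy_polar hn]
    simp only [pdy, norm_polar hm]
    rw [mul_comm]
    exact ((hb _).hasDerivAt.comp y ((Real.hasDerivAt_exp y).const_mul m)).deriv
  have p2 : fderiv ℝ (fun x : Pt => b ‖x‖) x (polarPerp m y θ) = 0 := by
    rw [hx, ← pdt_polar hn]
    unfold pdt
    simp only [norm_polar hm, deriv_const]
  rw [pdy_polar hw, ← p1, ← hx] at h1
  rw [pdt_polar hw, ← sub_zero (fderiv ℝ w _ _), ← hx, ← p2] at h2
  set G := fderiv ℝ w x - fderiv ℝ (fun x : Pt => b ‖x‖) x with hG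
  have e := norm_sq_mul_polar (m := m) y θ G
  rw [gradient, gradient, ← map_sub, ← hG]
  set N := ‖(InnerProductSpace.toDual ℝ Pt).symm G‖ with hN
  have hN0 : 0 ≤ N := norm_nonneg _
  have q1 : G (polar m y θ) ^ 2 ≤ (M * (m * exp y)) ^ 2 := sq_le_sq' (abs_le.1 h1).1 (abs_le.1 h1).2
  have q2 : G (polarPerp m y θ) ^ 2 ≤ (M * (m * exp y)) ^ 2 :=
    sq_le_sq' (abs_le.1 h2).1 (abs_le.1 h2).2
  have hM : 0 ≤ M := by
    have := (abs_nonneg _).trans h1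
    exact nonneg_of_mul_nonneg_left this hr
  have : (m * exp y * N) ^ 2 ≤ (m * exp y * (2 * M)) ^ 2 := by
    have : 0 ≤ (M * (m * exp y)) ^ 2 := sq_nonneg _
    nlinarith
  exact le_of_mul_le_mul_left (abs_le_of_sq_le_sq' this (by positivity)).2 hr

theorem stmt6
    (ρ lam γ μ : ℕ → ℝ) (C₀ C₁ C₂ : ℝ) (hC₀ : 0 < C₀)
    (hρpos : ∀ n, 0 < ρ n) (hρbd : ∃ A : ℝ, ∀ n, ρ n ≤ A)
    (hlampos : ∀ n, 0 < lam n) (hlambd : ∃ A : ℝ, ∀ n, lam n ≤ A)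
    (f : ℕ → Pt → ℝ)
    (hfs : ∀ n, ContDiffOn ℝ (⊤ : ℕ∞) (f n) (ball 0 (ρ n)))
    (hfpos : ∀ n, ∀ x ∈ ball (0 : Pt) (ρ n), 0 < f n x)
    (hf0 : ∀ n, C₀⁻¹ ≤ f n 0 ∧ f n 0 ≤ C₀)
    (hf1 : ∀ n, ∀ x ∈ ball (0 : Pt) (ρ n), ‖gradient (f n) x‖ ≤ C₀)
    (hf2 : ∀ n, ∀ x ∈ ball (0 : Pt) (ρ n), ‖iteratedFDeriv ℝ 2 (f n) x‖ ≤ C₀)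
    (v : ℕ → Pt → ℝ)
    (hvs : ∀ n, ContDiffOn ℝ (⊤ : ℕ∞) (v n) (ball 0 (ρ n)))
    (hvpos : ∀ n, ∀ x ∈ ball (0 : Pt) (ρ n), 0 < v n x)
    (hveq : ∀ n, ∀ x ∈ ball (0 : Pt) (ρ n),
      lap (v n) x = lam n * f n x * v n x * Real.exp ((v n x) ^ 2))
    (hγdef : ∀ n, v n 0 = γ n) (hγ : Tendsto γ atTop atTop)
    (hgrad0 : ∀ n, gradient (v n) 0 = 0)
    (hμpos : ∀ n, 0 < μ n)
    (hμdef : ∀ n, (μ n) ^ 2 * (lam n * f n 0 * (γ n) ^ 2 * Real.exp ((γ n) ^ 2)) = 1)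
    (hμinf : Tendsto (fun n => ((μ n) ^ 2)⁻¹) atTop atTop)
    (hρμ : Tendsto (fun n => ρ n / μ n) atTop atTop)
    (hconv : TendstoCkLocOn (fun n x => γ n * (v n (μ n • x) - γ n)) Ustd Set.univ 2)
    (hC₁bd : ∀ n, ∀ x ∈ ball (0 : Pt) (ρ n),
      lam n * ‖x‖ ^ 2 * (v n x) ^ 2 * Real.exp ((v n x) ^ 2) ≤ C₁)
    (hC₂bd : ∀ n, ∀ x ∈ ball (0 : Pt) (ρ n), ‖x‖ * ‖gradient (v n) x‖ ≤ C₂ / γ n)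
    (B : ℕ → ℝ → ℝ)
    (hBs : ∀ n, ContDiff ℝ (⊤ : ℕ∞) (B n))
    (hB0 : ∀ n, B n 0 = γ n) (hB0' : ∀ n, deriv (B n) 0 = 0)
    (hBode : ∀ n, ∀ r > (0 : ℝ), deriv (deriv (B n)) r + deriv (B n) r / r
      = -(lam n * f n 0 * B n r * Real.exp ((B n r) ^ 2)))
    :
    ∃ Cc : ℝ, 0 < Cc ∧ ∀ᶠ n in atTop, ∀ x ∈ ball (0 : Pt) (ρ n),
      |v n x - B n ‖x‖| ≤ Cc / γ n ∧
      ‖gradient (v n) x - gradient (fun y => B n ‖y‖) x‖ ≤ Cc / (γ n * ρ n) := by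
  obtain ⟨A, hA⟩ := hρbd
  obtain ⟨L, hL⟩ := hlambd
  have hA0 : 0 < A := (hρpos 0).trans_le (hA 0)
  have hL0 : 0 < L := (hlampos 0).trans_le (hL 0)
  set K := 1 + C₀ + |C₂| + C₀ * A + A ^ 2 * L * C₀ with hK
  have k1 : 0 < C₀ * A := by positivity
  have k2 : 0 < A ^ 2 * L * C₀ := by positivity
  have k3 := abs_nonneg C₂
  have k4 := le_abs_self C₂
  obtain ⟨N, hN⟩ := eventually_atTop.1
    ((hγ.eventually_ge_atTop 1).and (hγ.eventually_ge_atTop (10 * K)))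
  have hcyl : ∀ n, ∃ d : Cyl K, d.γ = γ (n + N) ∧ d.Y = log (ρ (n + N) / μ (n + N)) ∧
      d.u = (fun y θ => v (n + N) (polar (μ (n + N)) y θ)) ∧
      d.β = (fun y => B (n + N) (μ (n + N) * exp y)) ∧
      d.dβ = fun y => μ (n + N) * exp y * deriv (B (n + N)) (μ (n + N) * exp y) := by
    intro n
    obtain ⟨g1, g2⟩ := hN (n + N) (Nat.le_add_left _ _)
    exact exists_cyl hC₀ (by linarith) (by linarith) (by linarith) (by linarith) (by linarith)
      (hρpos _) (hA _) (hlampos _) (hL _) (hμpos _) g1 (by nlinarith) (hfs _) (hfpos _) (hf0 _)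
      (hf1 _) (hvs _) (hvpos _) (hveq _) (hγdef _) (hgrad0 _) (hμdef _) (hC₂bd _) (hBs _)
      (hB0 _) (hB0' _) (hBode _)
  choose d dγ dY du dβ ddβ using hcyl
  have hadm : Adm d := by
    refine ⟨?_, ?_, fun S ε hε => ?_⟩
    · simp only [dγ]
      exact hγ.comp (tendsto_add_atTop_nat N)
    · simp only [dY]
      exact (tendsto_log_atTop.comp hρμ).comp (tendsto_add_atTop_nat N)
    · filter_upwards [(tendsto_add_atTop_nat N).eventually (conv_polar hconv S hε)] with n hn y hy θ
      rw [dγ, du]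
      exact hn y hy θ
  obtain ⟨C, hC, hmain⟩ := hadm.main
  refine ⟨2 * C, by positivity, ?_⟩
  obtain ⟨N', hN'⟩ := eventually_atTop.1 hmain
  filter_upwards [eventually_ge_atTop (N' + N)] with n hn x hx
  obtain ⟨j, rfl⟩ : ∃ j, n = j + N := ⟨n - N, by omega⟩
  have hj := hN' j (by omega)
  rw [dγ, dY, du, dβ, ddβ] at hj
  have hg1 := (hN (j + N) (Nat.le_add_left _ _)).1
  generalize j + N = n at hj hx hg1
  have hg : 0 < γ n := by linarith
  have hρn := hρpos n
  have hμn := hμpos n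
  by_cases hx0 : x = 0
  · subst hx0
    rw [(gradient_radial_zero ((hBs n).differentiable (by simp)) (hB0' n)).gradient, hgrad0,
      norm_zero, hγdef, hB0, sub_self, sub_self, abs_zero, norm_zero]
    exact ⟨by positivity, by positivity⟩
  obtain ⟨y, θ, rfl⟩ := exists_eq_polar hμn hx0
  have hlt : μ n * exp y < ρ n := by rwa [mem_ball_zero_iff, norm_polar hμn] at hx
  have hyY : y < log (ρ n / μ n) := by
    rw [Real.lt_log_iff_exp_lt (by positivity), lt_div_iff₀ hμn]
    linarith
  have hE : exp (y - log (ρ n / μ n)) = μ n * exp y / ρ n := by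
    rw [exp_sub, exp_log (by positivity)]
    field_simp
  obtain ⟨m1, m2, m3⟩ := hj y hyY θ
  rw [norm_polar hμn]
  constructor
  · rw [le_div_iff₀ hg, mul_comm]
    refine m1.trans ?_
    have : exp (y - log (ρ n / μ n)) ≤ 1 := exp_le_one_iff.2 (by linarith)
    nlinarith
  · have hdiv : ∀ {a : ℝ}, γ n * |a| ≤ C * exp (y - log (ρ n / μ n)) →
        |a| ≤ C / (γ n * ρ n) * (μ n * exp y) := fun {a} h => by
      rw [hE] at h
      have e : C / (γ n * ρ n) * (μ n * exp y) = C * (μ n * exp y / ρ n) / γ n := by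
        field_simp
      rw [e, le_div_iff₀ hg]
      linarith
    have hvd : DifferentiableAt ℝ (v n) (polar (μ n) y θ) :=
      ((hvs n).contDiffAt (isOpen_ball.mem_nhds hx)).differentiableAt (by simp)
    have := gradient_sub_radial_le hμn ((hBs n).differentiable (by simp)) hvd (hdiv m2) (hdiv m3)
    exact this.trans_eq (by ring)

end
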